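/- For every n and every degree i ≥ 0 with 2i ≤ n − 6, the group cohomology H^i(Out(F_n); H^*) is zero, where H^* is the dual of the abelianization of the free group F_n with its natural Out(F_n)-action. -/

import Mathlib

open CategoryTheory

noncomputable section

abbrev FreeGrp (n : ℕ) : Type := FreeGroup (Fin n)
abbrev AutF (n : ℕ) : Type := MulAut (FreeGrp n)
abbrev AbH (n : ℕ) : Type := Additive (Abelianization (FreeGrp n))

def abRep (n : ℕ) : Representation ℤ (AutF n) (AbH n) where
  toFun φ := (MonoidHom.toAdditive (Abelianization.map φ.toMonoidHom)).toIntLinearMap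
  map_one' := by
    ext x
    show MonoidHom.toAdditive (Abelianization.map (MulEquiv.toMonoidHom (1 : AutF n))) x = x
    rw [show MulEquiv.toMonoidHom (1 : AutF n) = MonoidHom.id _ from rfl, Abelianization.map_id]
    rfl
  map_mul' φ ψ := by
    ext x
    show MonoidHom.toAdditive (Abelianization.map (MulEquiv.toMonoidHom (φ * ψ))) x =
      MonoidHom.toAdditive (Abelianization.map φ.toMonoidHom)
        (MonoidHom.toAdditive (Abelianization.map ψ.toMonoidHom) x)
    rw [show MulEquiv.toMonoidHom (φ * ψ) = φ.toMonoidHom.comp ψ.toMonoidHom from rfl,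
      ← Abelianization.map_comp]
    rfl

/-- The subgroup of inner automorphisms of the free group. -/
def InnF (n : ℕ) : Subgroup (AutF n) := (MulAut.conj (G := FreeGrp n)).range

instance innF_normal (n : ℕ) : (InnF n).Normal := by
  constructor
  rintro x ⟨g, rfl⟩ φ
  refine ⟨φ g, ?_⟩
  ext h
  simp only [MulAut.conj_apply, MulAut.mul_apply, MulAut.inv_def, map_mul, map_inv,
    MulEquiv.apply_symm_apply]

/-- The outer automorphism group `Out(F_n) = Aut(F_n)/Inn(F_n)`. -/
abbrev OutF (n : ℕ) : Type := AutF n ⧸ InnF n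

/-- Inner automorphisms act trivially on the abelianization. -/
lemma abRep_inn {n : ℕ} (x : AutF n) (hx : x ∈ InnF n) : abRep n x = 1 := by
  obtain ⟨g, rfl⟩ := hx
  ext y
  show MonoidHom.toAdditive (Abelianization.map (MulAut.conj g).toMonoidHom) y = y
  have : Abelianization.map (MulAut.conj g).toMonoidHom = MonoidHom.id _ := by
    apply Abelianization.hom_ext
    apply MonoidHom.ext
    intro z
    show Abelianization.map (MulAut.conj g).toMonoidHom (Abelianization.of z) =
      Abelianization.of z
    rw [Abelianization.map_of]
    show Abelianization.of (g * z * g⁻¹) = Abelianization.of z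
    rw [map_mul, map_mul, mul_comm (Abelianization.of g) (Abelianization.of z), mul_assoc,
      ← map_mul, mul_inv_cancel, map_one, mul_one]
  rw [this]
  rfl

/-- The action of `Out(F_n)` on the abelianization, through which the `Aut(F_n)`-action
factors. -/
def abRepOut (n : ℕ) : Representation ℤ (OutF n) (AbH n) :=
  QuotientGroup.lift (InnF n) (abRep n) abRep_inn

/-- The dual module `H^* = Hom_ℤ(H, ℤ)` with the contragredient `Out(F_n)`-action,
as an object of `Rep ℤ (Out F_n)`. -/
def dualRepOut (n : ℕ) : Rep ℤ (OutF n) := Rep.of (abRepOut n).dual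

namespace WordCx

open Finsupp

section Chains

variable {V W : Type*}

/-- The simplicial boundary of a word: the alternating sum of its faces. -/
def bd : List V → (List V →₀ ℤ)
  | [] => 0
  | a :: s => single s 1 - mapDomain (List.cons a) (bd s)

/-- The boundary operator on chains of words. -/
def bdL : (List V →₀ ℤ) →ₗ[ℤ] (List V →₀ ℤ) := linearCombination ℤ bd

@[simp] lemma bdL_single (s : List V) (k : ℤ) : bdL (single s k) = k • bd s := by
  simp [bdL]

/-- Put a letter in front of every word of a chain. -/
def consL (a : V) : (List V →₀ ℤ) →ₗ[ℤ] (List V →₀ ℤ) := lmapDomain ℤ ℤ (List.cons a)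

lemma consL_apply (a : V) (x : List V →₀ ℤ) : consL a x = mapDomain (List.cons a) x := rfl

@[simp] lemma consL_single (a : V) (s : List V) (k : ℤ) :
    consL a (single s k) = single (a :: s) k := by
  simp [consL]

lemma bd_cons (a : V) (s : List V) : bd (a :: s) = single s 1 - consL a (bd s) := rfl

lemma bdL_consL (a : V) (x : List V →₀ ℤ) : bdL (consL a x) = x - consL a (bdL x) := by
  have : bdL ∘ₗ consL a = LinearMap.id - consL a ∘ₗ bdL := by
    ext1 s
    ext1
    simp [bd_cons]
  exact congrArg (fun f => f x) this

lemma bdL_bd (s : List V) : bdL (bd s) = 0 := by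
  induction s with
  | nil => simp [bd]
  | cons a s ih => simp [bd_cons, bdL_consL, ih]

lemma bdL_bdL (x : List V →₀ ℤ) : bdL (bdL x) = 0 := by
  have : bdL ∘ₗ bdL = (0 : (List V →₀ ℤ) →ₗ[ℤ] _) := by
    ext1 s
    ext1
    simp [bdL_bd]
  exact congrArg (fun f => f x) this

lemma bd_support (s : List V) :
    bd s ∈ supported ℤ ℤ {t : List V | t.Sublist s ∧ t.length + 1 = s.length} := by
  induction s with
  | nil => simp [bd]
  | cons a s ih =>
    rw [bd_cons]
    refine Submodule.sub_mem _ (single_mem_supported _ _ ?_) ?_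
    · simp
    · rw [consL_apply]
      rw [mem_supported] at ih ⊢
      intro t ht
      classical
      obtain ⟨u, hu, rfl⟩ := Finset.mem_image.1 (mapDomain_support ht)
      obtain ⟨h1, h2⟩ := ih hu
      exact ⟨h1.cons_cons a, by simpa using h2⟩

/-- The set of words is closed under passing to subwords. -/
def FaceClosed (X : Set (List V)) : Prop := ∀ ⦃s t : List V⦄, t.Sublist s → s ∈ X → t ∈ X

/-- Chains of words of length `p` lying in `X`. -/
def Ch (X : Set (List V)) (p : ℕ) : Submodule ℤ (List V →₀ ℤ) :=
  supported ℤ ℤ {s | s ∈ X ∧ s.length = p}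

lemma single_mem_Ch {X : Set (List V)} {s : List V} (hs : s ∈ X) (k : ℤ) :
    single s k ∈ Ch X s.length := single_mem_supported _ _ ⟨hs, rfl⟩

lemma Ch_mono {X Y : Set (List V)} (h : X ⊆ Y) (p : ℕ) : Ch X p ≤ Ch Y p :=
  supported_mono fun _ hs => ⟨h hs.1, hs.2⟩

/-- A linear map sending the basis words of `Ch X p` to `N` sends `Ch X p` to `N`. -/
lemma map_mem_of_single {X : Set (List V)} {p : ℕ} {M : Type*} [AddCommGroup M]
    (f : (List V →₀ ℤ) →ₗ[ℤ] M) (N : Submodule ℤ M)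
    (h : ∀ s ∈ X, s.length = p → f (single s 1) ∈ N) {x : List V →₀ ℤ} (hx : x ∈ Ch X p) :
    f x ∈ N := by
  rw [← Finsupp.sum_single x, Finsupp.sum, map_sum]
  refine Submodule.sum_mem _ fun s hs => ?_
  have := (mem_supported _ _).1 hx hs
  rw [← mul_one (x s), ← smul_eq_mul, ← smul_single, map_smul]
  exact N.smul_mem _ (h s this.1 this.2)

lemma eq_of_single {X : Set (List V)} {p : ℕ} {M : Type*} [AddCommGroup M]
    (f g : (List V →₀ ℤ) →ₗ[ℤ] M)
    (h : ∀ s ∈ X, s.length = p → f (single s 1) = g (single s 1)) {x : List V →₀ ℤ}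
    (hx : x ∈ Ch X p) : f x = g x := by
  have := map_mem_of_single (f - g) ⊥ (fun s hs hp => by simp [h s hs hp]) hx
  simpa [sub_eq_zero] using this

lemma bd_mem_Ch {X : Set (List V)} (hX : FaceClosed X) {s : List V} (hs : s ∈ X) {p : ℕ}
    (hp : s.length = p + 1) : bd s ∈ Ch X p :=
  (supported_mono (s := {t : List V | t.Sublist s ∧ t.length + 1 = s.length})
    fun _ ht => And.intro (hX ht.1 hs) (by have := ht.2; omega)) (bd_support s)

lemma bdL_mem {X : Set (List V)} (hX : FaceClosed X) {p : ℕ} {x : List V →₀ ℤ}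
    (hx : x ∈ Ch X (p + 1)) : bdL x ∈ Ch X p :=
  map_mem_of_single bdL _ (fun s hs hp => by simpa using bd_mem_Ch hX hs hp) hx

lemma bdL_zero {X : Set (List V)} {x : List V →₀ ℤ} (hx : x ∈ Ch X 0) : bdL x = 0 := by
  have := map_mem_of_single bdL ⊥ (fun s _ hp => by
    rw [List.length_eq_zero_iff] at hp; simp [hp, bd]) hx
  simpa using this

/-- Exactness of the augmented chain complex of `X` at words of length `p`. -/
def Ex (X : Set (List V)) (p : ℕ) : Prop :=
  ∀ x ∈ Ch X p, bdL x = 0 → ∃ y ∈ Ch X (p + 1), bdL y = x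

lemma Ex_empty (p : ℕ) : Ex (∅ : Set (List V)) p := by
  intro x hx _
  refine ⟨0, zero_mem _, ?_⟩
  have : x = 0 := by simpa [Ch] using hx
  simp [this]

lemma Ex_cone {X : Set (List V)} (a : V) (h : ∀ s ∈ X, a :: s ∈ X) (p : ℕ) : Ex X p := by
  intro x hx h0
  refine ⟨consL a x, ?_, by simp [bdL_consL, h0]⟩
  refine map_mem_of_single (consL a) _ (fun s hs hp => ?_) hx
  rw [consL_single, ← hp]
  exact single_mem_Ch (h s hs) 1

lemma Ex_union {A B : Set (List V)} (hA : FaceClosed A) (hB : FaceClosed B) {p : ℕ}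
    (eA : Ex A p) (eB : Ex B p) (eI : ∀ q, q + 1 = p → Ex (A ∩ B) q) : Ex (A ∪ B) p := by
  intro x hx h0
  have hsup : x ∈ Ch A p ⊔ Ch B p := by
    have : Ch (A ∪ B) p = Ch A p ⊔ Ch B p := by
      rw [Ch, Ch, Ch, ← supported_union]
      congr 1
      ext s
      simp only [Set.mem_union, Set.mem_ofPred_eq]
      tauto
    rwa [← this]
  obtain ⟨a, ha, b, hb, rfl⟩ := Submodule.mem_sup.1 hsup
  obtain ⟨w, hwA, hwB, hw⟩ : ∃ w, w ∈ Ch A p ∧ w ∈ Ch B p ∧ bdL w = bdL a := by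
    cases p with
    | zero => exact ⟨0, zero_mem _, zero_mem _, by rw [bdL_zero ha, map_zero]⟩
    | succ q =>
      have hab : bdL a = - bdL b := by
        rw [map_add] at h0; exact eq_neg_of_add_eq_zero_left h0
      have hI : bdL a ∈ Ch (A ∩ B) q := by
        have h1 := bdL_mem hA ha
        have h2 : bdL a ∈ Ch B q := hab ▸ neg_mem (bdL_mem hB hb)
        rw [Ch, mem_supported] at *
        exact fun s hs => ⟨⟨(h1 hs).1, (h2 hs).1⟩, (h1 hs).2⟩
      obtain ⟨w, hw, hw'⟩ := eI q rfl _ hI (bdL_bdL _)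
      exact ⟨w, Ch_mono Set.inter_subset_left _ hw, Ch_mono Set.inter_subset_right _ hw, hw'⟩
  obtain ⟨y, hy, hya⟩ := eA (a - w) (sub_mem ha hwA) (by rw [map_sub, hw, sub_self])
  obtain ⟨z, hz, hzb⟩ := eB (b + w) (add_mem hb hwB) (by
    rw [map_add, hw, add_comm, ← map_add, h0])
  refine ⟨y + z, add_mem (Ch_mono Set.subset_union_left _ hy)
    (Ch_mono Set.subset_union_right _ hz), ?_⟩
  rw [map_add, hya, hzb]
  abel

lemma Ex_directed {ι : Type*} {X : ι → Set (List V)} (hd : Directed (· ⊆ ·) X) {p : ℕ}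
    (h : ∀ i, Ex (X i) p) : Ex (⋃ i, X i) p := by
  intro x hx h0
  rcases isEmpty_or_nonempty ι with hι | hι
  · exact Ex_empty p x (by simpa using hx) h0 |>.imp fun y hy => ⟨by simpa using hy.1, hy.2⟩
  · have hfin : ∀ F : Finset (List V), (∀ s ∈ F, s ∈ ⋃ i, X i) → ∃ i, ∀ s ∈ F, s ∈ X i := by
      classical
      intro F
      induction F using Finset.induction_on with
      | empty => exact fun _ => ⟨hι.some, by simp⟩
      | insert a F _ ih =>
        intro hF
        obtain ⟨i, hi⟩ := ih fun s hs => hF s (Finset.mem_insert_of_mem hs)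
        obtain ⟨j, hj⟩ := Set.mem_iUnion.1 (hF a (Finset.mem_insert_self _ _))
        obtain ⟨k, hik, hjk⟩ := hd i j
        refine ⟨k, fun s hs => ?_⟩
        rcases Finset.mem_insert.1 hs with rfl | hs
        · exact hjk hj
        · exact hik (hi s hs)
    obtain ⟨i, hi⟩ := hfin x.support fun s hs => ((mem_supported _ _).1 hx hs).1
    obtain ⟨y, hy, hyx⟩ := h i x ((mem_supported _ _).2 fun s hs =>
      ⟨hi s hs, ((mem_supported _ _).1 hx hs).2⟩) h0
    exact ⟨y, Ch_mono (Set.subset_iUnion X i) _ hy, hyx⟩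

/-- If `X` is exact in lengths `< q`, it has a contraction in these lengths. -/
lemma exists_contraction {X : Set (List V)} (hX : FaceClosed X) {q : ℕ}
    (h : ∀ p < q, Ex X p) : ∃ H : (List V →₀ ℤ) →ₗ[ℤ] (List V →₀ ℤ),
      (∀ p < q, ∀ x ∈ Ch X p, H x ∈ Ch X (p + 1)) ∧
      ∀ p < q, ∀ x ∈ Ch X p, bdL (H x) + H (bdL x) = x := by
  induction q with
  | zero => exact ⟨0, by simp, by simp⟩
  | succ q ih =>
    obtain ⟨H, h1, h2⟩ := ih fun p hp => h p (by omega)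
    have key : ∀ s : List V, ∃ y, (s ∈ X → s.length = q →
        y ∈ Ch X (q + 1) ∧ bdL y = single s 1 - H (bd s)) := by
      intro s
      by_cases hs : s ∈ X ∧ s.length = q
      · obtain ⟨hs, hq⟩ := hs
        have hmem : single s 1 - H (bd s) ∈ Ch X q := by
          refine sub_mem (hq ▸ single_mem_Ch hs 1) ?_
          cases q with
          | zero =>
            rw [List.length_eq_zero_iff] at hq; simp [hq, bd]
          | succ q => exact h1 q (by omega) _ (bd_mem_Ch hX hs hq)
        obtain ⟨y, hy, hy'⟩ := h q (by omega) _ hmem (by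
          rw [map_sub, bdL_single, one_smul, sub_eq_zero]
          cases q with
          | zero =>
            rw [List.length_eq_zero_iff] at hq; simp [hq, bd]
          | succ q =>
            have := h2 q (by omega) _ (bd_mem_Ch hX hs hq)
            rw [bdL_bd, map_zero, add_zero] at this
            exact this.symm)
        exact ⟨y, fun _ _ => ⟨hy, hy'⟩⟩
      · exact ⟨0, fun a b => (hs ⟨a, b⟩).elim⟩
    choose Y hY using key
    classical
    let H' : (List V →₀ ℤ) →ₗ[ℤ] (List V →₀ ℤ) :=
      linearCombination ℤ fun s => if s.length = q then Y s else H (single s 1)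
    have hlt : ∀ p < q, ∀ x ∈ Ch X p, H' x = H x := by
      intro p hp x hx
      refine eq_of_single H' H (fun s _ hs => ?_) hx
      simp [H', show s.length ≠ q by omega]
    have heq : ∀ s : List V, s.length = q → H' (single s 1) = Y s := by
      intro s hs; simp [H', hs]
    refine ⟨H', fun p hp x hx => ?_, fun p hp x hx => ?_⟩
    · rcases Nat.lt_succ_iff_lt_or_eq.1 hp with hp | rfl
      · rw [hlt p hp x hx]; exact h1 p hp x hx
      · exact map_mem_of_single H' _ (fun s hs hsp => by
          rw [heq s hsp]; exact (hY s hs hsp).1) hx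
    · rcases Nat.lt_succ_iff_lt_or_eq.1 hp with hp | rfl
      · rw [hlt p hp x hx]
        rw [show H' (bdL x) = H (bdL x) from ?_]
        · exact h2 p hp x hx
        · cases p with
          | zero => rw [bdL_zero hx, map_zero, map_zero]
          | succ p => exact hlt p (by omega) _ (bdL_mem hX hx)
      · have := eq_of_single (bdL ∘ₗ H' + H' ∘ₗ bdL) LinearMap.id (fun s hs hsp => ?_) hx
        · simpa using this
        · have h3 : H' (bd s) = H (bd s) := by
            cases p with
            | zero => rw [List.length_eq_zero_iff] at hsp; simp [hsp, bd]
            | succ p => exact hlt p (by omega) _ (bd_mem_Ch hX hs hsp)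
          simp [heq s hsp, (hY s hs hsp).2, h3]

end Chains

section Avoid

variable {V I : Type*}

/-- Words all of whose letters have index in `B`. -/
def WordsOver (L : Set V) (idx : V → I) (B : Finset I) : Set (List V) :=
  {s | ∀ x ∈ s, x ∈ L ∧ idx x ∈ B}

lemma WordsOver_faceClosed (L : Set V) (idx : V → I) (B : Finset I) :
    FaceClosed (WordsOver L idx B) := fun _ _ h hs x hx => hs x (h.subset hx)

lemma WordsOver_Ex {L : Set V} {idx : V → I} {B : Finset I}
    (hL : ∃ x ∈ L, idx x ∈ B) (p : ℕ) : Ex (WordsOver L idx B) p := by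
  obtain ⟨x, hx, hB⟩ := hL
  refine Ex_cone x (fun s hs => ?_) p
  intro y hy
  rcases List.mem_cons.1 hy with rfl | hy
  · exact ⟨hx, hB⟩
  · exact hs y hy

variable [DecidableEq I]

/-- Words that avoid some member of the list `E` of index sets. -/
def Avoiding (L : Set V) (idx : V → I) (B : Finset I) (E : List (Finset I)) : Set (List V) :=
  {s | ∃ e ∈ E, s ∈ WordsOver L idx (B \ e)}

lemma Avoiding_faceClosed (L : Set V) (idx : V → I) (B : Finset I) (E : List (Finset I)) :
    FaceClosed (Avoiding L idx B E) := fun _ _ h ⟨e, he, hs⟩ =>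
  ⟨e, he, WordsOver_faceClosed L idx _ h hs⟩

lemma Avoiding_Ex (L : Set V) (idx : V → I) (hL : ∀ i, ∃ x ∈ L, idx x = i) :
    ∀ (p : ℕ) (E : List (Finset I)) (B : Finset I),
      (∀ e ∈ E, e.Nonempty ∧ e.card ≤ 2) → 2 * p + 3 ≤ B.card → Ex (Avoiding L idx B E) p := by
  intro p
  induction p using Nat.strong_induction_on with
  | _ p ihp =>
  intro E
  induction E with
  | nil =>
    intro B _ _
    have : Avoiding L idx B [] = ∅ := by ext s; simp [Avoiding]
    rw [this]; exact Ex_empty p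
  | cons e E ih =>
    intro B hE hB
    have hE' : Ex (Avoiding L idx B E) p :=
      ih B (fun e he => hE e (List.mem_cons_of_mem _ he)) hB
    have hun : Avoiding L idx B (e :: E) = WordsOver L idx (B \ e) ∪ Avoiding L idx B E := by
      ext s; simp [Avoiding]
    have hcard : B.card - 2 ≤ (B \ e).card := by
      have := Finset.le_card_sdiff e B
      have := (hE e List.mem_cons_self).2
      omega
    by_cases hsub : ∃ e' ∈ E, e' ⊆ e
    · obtain ⟨e', he', hsub⟩ := hsub
      have : WordsOver L idx (B \ e) ⊆ Avoiding L idx B E := fun s hs =>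
        ⟨e', he', fun x hx => ⟨(hs x hx).1, Finset.sdiff_subset_sdiff le_rfl hsub (hs x hx).2⟩⟩
      rw [hun, Set.union_eq_self_of_subset_left this]
      exact hE'
    · rw [hun]
      push Not at hsub
      refine Ex_union (WordsOver_faceClosed _ _ _) (Avoiding_faceClosed _ _ _ _)
        (WordsOver_Ex ?_ p) hE' ?_
      · obtain ⟨i, hi⟩ : (B \ e).Nonempty := by
          rw [← Finset.card_pos]; omega
        obtain ⟨x, hx, rfl⟩ := hL i
        exact ⟨x, hx, hi⟩
      · rintro q rfl
        have hwa : WordsOver L idx (B \ e) ∩ Avoiding L idx B E =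
            Avoiding L idx (B \ e) (E.map (· \ e)) := by
          ext s
          simp only [Avoiding, WordsOver, Set.mem_inter_iff, Set.mem_ofPred_eq, List.mem_map,
            Finset.mem_sdiff]
          constructor
          · rintro ⟨h1, e', he', h2⟩
            refine ⟨_, ⟨e', he', rfl⟩, fun x hx => ⟨(h1 x hx).1, (h1 x hx).2, ?_⟩⟩
            simp only [Finset.mem_sdiff]
            exact fun h => (h2 x hx).2.2 h.1
          · rintro ⟨_, ⟨e', he', rfl⟩, h⟩
            refine ⟨fun x hx => ⟨(h x hx).1, (h x hx).2.1⟩, e', he',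
              fun x hx => ⟨(h x hx).1, (h x hx).2.1.1, fun h' => (h x hx).2.2 ?_⟩⟩
            simp only [Finset.mem_sdiff]
            exact ⟨h', (h x hx).2.1.2⟩
        rw [hwa]
        refine ihp q (by omega) _ _ (fun e'' he'' => ?_) (by omega)
        obtain ⟨e', he', rfl⟩ := List.mem_map.1 he''
        refine ⟨?_, (Finset.card_le_card Finset.sdiff_subset).trans
          (hE e' (List.mem_cons_of_mem _ he')).2⟩
        rw [Finset.sdiff_nonempty]
        exact hsub e' he'

end Avoid

end WordCx

namespace WordCx

/-- Two commuting differentials on an abelian group together with a bigrading. -/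
structure DoubleCx (E : Type*) [AddCommGroup E] where
  /-- the first differential -/
  dS : E →+ E
  /-- the second differential -/
  dX : E →+ E
  /-- the bigraded pieces -/
  D : ℕ → ℕ → AddSubgroup E
  dS_dS : ∀ x, dS (dS x) = 0
  dX_dX : ∀ x, dX (dX x) = 0
  comm : ∀ x, dS (dX x) = dX (dS x)
  dS_mem : ∀ {j p x}, x ∈ D j p → dS x ∈ D (j + 1) p
  dX_mem : ∀ {j p x}, x ∈ D j p → dX x ∈ D j (p + 1)

namespace DoubleCx

variable {E : Type*} [AddCommGroup E] (C : DoubleCx E)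

/-- Interchange the two differentials. -/
def flip : DoubleCx E where
  dS := C.dX
  dX := C.dS
  D j p := C.D p j
  dS_dS := C.dX_dX
  dX_dX := C.dS_dS
  comm x := (C.comm x).symm
  dS_mem h := C.dX_mem h
  dX_mem h := C.dS_mem h

/-- Exactness of the `j`-th row at `p + 1`. -/
def ExX (j p : ℕ) : Prop := ∀ c ∈ C.D j (p + 1), C.dX c = 0 → ∃ b ∈ C.D j p, C.dX b = c

/-- Exactness of the `j`-th row at `0`. -/
def InjX (j : ℕ) : Prop := ∀ c ∈ C.D j 0, C.dX c = 0 → c = 0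

/-- Exactness at `(j + 1, p + 1)` of the `dX`-complex of `dS`-cohomology. -/
def E2 (j p : ℕ) : Prop := ∀ y ∈ C.D (j + 1) (p + 1), C.dS y = 0 →
  (∃ b ∈ C.D j (p + 2), C.dX y = C.dS b) →
  ∃ z ∈ C.D (j + 1) p, C.dS z = 0 ∧ ∃ b ∈ C.D j (p + 1), y = C.dX z + C.dS b

/-- A `dX`-closed `dS`-boundary is the `dS`-boundary of a `dX`-closed element. -/
def ClosedLift (j p : ℕ) : Prop := ∀ v ∈ C.D j p, C.dX (C.dS v) = 0 →
  ∃ w ∈ C.D j p, C.dS w = C.dS v ∧ C.dX w = 0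

lemma closedLift_of (h0 : ∀ p, C.D 0 p = ⊥) : ∀ (j p : ℕ),
    (∀ a b, a + b + 1 = j + p → p ≤ b → C.E2 a b ∧ C.ExX a b) → C.ClosedLift j p
  | 0, p, _ => by
    intro v hv _
    rw [h0, AddSubgroup.mem_bot] at hv
    exact ⟨0, zero_mem _, by simp [hv]⟩
  | j + 1, p, h => by
    intro v hv hdv
    obtain ⟨hE, hX⟩ := h j p (by omega) le_rfl
    obtain ⟨z, hz, hz0, b, hb, hzb⟩ := hE (C.dX v) (C.dX_mem hv) (by rw [C.comm, hdv])
      ⟨0, zero_mem _, by rw [C.dX_dX, map_zero]⟩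
    obtain ⟨w, hw, hwb, hw0⟩ := closedLift_of h0 j (p + 1)
      (fun a b h1 h2 => h a b (by omega) (by omega)) b hb (by
        rw [show C.dS b = C.dX v - C.dX z by rw [hzb]; abel, ← map_sub, C.dX_dX])
    obtain ⟨x, hx, rfl⟩ := hX w hw hw0
    refine ⟨v - z - C.dS x, sub_mem (sub_mem hv hz) (C.dS_mem hx), ?_, ?_⟩
    · rw [map_sub, map_sub, hz0, C.dS_dS]; simp
    · rw [map_sub, map_sub, hzb, ← C.comm, hwb]; abel

lemma inj_of (h0 : ∀ p, C.D 0 p = ⊥) {i : ℕ}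
    (h : ∀ a b, a + b = i → 1 ≤ b → C.E2 a b ∧ C.ExX a b) (hX : C.ExX i 0)
    (hI : C.InjX (i + 1)) {c : E} (hc : c ∈ C.D (i + 1) 0)
    (hv : ∃ v ∈ C.D i 1, C.dX c = C.dS v) : ∃ b ∈ C.D i 0, C.dS b = c := by
  obtain ⟨v, hv, hcv⟩ := hv
  obtain ⟨w, hw, hwv, hw0⟩ := C.closedLift_of h0 i 1
    (fun a b h1 h2 => h a b (by omega) h2) v hv (by rw [← hcv, C.dX_dX])
  obtain ⟨b, hb, rfl⟩ := hX w hw hw0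
  refine ⟨b, hb, ?_⟩
  have := hI (c - C.dS b) (sub_mem hc (C.dS_mem hb)) (by
    rw [map_sub, ← C.comm, hwv, hcv, sub_self])
  exact (sub_eq_zero.1 this).symm

lemma surj_of (h0 : ∀ p, C.D 0 p = ⊥) {i : ℕ}
    (h : ∀ a b, a + b = i + 1 → 2 ≤ b → C.E2 a b ∧ C.ExX a b) (hX : C.ExX i 1)
    (hX' : C.ExX (i + 1) 0) (hI : C.InjX (i + 2)) {y : E} (hy : y ∈ C.D (i + 1) 1)
    (hy0 : C.dS y = 0) (hv : ∃ v ∈ C.D i 2, C.dX y = C.dS v) :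
    ∃ c ∈ C.D (i + 1) 0, C.dS c = 0 ∧ ∃ v ∈ C.D i 1, y = C.dX c + C.dS v := by
  obtain ⟨v, hv, hyv⟩ := hv
  obtain ⟨w, hw, hwv, hw0⟩ := C.closedLift_of h0 i 2
    (fun a b h1 h2 => h a b (by omega) h2) v hv (by rw [← hyv, C.dX_dX])
  obtain ⟨x, hx, rfl⟩ := hX w hw hw0
  obtain ⟨c, hc, hcy⟩ := hX' (y - C.dS x) (sub_mem hy (C.dS_mem hx)) (by
    rw [map_sub, ← C.comm, hwv, hyv, sub_self])
  refine ⟨c, hc, hI _ (C.dS_mem hc) ?_, x, hx, by rw [hcy]; abel⟩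
  rw [← C.comm, hcy, map_sub, hy0, C.dS_dS, sub_zero]

/-- The elements `n` and `l` on the two edges are joined by a staircase. -/
def Link (k : ℕ) (n l : E) : Prop := ∃ e : ℕ → E, (∀ j p, j + p = k → e j ∈ C.D j p) ∧
  (∀ j < k, C.dS (e j) = C.dX (e (j + 1))) ∧ e 0 = n ∧ e k = l

lemma link_flip {k : ℕ} {n l : E} (h : C.Link k n l) : C.flip.Link k l n := by
  obtain ⟨e, h1, h2, h3, h4⟩ := h
  refine ⟨fun j => e (k - j), fun j p hjp => ?_, fun j hj => ?_, by simpa using h4,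
    by simpa using h3⟩
  · have : p = k - j := by omega
    subst this
    exact h1 _ _ (by omega)
  · have := h2 (k - (j + 1)) (by omega)
    rw [show k - (j + 1) + 1 = k - j by omega] at this
    exact this.symm

/-- The lifting property used to build a staircase. -/
def Descend (j p : ℕ) : Prop := ∀ x ∈ C.D (j + 1) p, C.dS x = 0 ∨ 0 < p →
  C.dS (C.dX x) = 0 → ∃ z ∈ C.D (j + 1) p, C.dS z = 0 ∧ (p = 0 → z = 0) ∧
    ∃ y ∈ C.D j (p + 1), C.dX x = C.dX z + C.dS y

lemma exists_link_aux {k : ℕ} : ∀ (j p : ℕ), j + p = k →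
    (∀ a b, a + 1 + b = k → p ≤ b → C.Descend a b) → ∀ x ∈ C.D j p, (C.dS x = 0 ∨ 0 < p) →
    C.dS (C.dX x) = 0 → ∃ e : ℕ → E, (∀ a b, a + b = k → a ≤ j → e a ∈ C.D a b) ∧
      (∀ a < j, C.dS (e a) = C.dX (e (a + 1))) ∧ C.dS (e j) = C.dS x ∧ (p = 0 → e j = x)
  | 0, p, hk, _, x, hx, _, _ => ⟨fun _ => x, fun a b h1 h2 => by
      obtain rfl : a = 0 := by omega
      obtain rfl : b = p := by omega
      exact hx, by simp, rfl, fun _ => rfl⟩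
  | j + 1, p, hk, h, x, hx, hx1, hx0 => by
    obtain ⟨z, hz, hz0, hzp, y, hy, hxy⟩ := h j p (by omega) le_rfl x hx hx1 hx0
    obtain ⟨e, h1, h2, h3, -⟩ := exists_link_aux j (p + 1) (by omega)
      (fun a b ha hb => h a b ha (by omega)) y hy (Or.inr (by omega)) (by
        rw [C.comm, show C.dS y = C.dX x - C.dX z by rw [hxy]; abel, ← map_sub, C.dX_dX])
    refine ⟨fun a => if a ≤ j then e a else x - z, fun a b hab ha => ?_, fun a ha => ?_, ?_, ?_⟩
    · dsimp only
      split_ifs with haj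
      · exact h1 a b hab haj
      · obtain rfl : a = j + 1 := by omega
        obtain rfl : b = p := by omega
        exact sub_mem hx hz
    · dsimp only
      rw [if_pos (by omega)]
      split_ifs with haj
      · exact h2 a (by omega)
      · obtain rfl : a = j := by omega
        rw [h3, map_sub, hxy]; abel
    · simp [hz0]
    · intro hp
      simp [hzp hp]

lemma exists_link {k : ℕ} (h : ∀ a b, a + 1 + b = k → C.Descend a b) {l : E}
    (hl : l ∈ C.D k 0) (hl0 : C.dS l = 0) : ∃ n ∈ C.D 0 k, C.Link k n l := by
  obtain ⟨e, h1, h2, -, h3⟩ := C.exists_link_aux k 0 rfl (fun a b hab _ => h a b hab) l hl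
    (Or.inl hl0) (by rw [C.comm, hl0, map_zero])
  exact ⟨e 0, h1 0 k (by omega) (by omega), e, fun j p hjp => h1 j p hjp (by omega), h2, rfl,
    h3 rfl⟩

/-- If one end of a staircase is a boundary, so is the other end. -/
lemma link_boundary {k : ℕ} (h : ∀ a b, a + b + 2 = k + 1 → C.E2 a b)
    (h0 : ∀ x ∈ C.D 0 (k + 1), C.dS x = 0 → x = 0) {n l : E} (hL : C.Link (k + 1) n l)
    (hl : ∃ b ∈ C.D k 0, C.dS b = l) : ∃ m ∈ C.D 0 k, C.dX m = n := by
  obtain ⟨e, h1, h2, rfl, rfl⟩ := hL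
  have key : ∀ p j, j + p = k → ∃ b ∈ C.D j p, C.dX (e (j + 1)) = C.dX (C.dS b) := by
    intro p
    induction p with
    | zero =>
      rintro j rfl
      obtain ⟨b, hb, hbe⟩ := hl
      exact ⟨b, hb, by rw [hbe]⟩
    | succ p ih =>
      intro j hj
      obtain ⟨b, hb, hbe⟩ := ih (j + 1) (by omega)
      obtain ⟨z, hz, hz0, b', hb', hzb⟩ := h j p (by omega) (e (j + 1) - C.dX b)
        (sub_mem (h1 _ _ (by omega)) (C.dX_mem hb)) (by
          rw [map_sub, h2 _ (by omega), hbe, C.comm, sub_self])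
        ⟨e j, h1 _ _ (by omega), by rw [map_sub, C.dX_dX, sub_zero, h2 _ (by omega)]⟩
      refine ⟨b', hb', ?_⟩
      have := congrArg C.dX hzb
      rw [map_sub, map_add, C.dX_dX, C.dX_dX, sub_zero, zero_add] at this
      exact this
  obtain ⟨b, hb, hbe⟩ := key k 0 (by omega)
  refine ⟨b, hb, ?_⟩
  have := h0 (e 0 - C.dX b) (sub_mem (h1 _ _ (by omega)) (C.dX_mem hb)) (by
    rw [map_sub, h2 _ (by omega), C.comm, hbe, sub_self])
  exact (sub_eq_zero.1 this).symm

end DoubleCx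

end WordCx

namespace WordCx

open Finsupp

section Del

variable {S T M M' : Type*} [AddCommGroup M] [AddCommGroup M']

/-- The coboundary of a cochain on words. -/
def del : (List S → M) →+ (List S → M) where
  toFun c s := linearCombination ℤ c (bd s)
  map_zero' := by ext s; simp
  map_add' c d := by
    ext s
    simp [linearCombination_apply, Finsupp.sum, smul_add, Finset.sum_add_distrib]

lemma del_apply (c : List S → M) (s : List S) : del c s = linearCombination ℤ c (bd s) := rfl

@[simp] lemma del_nil (c : List S → M) : del c [] = 0 := by simp [del_apply, bd]

lemma linearCombination_consL (c : List S → M) (a : S) (x : List S →₀ ℤ) :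
    linearCombination ℤ c (consL a x) = linearCombination ℤ (fun t => c (a :: t)) x := by
  rw [consL_apply, linearCombination_mapDomain]; rfl

lemma del_cons (c : List S → M) (a : S) (s : List S) :
    del c (a :: s) = c s - del (fun t => c (a :: t)) s := by
  rw [del_apply, bd_cons, map_sub, linearCombination_consL]
  simp [del_apply]

lemma linearCombination_bdL (c : List S → M) (x : List S →₀ ℤ) :
    linearCombination ℤ c (bdL x) = linearCombination ℤ (del c) x := by
  have : linearCombination ℤ c ∘ₗ bdL = linearCombination ℤ (del c) := by
    ext1 s
    ext1
    simp [del_apply]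
  exact congrArg (fun f => f x) this

lemma del_del (c : List S → M) : del (del c) = 0 := by
  ext s
  rw [del_apply, ← linearCombination_bdL, bdL_bd, map_zero]; rfl

lemma del_comp (φ : M →+ M') (c : List S → M) : del (fun t => φ (c t)) = fun s => φ (del c s) := by
  ext s
  simp only [del_apply, linearCombination_apply, Finsupp.sum, map_sum, map_zsmul]

lemma del_map (f : T → S) (c : List S → M) (s : List T) :
    del (fun t => c (t.map f)) s = del c (s.map f) := by
  induction s generalizing c with
  | nil => simp
  | cons a s ih =>
    rw [List.map_cons, del_cons, del_cons, ← ih]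
    simp

lemma linearCombination_congr {c d : List S → M} {x : List S →₀ ℤ} {A : Set (List S)}
    (hx : x ∈ supported ℤ ℤ A) (h : ∀ t ∈ A, c t = d t) :
    linearCombination ℤ c x = linearCombination ℤ d x := by
  rw [linearCombination_apply, linearCombination_apply]
  exact Finset.sum_congr rfl fun t ht => by
    dsimp only
    rw [h t ((mem_supported _ _).1 hx ht)]

lemma del_congr {c d : List S → M} {s : List S}
    (h : ∀ t : List S, t.Sublist s → t.length + 1 = s.length → c t = d t) : del c s = del d s :=
  linearCombination_congr (bd_support s) fun t ht => h t ht.1 ht.2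

lemma del_eq_zero {c : List S → M} {s : List S}
    (h : ∀ t : List S, t.Sublist s → t.length + 1 = s.length → c t = 0) : del c s = 0 := by
  rw [del_congr (d := 0) h, map_zero]; rfl

lemma linearCombination_mem (N : AddSubgroup M) {c : List S → M} (h : ∀ t, c t ∈ N)
    (x : List S →₀ ℤ) : linearCombination ℤ c x ∈ N := by
  rw [linearCombination_apply]
  exact sum_mem fun t _ => N.zsmul_mem (h t) _

lemma del_mem (N : AddSubgroup M) {c : List S → M} (h : ∀ t, c t ∈ N) (s : List S) :
    del c s ∈ N := linearCombination_mem N h _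

lemma del_pi {Z : Type*} (c : List S → Z → M) (s : List S) (z : Z) :
    del c s z = del (fun t => c t z) s :=
  (congrFun (del_comp (Pi.evalAddMonoidHom (fun _ : Z => M) z) c) s).symm

lemma linearCombination_pi {Z : Type*} (c : List S → Z → M) (x : List S →₀ ℤ) (z : Z) :
    linearCombination ℤ c x z = linearCombination ℤ (fun t => c t z) x := by
  simp [linearCombination_apply, Finsupp.sum, Finset.sum_apply]

lemma mapDomain_sub' {A B : Type*} (f : A → B) (x y : A →₀ ℤ) :
    mapDomain f (x - y) = mapDomain f x - mapDomain f y := (lmapDomain ℤ ℤ f).map_sub x y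

/-- The prism joining a word to its image under a map. -/
def prism (θ : S → S) : List S → (List S →₀ ℤ)
  | [] => 0
  | a :: s => single (a :: θ a :: s.map θ) 1 - consL a (prism θ s)

lemma bdL_prism (θ : S → S) (s : List S) : bdL (prism θ s) =
    single (s.map θ) 1 - single s 1 - linearCombination ℤ (prism θ) (bd s) := by
  have hmap : ∀ s : List S, bd (s.map θ) = mapDomain (List.map θ) (bd s) := by
    intro s
    induction s with
    | nil => simp [bd]
    | cons a s ih =>
      rw [List.map_cons, bd_cons, bd_cons, ih, consL_apply, consL_apply, mapDomain_sub']
      simp only [mapDomain_single, ← mapDomain_comp]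
      rfl
  induction s with
  | nil => simp [prism, bd]
  | cons a s ih =>
    have h1 : linearCombination ℤ (prism θ) (consL a (bd s)) =
        consL a (consL (θ a) (mapDomain (List.map θ) (bd s))) -
          consL a (linearCombination ℤ (prism θ) (bd s)) := by
      have : linearCombination ℤ (prism θ) ∘ₗ consL a =
          consL a ∘ₗ consL (θ a) ∘ₗ lmapDomain ℤ ℤ (List.map θ) -
            consL a ∘ₗ linearCombination ℤ (prism θ) := by
        ext1 s
        ext1
        simp [prism]
      exact congrArg (fun f => f (bd s)) this
    rw [prism, map_sub, bdL_consL, bdL_single, one_smul, ih, bd_cons, bd_cons, hmap,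
      show bd (a :: s) = single s 1 - consL a (bd s) from rfl, map_sub (linearCombination ℤ _), h1]
    simp only [map_sub, consL_single, List.map_cons, linearCombination_single, one_smul]
    abel

lemma prism_support (θ : S → S) (s : List S) :
    prism θ s ∈ supported ℤ ℤ {t : List S | t.length = s.length + 1} := by
  induction s with
  | nil => simp [prism]
  | cons a s ih =>
    rw [prism]
    refine Submodule.sub_mem _ (single_mem_supported _ _ (by simp)) ?_
    rw [consL_apply]
    rw [mem_supported] at ih ⊢
    intro t ht
    classical
    obtain ⟨u, hu, rfl⟩ := Finset.mem_image.1 (mapDomain_support ht)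
    simpa using ih hu

lemma prism_map {θ θ' : S → S} (g : S → S) (h : ∀ a, θ' (g a) = g (θ a)) (s : List S) :
    prism θ' (s.map g) = mapDomain (List.map g) (prism θ s) := by
  induction s with
  | nil => simp [prism]
  | cons a s ih =>
    rw [List.map_cons, prism, prism, ih, mapDomain_sub']
    simp only [consL_apply, mapDomain_single, ← mapDomain_comp]
    congr 1
    have : θ' ∘ g = g ∘ θ := funext h
    simp [h, this]

lemma prism_homotopy (θ : S → S) {c : List S → M} (hc : del c = 0) (s : List S) :
    del (fun t => linearCombination ℤ c (prism θ t)) s = c (s.map θ) - c s := by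
  have h1 : del (fun t => linearCombination ℤ c (prism θ t)) s =
      linearCombination ℤ c (linearCombination ℤ (prism θ) (bd s)) := by
    rw [del_apply]
    have : linearCombination ℤ (fun t => linearCombination ℤ c (prism θ t)) =
        linearCombination ℤ c ∘ₗ linearCombination ℤ (prism θ) := by
      ext1 s
      ext1
      simp
    rw [this]; rfl
  have h2 := linearCombination_bdL c (prism θ s)
  rw [hc, bdL_prism, map_sub, map_sub] at h2
  rw [h1]
  have h3 : linearCombination ℤ (0 : List S → M) (prism θ s) = 0 := by
    simp
  rw [h3] at h2
  simp only [linearCombination_single, one_smul] at h2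
  exact (sub_eq_zero.1 h2).symm

end Del

section Glue

lemma exists_equivariant {G Y W : Type*} [Group G] (K : Subgroup G) (aY : G → Y → Y)
    (aW : G → W → W) (hY1 : ∀ y, aY 1 y = y) 
    (hY : ∀ g h y, aY (g * h) y = aY g (aY h y))
    (hW : ∀ g h w, aW (g * h) w = aW g (aW h w)) (Q : Y → W → Prop)
    (hQ : ∀ g ∈ K, ∀ y w, Q y w → Q (aY g y) (aW g w))
    (h : ∀ y, ∃ g ∈ K, ∃ y₀, y = aY g y₀ ∧ ∃ w, Q y₀ w ∧ ∀ k ∈ K, aY k y₀ = y₀ → aW k w = w) :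
    ∃ F : Y → W, (∀ g ∈ K, ∀ y, F (aY g y) = aW g (F y)) ∧ ∀ y, Q y (F y) := by
  have h' : ∀ y, ∃ w, Q y w ∧ ∀ k ∈ K, aY k y = y → aW k w = w := by
    intro y
    obtain ⟨g, hg, y₀, rfl, w, hw, hk⟩ := h y
    refine ⟨aW g w, hQ g hg _ _ hw, fun k hkK hky => ?_⟩
    have := hk (g⁻¹ * k * g) (mul_mem (mul_mem (inv_mem hg) hkK) hg) (by
      rw [hY, hY, hky, ← hY, inv_mul_cancel, hY1])
    rw [mul_assoc, hW, hW] at this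
    conv_rhs => rw [← this]
    rw [← hW, ← hW, ← hW]
    congr 1
    group
  choose w hw hk using h'
  let r : Setoid Y := ⟨fun y y' => ∃ g ∈ K, aY g y = y', ⟨fun y => ⟨1, one_mem _, hY1 y⟩,
    fun {y y'} ⟨g, hg, h⟩ => ⟨g⁻¹, inv_mem hg, by rw [← h, ← hY, inv_mul_cancel, hY1]⟩,
    fun {_ _ _} ⟨g, hg, h⟩ ⟨g', hg', h'⟩ => ⟨g' * g, mul_mem hg' hg, by rw [hY, h, h']⟩⟩⟩
  let ρ : Y → Y := fun y => (Quotient.mk r y).out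
  have hρ : ∀ y, ∃ g ∈ K, aY g (ρ y) = y := fun y => Quotient.exact (Quotient.out_eq (Quotient.mk r y))
  choose γ hγK hγ using hρ
  refine ⟨fun y => aW (γ y) (w (ρ y)), fun g hg y => ?_, fun y => ?_⟩
  · have e : ρ (aY g y) = ρ y := by
      have : (Quotient.mk r (aY g y)) = Quotient.mk r y :=
        Quotient.sound ⟨g⁻¹, inv_mem hg, by rw [← hY, inv_mul_cancel, hY1]⟩
      simp only [ρ, this]
    have h1 := hγ (aY g y)
    rw [e] at h1
    have h2 := hk (ρ y) ((γ y)⁻¹ * (g⁻¹ * γ (aY g y)))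
      (mul_mem (inv_mem (hγK _)) (mul_mem (inv_mem hg) (hγK _))) (by
        rw [hY, hY, h1, ← hY g⁻¹, inv_mul_cancel, hY1]
        conv_lhs => rw [show aY (γ y)⁻¹ y = aY (γ y)⁻¹ (aY (γ y) (ρ y)) by rw [hγ]]
        rw [← hY, inv_mul_cancel, hY1])
    dsimp only
    rw [e]
    conv_rhs => rw [← h2]
    rw [← hW, ← hW]
    congr 1
    group
  · have := hQ _ (hγK y) _ _ (hw (ρ y))
    rwa [hγ] at this

end Glue

end WordCx

namespace WordCx

open Finsupp

section Sm

variable {G S : Type*} [Group G] [MulAction G S]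

/-- The action of a group on words. -/
def sm (g : G) (s : List S) : List S := s.map (g • ·)

@[simp] lemma sm_nil (g : G) : sm g ([] : List S) = [] := rfl
@[simp] lemma sm_cons (g : G) (a : S) (s : List S) : sm g (a :: s) = (g • a) :: sm g s := rfl
@[simp] lemma length_sm (g : G) (s : List S) : (sm g s).length = s.length := by simp [sm]
@[simp] lemma one_sm (s : List S) : sm (1 : G) s = s := by simp [sm]
lemma mul_sm (g h : G) (s : List S) : sm (g * h) s = sm g (sm h s) := by
  simp [sm, mul_smul]
@[simp] lemma inv_sm_sm (g : G) (s : List S) : sm g⁻¹ (sm g s) = s := by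
  rw [← mul_sm, inv_mul_cancel, one_sm]
@[simp] lemma sm_inv_sm (g : G) (s : List S) : sm g (sm g⁻¹ s) = s := by
  rw [← mul_sm, mul_inv_cancel, one_sm]

lemma del_sm {M : Type*} [AddCommGroup M] (g : G) (c : List S → M) (s : List S) :
    del (fun t => c (sm g t)) s = del c (sm g s) := del_map _ c s

end Sm

section Co

variable {G S V Z : Type*} [Group G] [MulAction G S] [MulAction G V] [MulAction G Z]

/-- A group of functions stable under translation. -/
def Stable (G : Type*) {Z : Type*} [Group G] [MulAction G Z] (N : AddSubgroup (Z → ℤ)) : Prop :=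
  ∀ (g : G), ∀ f ∈ N, (fun z => f (g • z)) ∈ N

/-- Equivariant cochains on words of length `j` with values in `N`. -/
def Co (K : Subgroup G) (N : AddSubgroup (Z → ℤ)) (j : ℕ) : AddSubgroup (List S → Z → ℤ) where
  carrier := {c | (∀ g ∈ K, ∀ s z, c (sm g s) (g • z) = c s z) ∧ (∀ s, c s ∈ N) ∧
    ∀ s, s.length ≠ j → c s = 0}
  zero_mem' := ⟨fun _ _ _ _ => rfl, fun _ => zero_mem N, fun _ _ => rfl⟩
  add_mem' {c d} hc hd := ⟨fun g hg s z => by simp [hc.1 g hg, hd.1 g hg],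
    fun s => add_mem (hc.2.1 s) (hd.2.1 s), fun s hs => by simp [hc.2.2 s hs, hd.2.2 s hs]⟩
  neg_mem' {c} hc := ⟨fun g hg s z => by simp [hc.1 g hg], fun s => neg_mem (hc.2.1 s),
    fun s hs => by simp [hc.2.2 s hs]⟩

/-- The stabilizer in `K` of a word. -/
def Stab (K : Subgroup G) (v : List V) : Subgroup G where
  carrier := {g | g ∈ K ∧ sm g v = v}
  one_mem' := ⟨one_mem K, one_sm v⟩
  mul_mem' {a b} ha hb := ⟨mul_mem ha.1 hb.1, by rw [mul_sm, hb.2, ha.2]⟩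
  inv_mem' {a} ha := ⟨inv_mem ha.1, by conv_lhs => rw [← ha.2, inv_sm_sm]⟩

lemma mem_Stab {K : Subgroup G} {v : List V} {g : G} : g ∈ Stab K v ↔ g ∈ K ∧ sm g v = v := Iff.rfl

lemma Stab_nil (K : Subgroup G) : Stab K ([] : List V) = K := by
  ext g; simp [mem_Stab]

lemma Stab_mono {K : Subgroup G} {v w : List V} (h : v.Sublist w) : Stab K w ≤ Stab K v := by
  intro g hg
  refine ⟨hg.1, ?_⟩
  have h2 : ∀ x ∈ w, g • x = x := by
    have := hg.2
    conv_rhs at this => rw [← List.map_id w]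
    exact List.map_inj_left.1 this
  conv_rhs => rw [← List.map_id v]
  exact List.map_inj_left.2 fun x hx => h2 x (h.subset hx)

variable {K : Subgroup G} {N : AddSubgroup (Z → ℤ)}

lemma Co_mono {K' : Subgroup G} (h : K' ≤ K) (j : ℕ) :
    (Co K N j : AddSubgroup (List S → Z → ℤ)) ≤ Co K' N j :=
  fun _ hc => ⟨fun g hg => hc.1 g (h hg), hc.2⟩

/-- The cochain is the coboundary of an equivariant cochain of list length `j`; for `j = 0`
this means that it vanishes. -/
def Null (K : Subgroup G) (N : AddSubgroup (Z → ℤ)) (j : ℕ) (c : List S → Z → ℤ) : Prop :=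
  ∃ b ∈ Co K N j, (j = 0 → b = 0) ∧ del b = c

variable {j : ℕ} {c d : List S → Z → ℤ}

lemma Null.zero : Null K N j (0 : List S → Z → ℤ) := ⟨0, zero_mem _, fun _ => rfl, map_zero _⟩

lemma Null.add (hc : Null K N j c) (hd : Null K N j d) : Null K N j (c + d) := by
  obtain ⟨b, h1, h2, rfl⟩ := hc
  obtain ⟨b', h1', h2', rfl⟩ := hd
  exact ⟨b + b', add_mem h1 h1', fun h => by rw [h2 h, h2' h, add_zero], map_add _ _ _⟩

lemma Null.neg (hc : Null K N j c) : Null K N j (-c) := by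
  obtain ⟨b, h1, h2, rfl⟩ := hc
  exact ⟨-b, neg_mem h1, fun h => by rw [h2 h, neg_zero], map_neg _ _⟩

lemma Null.trans {e : List S → Z → ℤ} (hc : Null K N j (c - d)) (hd : Null K N j (d - e)) :
    Null K N j (c - e) := by
  have := hc.add hd
  rwa [sub_add_sub_cancel] at this

lemma Null.mono {K' : Subgroup G} (h : K' ≤ K) (hc : Null K N j c) : Null K' N j c := by
  obtain ⟨b, h1, h2, rfl⟩ := hc
  exact ⟨b, Co_mono h j h1, h2, rfl⟩

lemma Null.sum {ι : Type*} {f : ι → List S → Z → ℤ} (F : Finset ι)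
    (h : ∀ i ∈ F, Null K N j (f i)) : Null K N j (∑ i ∈ F, f i) := by
  classical
  induction F using Finset.induction_on with
  | empty => simpa using Null.zero
  | insert a F ha ih =>
    rw [Finset.sum_insert ha]
    exact (h a (by simp)).add (ih fun i hi => h i (by simp [hi]))

section Comp

variable {G' Z' : Type*} [Group G'] [MulAction G' S] [MulAction G' Z'] {K' : Subgroup G'}
  {N' : AddSubgroup (Z' → ℤ)}

/-- Change of group and coefficients along an equivariant map `Z' → Z`. -/
lemma Co_comp (φ : G' → G) (hφ : ∀ g ∈ K', φ g ∈ K) (hS : ∀ g ∈ K', ∀ s : S, φ g • s = g • s)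
    (η : Z' → Z) (hη : ∀ g ∈ K', ∀ z, η (g • z) = φ g • η z) (hN : ∀ f ∈ N, f ∘ η ∈ N')
    (hc : c ∈ Co K N j) : (fun s => c s ∘ η) ∈ Co K' N' j := by
  refine ⟨fun g hg s z => ?_, fun s => hN _ (hc.2.1 s), fun s hs => ?_⟩
  · have : sm g s = sm (φ g) s := List.map_congr_left fun x _ => (hS g hg x).symm
    simp only [Function.comp]
    rw [hη g hg, this, hc.1 _ (hφ g hg)]
  · dsimp only
    rw [hc.2.2 s hs]; rfl

lemma del_precomp (η : Z' → Z) (c : List S → Z → ℤ) :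
    WordCx.del (fun s => c s ∘ η) = fun s => WordCx.del c s ∘ η := by
  ext s z
  simp only [del_pi, Function.comp]

lemma Null.comp (φ : G' → G) (hφ : ∀ g ∈ K', φ g ∈ K) (hS : ∀ g ∈ K', ∀ s : S, φ g • s = g • s)
    (η : Z' → Z) (hη : ∀ g ∈ K', ∀ z, η (g • z) = φ g • η z) (hN : ∀ f ∈ N, f ∘ η ∈ N')
    (hc : Null K N j c) : Null K' N' j (fun s => c s ∘ η) := by
  obtain ⟨b, h1, h2, rfl⟩ := hc
  exact ⟨_, Co_comp φ hφ hS η hη hN h1, fun h => by rw [h2 h]; rfl, del_precomp η b⟩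

end Comp

/-- Translation of cochains. -/
def tr (g : G) (c : List S → Z → ℤ) : List S → Z → ℤ := fun s z => c (sm g⁻¹ s) (g⁻¹ • z)

lemma tr_mul (g h : G) (c : List S → Z → ℤ) : tr (g * h) c = tr g (tr h c) := by
  ext s z
  simp [tr, mul_sm, mul_smul]

lemma tr_sub (g : G) (c d : List S → Z → ℤ) : tr g (c - d) = tr g c - tr g d := rfl

lemma del_tr (g : G) (c : List S → Z → ℤ) : WordCx.del (tr g c) = tr g (WordCx.del c) := by
  ext s z
  simp only [tr, del_pi]
  exact del_sm g⁻¹ (fun t => c t (g⁻¹ • z)) s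

lemma tr_eq (hc : c ∈ Co K N j) {g : G} (hg : g ∈ K) : tr g c = c := by
  ext s z
  simpa [tr] using (hc.1 g hg (sm g⁻¹ s) (g⁻¹ • z)).symm

lemma tr_mem {K' : Subgroup G} (hN : Stable G N) (g : G) (h : ∀ k ∈ K', g⁻¹ * k * g ∈ K)
    (hc : c ∈ Co K N j) : tr g c ∈ Co K' N j := by
  refine ⟨fun k hk s z => ?_, fun s => hN _ _ (hc.2.1 _), fun s hs => ?_⟩
  · have := hc.1 _ (h k hk) (sm g⁻¹ s) (g⁻¹ • z)
    rw [← mul_sm, ← mul_smul, mul_assoc, mul_inv_cancel, mul_one, mul_sm, mul_smul] at this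
    exact this
  · ext z
    simp only [tr]
    rw [hc.2.2 _ (by simpa using hs)]; rfl

lemma Null.tr {K' : Subgroup G} (hN : Stable G N) (g : G) (h : ∀ k ∈ K', g⁻¹ * k * g ∈ K)
    (hc : Null K N j c) : Null K' N j (tr g c) := by
  obtain ⟨b, h1, h2, rfl⟩ := hc
  exact ⟨WordCx.tr g b, tr_mem hN g h h1, fun h => by rw [h2 h]; rfl, del_tr g b⟩

lemma Null.homotopy' (θ : Z → S → S) (hθ : ∀ g ∈ K, ∀ z s, θ (g • z) (g • s) = g • θ z s)
    (hN : ∀ s, (fun z => linearCombination ℤ (fun t => c t z) (prism (θ z) s)) ∈ N)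
    (hc : c ∈ Co K N (j + 1)) (hc0 : WordCx.del c = 0) :
    Null K N j ((fun s z => c (s.map (θ z)) z) - c) := by
  have hc0' : ∀ z, WordCx.del (fun t => c t z) = 0 := by
    intro z
    ext s
    rw [← del_pi, hc0]; rfl
  have hzero : ∀ s : List S, s.length ≠ j →
      (fun z => linearCombination ℤ (fun t => c t z) (prism (θ z) s)) = 0 := by
    intro s hs
    ext z
    rw [linearCombination_congr (d := 0) (prism_support (θ z) s) (fun t ht => ?_)]
    · simp
    · rw [hc.2.2 t (by rw [ht]; omega)]; rfl
  refine ⟨fun s z => linearCombination ℤ (fun t => c t z) (prism (θ z) s),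
    ⟨fun g hg s z => ?_, hN, hzero⟩, ?_, ?_⟩
  · change linearCombination ℤ (fun t => c t (g • z)) (prism (θ (g • z)) (List.map (g • ·) s)) = _
    rw [prism_map (θ := θ z) (g • ·) (hθ g hg z), linearCombination_mapDomain]
    congr 2
    funext t
    exact hc.1 g hg t z
  · rintro rfl
    ext s z
    by_cases hs : s.length = 0
    · rw [List.length_eq_zero_iff] at hs
      simp [hs, prism]
    · exact congrFun (hzero s hs) z
  · ext s z
    rw [del_pi, prism_homotopy (θ z) (hc0' z)]
    rfl

lemma Null.homotopy (θ : S → S) (hθ : ∀ g ∈ K, ∀ s, θ (g • s) = g • θ s)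
    (hc : c ∈ Co K N (j + 1)) (hc0 : WordCx.del c = 0) :
    Null K N j ((fun s => c (s.map θ)) - c) := by
  refine Null.homotopy' (fun _ => θ) (fun g hg _ s => hθ g hg s) (fun s => ?_) hc hc0
  convert linearCombination_mem N hc.2.1 (prism θ s) using 1
  ext z
  rw [linearCombination_pi]

end Co

section Cc

variable {G S V Z : Type*} [Group G] [MulAction G S] [MulAction G V] [MulAction G Z]

/-- Equivariant cochains on pairs of words. -/
def Cc (K : Subgroup G) (X : Set (List V)) (N : AddSubgroup (Z → ℤ)) (j p : ℕ) :
    AddSubgroup (List S → List V → Z → ℤ) where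
  carrier := {c | (∀ g ∈ K, ∀ s v z, c (sm g s) (sm g v) (g • z) = c s v z) ∧
    (∀ s v, c s v ∈ N) ∧ (∀ s, s.length ≠ j → c s = 0) ∧
    ∀ s v, v ∉ X ∨ v.length ≠ p → c s v = 0}
  zero_mem' := ⟨fun _ _ _ _ _ => rfl, fun _ _ => zero_mem N, fun _ _ => rfl, fun _ _ _ => rfl⟩
  add_mem' {c d} hc hd := ⟨fun g hg s v z => by simp [hc.1 g hg, hd.1 g hg],
    fun s v => add_mem (hc.2.1 s v) (hd.2.1 s v),
    fun s hs => by simp [hc.2.2.1 s hs, hd.2.2.1 s hs],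
    fun s v h => by simp [hc.2.2.2 s v h, hd.2.2.2 s v h]⟩
  neg_mem' {c} hc := ⟨fun g hg s v z => by simp [hc.1 g hg], fun s v => neg_mem (hc.2.1 s v),
    fun s hs => by simp [hc.2.2.1 s hs], fun s v h => by simp [hc.2.2.2 s v h]⟩

open Classical in
/-- The coboundary in the second variable, on words in `X`. -/
def delX {M : Type*} [AddCommGroup M] (X : Set (List V)) : (List V → M) →+ (List V → M) where
  toFun c v := if v ∈ X then del c v else 0
  map_zero' := by ext v; simp
  map_add' c d := by ext v; by_cases h : v ∈ X <;> simp [h]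

lemma delX_of_mem {M : Type*} [AddCommGroup M] {X : Set (List V)} (c : List V → M) {v : List V}
    (hv : v ∈ X) : delX X c v = del c v := if_pos hv

lemma delX_of_not_mem {M : Type*} [AddCommGroup M] {X : Set (List V)} (c : List V → M)
    {v : List V} (hv : v ∉ X) : delX X c v = 0 := if_neg hv

variable (S) in
/-- The double complex of equivariant cochains. -/
def dbl (K : Subgroup G) (X : Set (List V)) (hX : FaceClosed X)
    (hK : ∀ g ∈ K, ∀ v ∈ X, sm g v ∈ X) (N : AddSubgroup (Z → ℤ)) :
    DoubleCx (List S → List V → Z → ℤ) where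
  dS := del
  dX := (delX X).compLeft (List S)
  D := Cc K X N
  dS_dS := del_del
  dX_dX c := by
    ext s v z
    by_cases hv : v ∈ X
    · have : delX X (delX X (c s)) v = 0 := by
        rw [delX_of_mem _ hv, del_congr (d := del (c s)) fun t ht _ =>
          delX_of_mem _ (hX ht hv), del_del]; rfl
      exact congrFun this z
    · exact congrFun (delX_of_not_mem (delX X (c s)) hv) z
  comm c := del_comp (delX X) c
  dS_mem {j p c} hc := by
    refine ⟨fun g hg s v z => ?_, fun s v => ?_, fun s hs => ?_, fun s v hv => ?_⟩
    · rw [del_pi, del_pi, del_pi, del_pi, ← del_sm]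
      exact congrArg (fun f => del f s) (funext fun t => hc.1 g hg t v z)
    · rw [del_pi]; exact del_mem N (fun t => hc.2.1 t v) s
    · exact del_eq_zero fun t _ ht => hc.2.2.1 t (by omega)
    · rw [del_pi]; exact del_eq_zero fun t _ _ => hc.2.2.2 t v hv
  dX_mem {j p c} hc := by
    refine ⟨fun g hg s v z => ?_, fun s v => ?_, fun s hs => ?_, fun s v hv => ?_⟩
    · change delX X (c (sm g s)) (sm g v) (g • z) = delX X (c s) v z
      by_cases hv : v ∈ X
      · rw [delX_of_mem _ hv, delX_of_mem _ (hK g hg v hv), del_pi, del_pi, ← del_sm]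
        exact congrArg (fun f => del f v) (funext fun t => hc.1 g hg s t z)
      · rw [delX_of_not_mem _ hv, delX_of_not_mem]; · rfl
        intro h
        have := hK _ (inv_mem hg) _ h
        rw [inv_sm_sm] at this
        exact hv this
    · change delX X (c s) v ∈ N
      by_cases hv : v ∈ X
      · rw [delX_of_mem _ hv]; exact del_mem N (hc.2.1 s) v
      · rw [delX_of_not_mem _ hv]; exact zero_mem N
    · change delX X (c s) = 0
      rw [hc.2.2.1 s hs, map_zero]
    · change delX X (c s) v = 0
      by_cases hvX : v ∈ X
      · rw [delX_of_mem _ hvX]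
        exact del_eq_zero fun t _ ht => hc.2.2.2 s t (Or.inr (by
          rcases hv with hv | hv
          · exact (hv hvX).elim
          · omega))
      · exact delX_of_not_mem _ hvX

variable {K : Subgroup G} {X : Set (List V)} {hX : FaceClosed X}
    {hK : ∀ g ∈ K, ∀ v ∈ X, sm g v ∈ X} {N : AddSubgroup (Z → ℤ)}

lemma dbl_dX {c : List S → List V → Z → ℤ} {v : List V} (hv : v ∈ X) (s : List S) :
    (dbl S K X hX hK N).dX c s v = del (c s) v := delX_of_mem _ hv

lemma Cc_ext {j p : ℕ} {c d : List S → List V → Z → ℤ} (hc : c ∈ Cc K X N j p)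
    (hd : d ∈ Cc K X N j p) (h : ∀ v ∈ X, v.length = p → ∀ s, c s v = d s v) : c = d := by
  ext s v : 2
  by_cases hv : v ∈ X ∧ v.length = p
  · exact h v hv.1 hv.2 s
  · have hv' : v ∉ X ∨ v.length ≠ p := by tauto
    rw [hc.2.2.2 s v hv', hd.2.2.2 s v hv']

lemma Cc_at {j p : ℕ} {c : List S → List V → Z → ℤ} (hc : c ∈ Cc K X N j p) (v : List V) :
    (fun s => c s v) ∈ Co (Stab K v) N j := by
  refine ⟨fun g hg s z => ?_, fun s => hc.2.1 s v, fun s hs => by simp [hc.2.2.1 s hs]⟩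
  have := hc.1 g hg.1 s v z
  rwa [hg.2] at this

lemma tr_at {j p : ℕ} {c : List S → List V → Z → ℤ} (hc : c ∈ Cc K X N j p) (v : List V) {g : G}
    (hg : g ∈ K) : tr g (fun s => c s v) = fun s => c s (sm g v) := by
  ext s z
  simpa [tr] using (hc.1 g hg (sm g⁻¹ s) v (g⁻¹ • z)).symm

lemma del_at (c : List S → List V → Z → ℤ) (v : List V) :
    del (fun s => c s v) = fun s => del c s v := by
  ext s : 1
  exact (del_pi c s v).symm

/-- Construct an equivariant cochain on pairs of words, orbit by orbit. -/
lemma exists_Cc (hK : ∀ g ∈ K, ∀ v ∈ X, sm g v ∈ X) (hN : Stable G N) (j p : ℕ)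
    (Q : List V → (List S → Z → ℤ) → Prop)
    (hQ : ∀ g ∈ K, ∀ v c, Q v c → Q (sm g v) (tr g c))
    (h : ∀ v ∈ X, v.length = p → ∃ g ∈ K, ∃ v₀, v = sm g v₀ ∧ ∃ c ∈ Co (Stab K v₀) N j, Q v₀ c) :
    ∃ b : List S → List V → Z → ℤ, b ∈ Cc K X N j p ∧
      ∀ v ∈ X, v.length = p → Q v (fun s => b s v) := by
  have hiff : ∀ g ∈ K, ∀ v, sm g v ∈ X ↔ v ∈ X := fun g hg v => ⟨fun h => by
    simpa using hK _ (inv_mem hg) _ h, hK g hg v⟩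
  obtain ⟨F, hF1, hF2⟩ := exists_equivariant K (sm (S := V)) (tr (S := S) (Z := Z)) one_sm mul_sm
    tr_mul (fun v c => (c ∈ Co (Stab K v) N j) ∧ ((v ∈ X ∧ v.length = p → Q v c) ∧
      (¬(v ∈ X ∧ v.length = p) → c = 0)))
    (fun g hg v c h => ⟨tr_mem (K := Stab K v) (K' := Stab K (sm g v)) hN g (fun k hk => ⟨mul_mem (mul_mem (inv_mem hg) hk.1) hg, by
        rw [mul_sm, mul_sm, hk.2, inv_sm_sm]⟩) h.1, by
      rw [hiff g hg, length_sm]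
      exact ⟨fun hv => hQ g hg v c (h.2.1 hv), fun hv => by rw [h.2.2 hv]; rfl⟩⟩)
    (fun v => by
      by_cases hv : v ∈ X ∧ v.length = p
      · obtain ⟨g, hg, v₀, rfl, c, hc, hQc⟩ := h v hv.1 hv.2
        rw [hiff g hg, length_sm] at hv
        exact ⟨g, hg, v₀, rfl, c, ⟨hc, fun _ => hQc, fun h => (h hv).elim⟩,
          fun k hk hkv => tr_eq hc ⟨hk, hkv⟩⟩
      · exact ⟨1, one_mem _, v, (one_sm v).symm, 0, ⟨zero_mem _, fun h => (hv h).elim,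
          fun _ => rfl⟩, fun _ _ _ => rfl⟩)
  refine ⟨fun s v => F v s, ⟨fun g hg s v z => ?_, fun s v => (hF2 v).1.2.1 s, fun s hs => ?_,
    fun s v hv => ?_⟩, fun v hv hp => (hF2 v).2.1 ⟨hv, hp⟩⟩
  · change F (sm g v) (sm g s) (g • z) = F v s z
    rw [hF1 g hg]; simp [tr]
  · ext v : 1
    exact (hF2 v).1.2.2 s hs
  · have := (hF2 v).2.2 (by tauto)
    change F v s = 0
    rw [this]; rfl

/-- Pointwise coboundaries are coboundaries. -/
lemma exists_dS_lift (hX : FaceClosed X) (hN : Stable G N) {j p : ℕ} {y : List S → List V → Z → ℤ}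
    (hK : ∀ g ∈ K, ∀ v ∈ X, sm g v ∈ X)
    (hy : y ∈ Cc K X N (j + 1) p)
    (h : ∀ v ∈ X, v.length = p → ∃ g ∈ K, ∃ v₀, v = sm g v₀ ∧
      Null (Stab K v₀) N j (fun s => y s v₀)) :
    ∃ b ∈ Cc K X N j p, (j = 0 → b = 0) ∧ del b = y := by
  obtain ⟨b, hb, hQ⟩ := exists_Cc hK hN j p (S := S)
    (fun v c => (j = 0 → c = 0) ∧ del c = fun s => y s v)
    (fun g hg v c h => ⟨fun hj => by rw [h.1 hj]; rfl, by rw [del_tr, h.2, tr_at hy v hg]⟩)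
    (fun v hv hp => by
      obtain ⟨g, hg, v₀, rfl, b, hb, h1, h2⟩ := h v hv hp
      exact ⟨g, hg, v₀, rfl, b, hb, h1, h2⟩)
  refine ⟨b, hb, fun hj => Cc_ext hb (zero_mem _) fun v hv hp s => ?_,
    Cc_ext ((dbl S K X hX hK N).dS_mem hb) hy fun v hv hp s => ?_⟩
  · exact congrFun ((hQ v hv hp).1 hj) s
  · have := congrFun (hQ v hv hp).2 s
    rwa [del_at] at this

end Cc

end WordCx

namespace WordCx

open Finsupp

namespace DoubleCx

variable {E : Type*} [AddCommGroup E] (C : DoubleCx E)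

/-- Replace the column of index zero by zero. -/
def trunc : DoubleCx E where
  dS := C.dS
  dX := C.dX
  D j p := if j = 0 then ⊥ else C.D j p
  dS_dS := C.dS_dS
  dX_dX := C.dX_dX
  comm := C.comm
  dS_mem {j p x} h := by
    rw [if_neg (by omega)]
    split_ifs at h
    · rw [AddSubgroup.mem_bot] at h; rw [h, map_zero]; exact zero_mem _
    · exact C.dS_mem h
  dX_mem {j p x} h := by
    split_ifs at h ⊢
    · rw [AddSubgroup.mem_bot] at h; rw [h, map_zero]; exact zero_mem _
    · exact C.dX_mem h

@[simp] lemma trunc_zero (p : ℕ) : C.trunc.D 0 p = ⊥ := by simp [trunc]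
@[simp] lemma trunc_succ (j p : ℕ) : C.trunc.D (j + 1) p = C.D (j + 1) p := by simp [trunc]
@[simp] lemma trunc_dS : C.trunc.dS = C.dS := rfl
@[simp] lemma trunc_dX : C.trunc.dX = C.dX := rfl

lemma trunc_ExX_zero (p : ℕ) : C.trunc.ExX 0 p := fun c hc _ => by
  rw [trunc_zero, AddSubgroup.mem_bot] at hc
  exact ⟨0, zero_mem _, by rw [hc, map_zero]⟩

lemma trunc_ExX_succ {j p : ℕ} (h : C.ExX (j + 1) p) : C.trunc.ExX (j + 1) p := by
  unfold ExX at h ⊢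
  simpa using h

lemma trunc_InjX_succ {j : ℕ} (h : C.InjX (j + 1)) : C.trunc.InjX (j + 1) := by
  unfold InjX at h ⊢
  simpa using h

lemma mem_trunc {j p : ℕ} {x : E} (hx : x ∈ C.D j p) (h : j = 0 → x = 0) : x ∈ C.trunc.D j p := by
  cases j with
  | zero => simp [h rfl]
  | succ j => simpa using hx

lemma of_mem_trunc {j p : ℕ} {x : E} (hx : x ∈ C.trunc.D j p) :
    x ∈ C.D j p ∧ (j = 0 → x = 0) := by
  cases j with
  | zero =>
    rw [trunc_zero, AddSubgroup.mem_bot] at hx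
    simp [hx]
  | succ j => simpa using hx

end DoubleCx

/-- A free action admits an equivariant map to the group. -/
lemma exists_kappa {G S : Type*} [Group G] [MulAction G S] (K : Subgroup G)
    (h : ∀ g ∈ K, ∀ s : S, g • s = s → g = 1) :
    ∃ κ : S → G, (∀ s, κ s ∈ K) ∧ ∀ g ∈ K, ∀ s, κ (g • s) = g * κ s := by
  obtain ⟨F, h1, h2⟩ := exists_equivariant K (fun (g : G) (s : S) => g • s) (fun g w => g * w)
    (one_smul G) mul_smul mul_assoc (fun _ w => w ∈ K) (fun g hg _ w hw => mul_mem hg hw)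
    (fun y => ⟨1, one_mem _, y, (one_smul _ _).symm, 1, one_mem _, fun k hk hky => by
      rw [h k hk y hky, one_mul]⟩)
  exact ⟨F, h2, h1⟩

section

variable {G S V Z : Type*} [Group G] [MulAction G S] [MulAction G V] [MulAction G Z]
  {K : Subgroup G} {X : Set (List V)} {N : AddSubgroup (Z → ℤ)}

/-- A cochain determined by its first letter through an equivariant choice. -/
def kap (κ : S → G) (H : (List V →₀ ℤ) →ₗ[ℤ] (List V →₀ ℤ)) (c : List S → List V → Z → ℤ) :
    List S → List V → Z → ℤ
  | [], _ => 0
  | a :: s, v => linearCombination ℤ (fun w => c (a :: s) (sm (κ a) w)) (H (single (sm (κ a)⁻¹ v) 1))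

open Classical in
lemma exX_dbl {hX : FaceClosed X} {hK : ∀ g ∈ K, ∀ v ∈ X, sm g v ∈ X} {κ : S → G}
    (hκ : ∀ s, κ s ∈ K) (hκK : ∀ g ∈ K, ∀ s, κ (g • s) = g * κ s) {p : ℕ}
    (hEx : ∀ q ≤ p + 1, Ex X q) (j : ℕ) : (dbl S K X hX hK N).ExX (j + 1) p := by
  intro c hc hc0
  obtain ⟨H, hH, hHe⟩ := exists_contraction hX (q := p + 2) fun q hq => hEx q (by omega)
  have hKi : ∀ g ∈ K, ∀ v, sm g⁻¹ v ∈ X ↔ v ∈ X := fun g hg v =>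
    ⟨fun h => by simpa using hK _ hg _ h, hK _ (inv_mem hg) v⟩
  let b : List S → List V → Z → ℤ := fun s v =>
    if v ∈ X ∧ v.length = p then kap κ H c s v else 0
  have hb : b ∈ Cc K X N (j + 1) p := by
    refine ⟨fun g hg s v z => ?_, fun s v => ?_, fun s hs => ?_, fun s v hv => ?_⟩
    · have hiff : sm g v ∈ X ↔ v ∈ X := by simpa using hKi _ (inv_mem hg) v
      dsimp only [b]
      rw [length_sm, hiff]
      split_ifs with hv
      · cases s with
        | nil => rfl
        | cons a s =>
          simp only [sm_cons, kap, hκK g hg, mul_inv_rev]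
          rw [mul_sm, inv_sm_sm, linearCombination_pi, linearCombination_pi]
          congr 2
          funext w
          rw [mul_sm]
          exact hc.1 g hg (a :: s) _ z
      · rfl
    · dsimp only [b]
      split_ifs with hv
      · cases s with
        | nil => exact zero_mem N
        | cons a s => exact linearCombination_mem N (fun w => hc.2.1 _ _) _
      · exact zero_mem N
    · ext v : 1
      dsimp only [b]
      split_ifs with hv
      · cases s with
        | nil => rfl
        | cons a s =>
          simp only [kap]
          rw [hc.2.2.1 _ hs]
          exact linearCombination_mem ⊥ (fun _ => rfl) _
      · rfl
    · exact if_neg (by tauto)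
  refine ⟨b, hb, Cc_ext ((dbl S K X hX hK N).dX_mem hb) hc fun v hv hp s => ?_⟩
  cases s with
  | nil => rw [hc.2.2.1 _ (by simp), ((dbl S K X hX hK N).dX_mem hb).2.2.1 _ (by simp)]
  | cons a s =>
    rw [dbl_dX hv]
    set u := sm (κ a)⁻¹ v with hu
    have huX : u ∈ X := (hKi _ (hκ a) v).2 hv
    have hup : u.length = p + 1 := by rw [hu, length_sm, hp]
    set c' : List V → Z → ℤ := fun w => c (a :: s) (sm (κ a) w) with hc'
    have h1 : del (b (a :: s)) v = linearCombination ℤ c' (H (bd u)) := by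
      have : v = sm (κ a) u := by rw [hu, sm_inv_sm]
      rw [this, ← del_sm, del_congr (d := fun w => linearCombination ℤ c' (H (single w 1)))
        fun t ht htl => ?_]
      · rw [del_apply]
        have : linearCombination ℤ (fun w => linearCombination ℤ c' (H (single w 1))) =
            linearCombination ℤ c' ∘ₗ H := by
          ext1 s; ext1; simp
        rw [this]; rfl
      · have htX := hX ht huX
        have : sm (κ a) t ∈ X ∧ (sm (κ a) t).length = p := ⟨hK _ (hκ a) _ htX, by
          rw [length_sm]; omega⟩
        dsimp only [b]
        rw [if_pos this, kap, inv_sm_sm]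
    have hus : single u (1 : ℤ) ∈ Ch X (p + 1) := hup ▸ single_mem_Ch huX 1
    have h2 := hHe (p + 1) (by omega) _ hus
    rw [bdL_single, one_smul] at h2
    have h3 : linearCombination ℤ c' (bdL (H (single u 1))) = 0 := by
      rw [linearCombination_bdL]
      rw [linearCombination_congr (d := 0) (hH (p + 1) (by omega) _ hus) fun t ht => ?_]
      · simp
      · rw [hc', del_sm, ← dbl_dX (hX := hX) (hK := hK) (K := K) (N := N) (hK _ (hκ a) _ ht.1), hc0]
        rfl
    rw [h1, eq_sub_of_add_eq' h2, map_sub, h3, sub_zero]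
    simp [hc', hu]

lemma injX_dbl {hX : FaceClosed X} {hK : ∀ g ∈ K, ∀ v ∈ X, sm g v ∈ X} (a : V) (ha : [a] ∈ X)
    (j : ℕ) : (dbl S K X hX hK N).InjX j := by
  intro c hc hc0
  refine Cc_ext hc (zero_mem _) fun v _ hv s => ?_
  have := dbl_dX (hX := hX) (hK := hK) (K := K) (N := N) (c := c) ha s
  rw [hc0, del_cons, del_nil, sub_zero] at this
  rw [List.length_eq_zero_iff.1 hv, ← this]; rfl

open Classical in
/-- Place a cochain on the edge of the double complex. -/
def edge : (List S → Z → ℤ) →+ (List S → List V → Z → ℤ) where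
  toFun c s v := if v = [] then c s else 0
  map_zero' := by ext s v; simp
  map_add' c d := by ext s v; by_cases h : v = [] <;> simp [h]

@[simp] lemma edge_nil (c : List S → Z → ℤ) (s : List S) : edge (V := V) c s [] = c s := by simp [edge]

lemma edge_mem {j : ℕ} (h : [] ∈ X) {c : List S → Z → ℤ} (hc : c ∈ Co K N j) :
    edge c ∈ Cc K X N j 0 := by
  refine ⟨fun g hg s v z => ?_, fun s v => ?_, fun s hs => ?_, fun s v hv => ?_⟩
  · cases v with
    | nil => simpa using hc.1 g hg s z
    | cons a v => simp [edge]
  · dsimp [edge]; split_ifs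
    exacts [hc.2.1 s, zero_mem N]
  · ext v : 1
    simp [edge, hc.2.2 s hs]
  · refine if_neg ?_
    rintro rfl
    simp [h] at hv

lemma at_nil_mem {j p : ℕ} {c : List S → List V → Z → ℤ} (hc : c ∈ Cc K X N j p) :
    (fun s => c s []) ∈ Co K N j := by
  have := Cc_at hc []
  rwa [Stab_nil] at this

lemma del_edge (c : List S → Z → ℤ) : del (edge (V := V) c) = edge (del c) :=
  del_comp (M' := List V → Z → ℤ) (⟨⟨fun f v => open Classical in if v = [] then f else 0, by ext; simp⟩, fun f g => by
    ext v; by_cases h : v = [] <;> simp [h]⟩ : (Z → ℤ) →+ (List V → Z → ℤ)) c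

/-- Injectivity criterion: a cocycle that vanishes on the stabilizers of letters vanishes. -/
lemma null_of_vertices {hX : FaceClosed X} {hK : ∀ g ∈ K, ∀ v ∈ X, sm g v ∈ X}
    (hN : Stable G N) (h0 : [] ∈ X) {x₀ : V} (hx₀ : [x₀] ∈ X)
    (hfree : ∀ g ∈ K, ∀ s : S, g • s = s → g = 1) {i : ℕ}
    (hEx : ∀ q, q ≤ i → Ex X q) 
    (hE2 : ∀ a b, a + b = i → 1 ≤ b → (dbl S K X hX hK N).trunc.E2 a b)
    {c : List S → Z → ℤ} (hc : c ∈ Co K N (i + 1))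
    (hv : ∀ x, [x] ∈ X → ∃ g ∈ K, ∃ x', x = g • x' ∧ Null (Stab K [x']) N i c) :
    Null K N i c := by
  obtain ⟨κ, hκ, hκK⟩ := exists_kappa K hfree
  set C := dbl S K X hX hK N
  have hce := edge_mem (V := V) h0 hc
  have hdX1 : ∀ a s, [a] ∈ X → C.dX (edge c) s [a] = c s := fun a s ha => by
    rw [dbl_dX ha, del_cons, del_nil, sub_zero, edge_nil]
  obtain ⟨v, hv, hvi, hdv⟩ := exists_dS_lift (K := K) hX hN hK (C.dX_mem hce) (fun v hvX hvp => by
    obtain ⟨x, rfl⟩ := List.length_eq_one_iff.1 hvp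
    obtain ⟨g, hg, x', rfl, hn⟩ := hv x hvX
    refine ⟨g, hg, [x'], rfl, ?_⟩
    have hx' : [x'] ∈ X := by simpa [sm] using hK _ (inv_mem hg) _ hvX
    convert hn using 1
    funext s
    exact hdX1 x' s hx')
  obtain ⟨b, hb, hbc⟩ := C.trunc.inj_of C.trunc_zero (i := i) (c := edge c) (fun a b hab hb => by
      refine ⟨hE2 a b hab hb, ?_⟩
      cases a with
      | zero => exact C.trunc_ExX_zero b
      | succ a => exact C.trunc_ExX_succ (exX_dbl hκ hκK (fun q hq => hEx q (by omega)) a))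
    (by
      cases i with
      | zero => exact C.trunc_ExX_zero 0
      | succ i => exact C.trunc_ExX_succ (exX_dbl hκ hκK (fun q hq => hEx q (by omega)) i))
    (C.trunc_InjX_succ (injX_dbl x₀ hx₀ _)) (by rwa [C.trunc_succ])
    ⟨v, C.mem_trunc hv hvi, hdv.symm⟩
  obtain ⟨hb1, hb2⟩ := C.of_mem_trunc hb
  refine ⟨_, at_nil_mem hb1, fun hi => by rw [hb2 hi]; rfl, ?_⟩
  rw [del_at]
  funext s
  have := congrFun (congrFun hbc s) []
  rwa [edge_nil] at this

end

end WordCx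

namespace WordCx

open FreeGroup (invRev invRev_length invRev_append invRev_invRev invRev_involutive isReduced_toWord toWord_mk mk_toWord toWord_inv inv_mk mul_mk norm_inv_eq)

section Nielsen

variable {α : Type*}

lemma mk_invRev (L : List (α × Bool)) : FreeGroup.mk (invRev L) = (FreeGroup.mk L)⁻¹ := inv_mk.symm

lemma mk_append (L M : List (α × Bool)) :
    FreeGroup.mk (L ++ M) = FreeGroup.mk L * FreeGroup.mk M := mul_mk.symm

variable [DecidableEq α]

lemma toWord_eq_of_isReduced {L : List (α × Bool)} (h : FreeGroup.IsReduced L) {x : FreeGroup α}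
    (hx : FreeGroup.mk L = x) : x.toWord = L := by
  rw [← hx, toWord_mk, h.reduce_eq]

lemma exists_cancel_list (w₂ : List (α × Bool)) : ∀ w₁ : List (α × Bool), FreeGroup.IsReduced w₁ →
    FreeGroup.IsReduced w₂ → ∃ p q r, w₁ = p ++ invRev q ∧ w₂ = q ++ r ∧ FreeGroup.IsReduced (p ++ r) := by
  induction w₂ with
  | nil => exact fun w₁ h _ => ⟨w₁, [], [], by simp, by simp, by simpa using h⟩
  | cons a w₂ ih =>
    intro w₁ h1 h2
    rcases List.eq_nil_or_concat w₁ with rfl | ⟨w, b, rfl⟩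
    · exact ⟨[], [], a :: w₂, by simp, by simp, by simpa using h2⟩
    · rw [List.concat_eq_append] at h1 ⊢
      by_cases hab : b.1 = a.1 → b.2 = a.2
      · refine ⟨w ++ [b], [], a :: w₂, by simp, by simp, ?_⟩
        rw [FreeGroup.IsReduced, List.isChain_append]
        exact ⟨h1, h2, by simpa using fun h => hab h⟩
      · push Not at hab
        obtain ⟨p, q, r, rfl, rfl, h⟩ := ih w (List.IsChain.left_of_append h1)
          (List.IsChain.right_of_append (l₁ := [a]) h2)
        refine ⟨p, a :: q, r, ?_, by simp, h⟩
        have : b = (a.1, !a.2) := Prod.ext hab.1 (by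
          have := hab.2
          cases h : a.2 <;> cases h' : b.2 <;> simp_all)
        rw [this, List.append_assoc]
        simp [invRev]

lemma exists_cancel (x y : FreeGroup α) : ∃ p q r, x.toWord = p ++ invRev q ∧
    y.toWord = q ++ r ∧ (x * y).toWord = p ++ r := by
  obtain ⟨p, q, r, h1, h2, h3⟩ := exists_cancel_list y.toWord x.toWord isReduced_toWord
    isReduced_toWord
  refine ⟨p, q, r, h1, h2, toWord_eq_of_isReduced h3 ?_⟩
  rw [← mk_toWord (x := x), ← mk_toWord (x := y), h1, h2]
  simp only [mk_append, mk_invRev]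
  group

/-- The length of the common initial segment of two reduced words. -/
def gp (u v : FreeGroup α) : ℕ := (u.norm + v.norm - (u⁻¹ * v).norm) / 2

lemma gp_spec (u v : FreeGroup α) : ∃ p q r, u.toWord = q ++ p ∧ v.toWord = q ++ r ∧
    (u⁻¹ * v).toWord = invRev p ++ r ∧ gp u v = q.length := by
  obtain ⟨p, q, r, h1, h2, h3⟩ := exists_cancel u⁻¹ v
  rw [toWord_inv, invRev_involutive.eq_iff, invRev_append, invRev_invRev] at h1
  refine ⟨invRev p, q, r, h1, h2, by rw [invRev_invRev, h3], ?_⟩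
  simp only [gp, FreeGroup.norm, h1, h2, h3, List.length_append, invRev_length]
  omega

lemma norm_inv_mul (u v : FreeGroup α) : (u⁻¹ * v).norm + 2 * gp u v = u.norm + v.norm := by
  obtain ⟨p, q, r, h1, h2, h3, h4⟩ := gp_spec u v
  simp only [FreeGroup.norm, h1, h2, h3, h4, List.length_append, invRev_length]
  omega

lemma norm_mul (x y : FreeGroup α) : (x * y).norm + 2 * gp x⁻¹ y = x.norm + y.norm := by
  have := norm_inv_mul x⁻¹ y
  rwa [inv_inv, norm_inv_eq] at this

lemma gp_le (u v : FreeGroup α) : gp u v ≤ u.norm ∧ gp u v ≤ v.norm := by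
  obtain ⟨p, q, r, h1, h2, h3, h4⟩ := gp_spec u v
  simp [FreeGroup.norm, h1, h2, h4]

lemma gp_comm (u v : FreeGroup α) : gp u v = gp v u := by
  have h : (u⁻¹ * v).norm = (v⁻¹ * u).norm := by
    rw [← norm_inv_eq]; simp
  simp only [gp, h, add_comm]

lemma gp_inv_mul (g h : FreeGroup α) : gp g⁻¹ (g⁻¹ * h) + gp g h = g.norm := by
  have h1 := norm_inv_mul g h
  have h2 := norm_inv_mul g⁻¹ (g⁻¹ * h)
  rw [inv_inv, mul_inv_cancel_left, norm_inv_eq] at h2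
  omega

lemma le_gp {u v : FreeGroup α} {k : ℕ} (hu : k ≤ u.norm) (hv : k ≤ v.norm)
    (h : u.toWord.take k = v.toWord.take k) : k ≤ gp u v := by
  obtain ⟨p, q, r, h1, h2, h3, h4⟩ := gp_spec u v
  rw [h4]
  by_contra! hk
  rw [FreeGroup.norm, h1, List.length_append] at hu
  rw [FreeGroup.norm, h2, List.length_append] at hv
  obtain ⟨m, rfl⟩ : ∃ m, k = q.length + (m + 1) := ⟨k - q.length - 1, by omega⟩
  rw [h1, h2, List.take_length_add_append, List.take_length_add_append] at h
  have h := List.append_cancel_left h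
  obtain ⟨a, p, rfl⟩ := List.exists_cons_of_length_pos (l := p) (by omega)
  obtain ⟨b, r, rfl⟩ := List.exists_cons_of_length_pos (l := r) (by omega)
  rw [List.take_succ_cons, List.take_succ_cons, List.cons.injEq] at h
  obtain ⟨rfl, -⟩ := h
  have hr : FreeGroup.IsReduced [(a.1, !a.2), a] := by
    have h4 : FreeGroup.IsReduced (u⁻¹ * v).toWord := isReduced_toWord
    rw [h3, show invRev (a :: p) ++ a :: r = invRev p ++ ([(a.1, !a.2), a] ++ r) by
      simp [invRev]] at h4
    exact List.IsChain.left_of_append (List.IsChain.right_of_append h4)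
  simp at hr

lemma take_eq {u v : FreeGroup α} {k : ℕ} (h : k ≤ gp u v) :
    u.toWord.take k = v.toWord.take k := by
  obtain ⟨p, q, r, h1, h2, h3, h4⟩ := gp_spec u v
  rw [h4] at h
  rw [h1, h2, List.take_append_of_le_length h, List.take_append_of_le_length h]

lemma gp_eq_of_lt {u v w : FreeGroup α} (h : gp u v < gp u w) : gp w v = gp u v := by
  have hl := gp_le u v
  have hl' := gp_le u w
  have hl'' := gp_le w v
  apply le_antisymm
  · by_contra! hlt
    have : gp u v + 1 ≤ gp u v := le_gp (by omega) (by omega)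
      ((take_eq (v := w) (by omega)).trans (take_eq (by omega)))
    omega
  · exact le_gp (by omega) hl.2 ((take_eq (gp_comm u w ▸ h.le)).trans (take_eq le_rfl))

lemma two_gp_sq {x : FreeGroup α} (hx : x ≠ 1) : 2 * gp x⁻¹ x < x.norm := by
  obtain ⟨p, q, r, h1, h2, -, h4⟩ := gp_spec x⁻¹ x
  rw [h4]
  by_contra! hlt
  rw [toWord_inv, h2, invRev_append] at h1
  rw [FreeGroup.norm, h2, List.length_append] at hlt
  obtain ⟨q', hq⟩ : ∃ q', q = invRev r ++ q' := by
    have := congrArg (List.take (invRev r).length) h1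
    rw [List.take_left, List.take_append_of_le_length (by rw [invRev_length]; omega)] at this
    exact ⟨q.drop (invRev r).length, by conv_lhs => rw [← List.take_append_drop (invRev r).length q, ← this]⟩
  rw [hq, List.append_assoc] at h1
  have h1 := List.append_cancel_left h1
  rw [invRev_append, invRev_invRev] at h1
  have h5 := (List.append_inj h1 (by rw [invRev_length])).1
  have h6 : FreeGroup.mk q' = 1 := by
    have : FreeGroup.mk q' ^ 2 = 1 := by
      have h7 := mk_invRev q'
      rw [h5] at h7
      rw [pow_two]
      nth_rewrite 1 [h7]
      exact inv_mul_cancel _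
    exact (pow_eq_one_iff_left two_ne_zero).1 this
  apply hx
  rw [← mk_toWord (x := x), h2, hq]
  simp only [mk_append, mk_invRev, h6]
  group

end Nielsen

end WordCx

namespace WordCx

open FreeGroup (invRev invRev_length invRev_append invRev_invRev invRev_involutive isReduced_toWord toWord_mk mk_toWord toWord_inv inv_mk mul_mk norm_inv_eq)

section Weight

variable {n : ℕ}

/-- The numerical base used to encode words in the free group on `Fin n`. -/
def bs (n : ℕ) : ℕ := 2 * n + 3

def dig (a : Fin n × Bool) : ℕ := 2 * a.1 + a.2.toNat

lemma dig_lt (a : Fin n × Bool) : dig a < bs n := by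
  have := a.1.2
  have := Bool.toNat_lt a.2
  simp only [dig, bs]
  omega

lemma dig_injective : Function.Injective (dig (n := n)) := by
  rintro ⟨a, b⟩ ⟨c, d⟩ h
  have h1 := Bool.toNat_lt b
  have h2 := Bool.toNat_lt d
  simp only [dig] at h
  refine Prod.ext (Fin.ext (by dsimp only; omega)) (by cases b <;> cases d <;> simp at h ⊢ <;> omega)

/-- The numerical encoding of a word. -/
def code : List (Fin n × Bool) → ℕ
  | [] => 0
  | a :: l => dig a * bs n ^ l.length + code l

lemma code_lt (l : List (Fin n × Bool)) : code l < bs n ^ l.length := by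
  induction l with
  | nil => simp [code]
  | cons a l ih =>
    have := dig_lt a
    rw [code, List.length_cons, pow_succ']
    nlinarith

lemma code_append (p q : List (Fin n × Bool)) :
    code (p ++ q) = code p * bs n ^ q.length + code q := by
  induction p with
  | nil => simp [code]
  | cons a l ih =>
    rw [List.cons_append, code, ih, code, List.length_append, pow_add]
    ring

lemma code_inj {l : List (Fin n × Bool)} : ∀ {m : List (Fin n × Bool)}, l.length = m.length →
    code l = code m → l = m := by
  induction l with
  | nil => intro m h _; exact (List.length_eq_zero_iff.1 h.symm).symm
  | cons a l ih =>
    intro m h hc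
    obtain ⟨b, m, rfl⟩ := List.exists_cons_of_length_pos (l := m) (by rw [← h]; simp)
    have h : l.length = m.length := by simpa using h
    rw [code, code, h] at hc
    have h1 := code_lt l
    have h2 := code_lt m
    rw [h] at h1
    have hab : dig a = dig b := by
      rcases lt_trichotomy (dig a) (dig b) with hlt | heq | hlt
      · nlinarith
      · exact heq
      · nlinarith
    rw [hab] at hc
    rw [dig_injective hab, ih h (by omega)]

/-- The first half of a reduced word. -/
def half (w : FreeGroup (Fin n)) : List (Fin n × Bool) := w.toWord.take ((w.norm + 1) / 2)

/-- A weight refining the length of elements of the free group. -/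
def nu (w : FreeGroup (Fin n)) : ℕ := bs n ^ (w.norm + 1) + code (half w) + code (half w⁻¹)

@[simp] lemma nu_inv (w : FreeGroup (Fin n)) : nu w⁻¹ = nu w := by
  simp only [nu, inv_inv, norm_inv_eq]
  ring

lemma code_half_lt (w : FreeGroup (Fin n)) : code (half w) < bs n ^ w.norm :=
  (code_lt _).trans_le (pow_le_pow_right₀ (by simp [bs]) (by
    rw [half, List.length_take]
    exact min_le_right _ _))

lemma nu_lt_of_norm_lt {x y : FreeGroup (Fin n)} (h : x.norm < y.norm) : nu x < nu y := by
  have h1 := code_half_lt x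
  have h2 := code_half_lt x⁻¹
  rw [norm_inv_eq] at h2
  have h3 : bs n ^ (x.norm + 2) ≤ bs n ^ (y.norm + 1) := pow_le_pow_right₀ (by simp [bs]) (by omega)
  have h4 : 3 ≤ bs n := by simp [bs]
  have h5 : 2 * bs n ^ x.norm + bs n ^ (x.norm + 1) ≤ bs n ^ (x.norm + 2) := by
    have : 0 < bs n ^ x.norm := by positivity
    have h6 : 3 * bs n ^ x.norm ≤ bs n ^ (x.norm + 1) := by
      rw [pow_succ, mul_comm]; exact Nat.mul_le_mul_left _ h4
    have h7 : 3 * bs n ^ (x.norm + 1) ≤ bs n ^ (x.norm + 2) := by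
      rw [pow_succ _ (x.norm + 1), mul_comm]; exact Nat.mul_le_mul_left _ h4
    omega
  simp only [nu]
  omega

lemma norm_le_of_nu_le {x y : FreeGroup (Fin n)} (h : nu x ≤ nu y) : x.norm ≤ y.norm := by
  by_contra! hlt
  exact absurd (nu_lt_of_norm_lt hlt) (by omega)

lemma nu_mul {x y : FreeGroup (Fin n)} (h : 2 * gp x⁻¹ y = y.norm) (hxy : y.norm ≤ x.norm) :
    ∃ K, 0 < K ∧ nu (x * y) + code (half y) * K = nu x + code (half y⁻¹) * K := by
  obtain ⟨p, q, r, h1, h2, h3, h4⟩ := gp_spec x⁻¹ y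
  rw [inv_inv] at h3
  rw [toWord_inv, invRev_involutive.eq_iff, invRev_append] at h1
  have h5 : y⁻¹.toWord = invRev r ++ invRev q := by rw [toWord_inv, h2, invRev_append]
  have h6 : x⁻¹.toWord = q ++ p := by rw [toWord_inv, h1, invRev_append, invRev_invRev, invRev_invRev]
  have h7 : (x * y)⁻¹.toWord = invRev r ++ p := by rw [toWord_inv, h3, invRev_append, invRev_invRev]
  have hy : y.norm = q.length + r.length := by rw [FreeGroup.norm, h2, List.length_append]
  have hx : x.norm = p.length + q.length := by
    rw [FreeGroup.norm, h1, List.length_append, invRev_length, invRev_length]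
  have hz : (x * y).norm = p.length + r.length := by
    rw [FreeGroup.norm, h3, List.length_append, invRev_length]
  have e1 : half y = q := by
    rw [half, h2, List.take_left']
    omega
  have e2 : half y⁻¹ = invRev r := by
    rw [half, h5, List.take_left']
    rw [norm_inv_eq, invRev_length]
    omega
  obtain ⟨m, hm⟩ : ∃ m, (x.norm + 1) / 2 = q.length + m := ⟨(x.norm + 1) / 2 - q.length, by omega⟩
  have hm' : ((x * y).norm + 1) / 2 = (invRev r).length + m := by
    rw [invRev_length]; omega
  have e3 : half (x * y) = half x := by
    rw [half, half, h1, h3, List.take_append_of_le_length, List.take_append_of_le_length]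
    · congr 1
      omega
    · rw [invRev_length]; omega
    · rw [invRev_length]; omega
  have e4 : half x⁻¹ = q ++ p.take m := by
    rw [half, h6, norm_inv_eq, hm, List.take_length_add_append]
  have e5 : half (x * y)⁻¹ = invRev r ++ p.take m := by
    rw [half, h7, norm_inv_eq, hm', List.take_length_add_append]
  refine ⟨bs n ^ (p.take m).length, by simp [bs], ?_⟩
  rw [nu, nu, e1, e2, e3, e4, e5, code_append, code_append, show (x * y).norm = x.norm by omega]
  ring

lemma code_half_ne {x y : FreeGroup (Fin n)} (h : 2 * gp x⁻¹ y = y.norm) (hy : y ≠ 1) :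
    code (half y) ≠ code (half y⁻¹) := by
  obtain ⟨p, q, r, h1, h2, h3, h4⟩ := gp_spec x⁻¹ y
  have h5 : y⁻¹.toWord = invRev r ++ invRev q := by rw [toWord_inv, h2, invRev_append]
  have hl : y.norm = q.length + r.length := by rw [FreeGroup.norm, h2, List.length_append]
  have e1 : half y = q := by
    rw [half, h2, List.take_left']
    omega
  have e2 : half y⁻¹ = invRev r := by
    rw [half, h5, List.take_left']
    rw [norm_inv_eq, invRev_length]
    omega
  rw [e1, e2]
  intro hc
  have := code_inj (by rw [invRev_length]; omega) hc
  apply hy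
  rw [← mk_toWord (x := y), h2, this, mk_append, mk_invRev, inv_mul_cancel]

/-- A symmetric set of elements of a free group is Nielsen reduced if products do not decrease
the weight. -/
structure NielsenReduced (T : Set (FreeGroup (Fin n))) : Prop where
  inv : ∀ x ∈ T, x⁻¹ ∈ T
  one : 1 ∉ T
  lt : ∀ x ∈ T, ∀ y ∈ T, x * y ≠ 1 → nu x < nu (x * y)

namespace NielsenReduced

variable {T : Set (FreeGroup (Fin n))} (hT : NielsenReduced T)

include hT

lemma lt' {x y : FreeGroup (Fin n)} (hx : x ∈ T) (hy : y ∈ T) (h : x * y ≠ 1) :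
    nu y < nu (x * y) := by
  have := hT.lt y⁻¹ (hT.inv y hy) x⁻¹ (hT.inv x hx)
  rw [← mul_inv_rev, nu_inv, nu_inv] at this
  exact this (inv_ne_one.2 h)

lemma two_gp_le {x y : FreeGroup (Fin n)} (hx : x ∈ T) (hy : y ∈ T) (h : x * y ≠ 1) :
    2 * gp x⁻¹ y ≤ x.norm ∧ 2 * gp x⁻¹ y ≤ y.norm := by
  have h1 := norm_le_of_nu_le (hT.lt x hx y hy h).le
  have h2 := norm_le_of_nu_le (hT.lt' hx hy h).le
  have := norm_mul x y
  omega

lemma code_lt_of_two_gp {x y : FreeGroup (Fin n)} (hx : x ∈ T) (hy : y ∈ T) (h : x * y ≠ 1)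
    (hg : 2 * gp x⁻¹ y = y.norm) : code (half y) < code (half y⁻¹) := by
  obtain ⟨K, hK, e⟩ := nu_mul hg (by have := hT.two_gp_le hx hy h; omega)
  have := hT.lt x hx y hy h
  by_contra! hle
  nlinarith

lemma gp_add_lt {x y z : FreeGroup (Fin n)} (hx : x ∈ T) (hy : y ∈ T) (hz : z ∈ T)
    (h : x * y ≠ 1) (h' : y * z ≠ 1) : gp x⁻¹ y + gp y⁻¹ z < y.norm := by
  have h1 := hT.two_gp_le hx hy h
  have h2 := hT.two_gp_le hy hz h'
  by_contra! hle
  have h3 := hT.code_lt_of_two_gp hx hy h (by omega)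
  have h4 := hT.code_lt_of_two_gp (hT.inv z hz) (hT.inv y hy)
    (by rw [← mul_inv_rev]; exact inv_ne_one.2 h')
    (by rw [inv_inv, gp_comm, norm_inv_eq]; omega)
  rw [inv_inv] at h4
  omega

lemma chain_aux (l : List (FreeGroup (Fin n))) : ∀ y, (∀ t ∈ l, t ∈ T) → y ∈ T →
    (l ++ [y]).IsChain (fun a b => a * b ≠ 1) →
    y.norm ≤ (l.prod * y).norm ∧ (∀ z ∈ T, y * z ≠ 1 → gp (l.prod * y)⁻¹ z = gp y⁻¹ z) ∧
      (l ≠ [] → nu l.prod < nu (l.prod * y)) := by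
  induction l using List.reverseRecOn with
  | nil => intro y _ _ _; simp
  | append_singleton l x ih =>
    intro y hl hy hc
    have hx : x ∈ T := hl x (by simp)
    obtain ⟨hc1, -, hc2⟩ := List.isChain_append.1 hc
    have hxy : x * y ≠ 1 := hc2 x (by simp) y (by simp)
    obtain ⟨i1, i2, -⟩ := ih x (fun t ht => hl t (by simp [ht])) hx hc1
    have e1 := i2 y hy hxy
    have e2 := hT.two_gp_le hx hy hxy
    rw [List.prod_append, List.prod_singleton]
    set W := l.prod * x with hW
    have e3 := norm_mul W y
    refine ⟨by omega, fun z hz hyz => ?_, fun _ => ?_⟩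
    · have h1 := hT.gp_add_lt hx hy hz hxy hyz
      have h2 := gp_inv_mul y W⁻¹
      rw [gp_comm y, e1] at h2
      rw [mul_inv_rev]
      exact gp_eq_of_lt (by omega)
    · rcases e2.2.eq_or_lt with heq | hlt
      · obtain ⟨K, hK, e⟩ := nu_mul (x := W) (y := y) (by omega) (by omega)
        have := hT.code_lt_of_two_gp hx hy hxy heq
        nlinarith
      · exact nu_lt_of_norm_lt (by omega)

lemma nu_lt_append (l m : List (FreeGroup (Fin n))) (hl : l ≠ []) (hm : m ≠ [])
    (hlm : ∀ t ∈ l ++ m, t ∈ T) (hc : (l ++ m).IsChain (fun a b => a * b ≠ 1)) :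
    nu l.prod < nu (l ++ m).prod := by
  induction m using List.reverseRecOn with
  | nil => exact absurd rfl hm
  | append_singleton m x ih =>
    rw [← List.append_assoc] at hc hlm ⊢
    have h1 := (hT.chain_aux (l ++ m) x (fun t ht => hlm t (List.mem_append_left _ ht))
      (hlm x (by simp)) hc).2.2 (by simp [hl])
    rw [List.prod_append (l₁ := l ++ m), List.prod_singleton]
    by_cases hm0 : m = []
    · simpa [hm0] using h1
    · exact (ih hm0 (fun t ht => hlm t (List.mem_append_left _ ht)) (List.isChain_append.1 hc).1).trans h1

lemma nu_lt_append' (l m : List (FreeGroup (Fin n))) (hl : l ≠ []) (hm : m ≠ [])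
    (hlm : ∀ t ∈ l ++ m, t ∈ T) (hc : (l ++ m).IsChain (fun a b => a * b ≠ 1)) :
    nu m.prod < nu (l ++ m).prod := by
  have := hT.nu_lt_append (m.map (·⁻¹)).reverse (l.map (·⁻¹)).reverse (by simpa) (by simpa) ?_ ?_
  · rwa [← List.reverse_append, ← List.map_append, ← List.prod_inv_reverse,
      ← List.prod_inv_reverse, nu_inv, nu_inv] at this
  · intro t ht
    have : t⁻¹ ∈ l ++ m := by
      simp only [List.mem_append, List.mem_reverse, List.mem_map] at ht ⊢
      rcases ht with ⟨a, h, rfl⟩ | ⟨a, h, rfl⟩ <;> simp [h]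
    simpa using hT.inv _ (hlm _ this)
  · rw [← List.reverse_append, ← List.map_append, List.isChain_reverse, List.isChain_map]
    refine hc.imp fun a b h h' => h ?_
    rw [← mul_inv_rev, inv_eq_one] at h'
    exact h'

lemma nu_le_prod {l : List (FreeGroup (Fin n))} (hl : ∀ t ∈ l, t ∈ T)
    (hc : l.IsChain (fun a b => a * b ≠ 1)) {t : FreeGroup (Fin n)} (ht : t ∈ l) :
    l = [t] ∨ nu t < nu l.prod := by
  obtain ⟨a, b, rfl⟩ := List.append_of_mem ht
  by_cases ha : a = []
  · subst ha
    by_cases hb : b = []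
    · left; simp [hb]
    · right
      simpa using hT.nu_lt_append [t] b (by simp) hb hl hc
  · right
    have h1 := hT.nu_lt_append' a (t :: b) ha (by simp) hl hc
    by_cases hb : b = []
    · subst hb; simpa using h1
    · refine lt_trans ?_ h1
      simpa using hT.nu_lt_append [t] b (by simp) hb (fun x hx => hl x (List.mem_append_right _ hx))
        (List.isChain_append.1 hc).2.1

lemma exists_chain {x : FreeGroup (Fin n)} (hx : x ∈ Subgroup.closure T) :
    ∃ l : List (FreeGroup (Fin n)), (∀ t ∈ l, t ∈ T) ∧ l.IsChain (fun a b => a * b ≠ 1) ∧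
      l.prod = x := by
  have key : ∀ t ∈ T, ∀ y, (∃ l : List (FreeGroup (Fin n)), (∀ t ∈ l, t ∈ T) ∧
      l.IsChain (fun a b => a * b ≠ 1) ∧ l.prod = y) → (∃ l : List (FreeGroup (Fin n)),
      (∀ t ∈ l, t ∈ T) ∧ l.IsChain (fun a b => a * b ≠ 1) ∧ l.prod = t * y) := by
    rintro t ht y ⟨l, h1, h2, rfl⟩
    rcases l with _ | ⟨b, l⟩
    · exact ⟨[t], by simpa using ht, by simp, by simp⟩
    · by_cases h : t * b = 1
      · refine ⟨l, fun s hs => h1 s (by simp [hs]), h2.tail, ?_⟩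
        rw [List.prod_cons, ← mul_assoc, h, one_mul]
      · refine ⟨t :: b :: l, ?_, ?_, by simp⟩
        · intro s hs
          rcases List.mem_cons.1 hs with rfl | hs
          · exact ht
          · exact h1 s hs
        · exact List.isChain_cons_cons.2 ⟨h, h2⟩
  induction hx using Subgroup.closure_induction_left with
  | one => exact ⟨[], by simp, by simp, by simp⟩
  | mul_left t ht y _ ih => exact key t ht y ih
  | inv_mul_cancel t ht y _ ih => exact key _ (hT.inv t ht) y ih

/-- A Nielsen reduced free symmetric generating set is determined by the subgroup it generates. -/
lemma mem_iff (hfree : ∀ t ∈ T, t ∉ Subgroup.closure (T \ {t, t⁻¹})) (x : FreeGroup (Fin n)) :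
    x ∈ T ↔ x ∈ Subgroup.closure T ∧ x ≠ 1 ∧
      x ∉ Subgroup.closure {y | y ∈ Subgroup.closure T ∧ nu y < nu x} := by
  constructor
  · intro hx
    refine ⟨Subgroup.subset_closure hx, fun h => hT.one (h ▸ hx), fun h => hfree x hx ?_⟩
    refine (Subgroup.closure_le _).2 ?_ h
    rintro y ⟨hy, hlt⟩
    obtain ⟨l, h1, h2, rfl⟩ := hT.exists_chain hy
    refine Subgroup.list_prod_mem _ fun t ht => Subgroup.subset_closure ⟨h1 t ht, ?_⟩
    have : nu t ≤ nu l.prod := by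
      rcases hT.nu_le_prod h1 h2 ht with h | h
      · simp [h]
      · exact h.le
    rintro (rfl | h)
    · omega
    · rw [Set.mem_singleton_iff] at h
      rw [h, nu_inv] at this
      omega
  · rintro ⟨h1, h2, h3⟩
    obtain ⟨l, h4, h5, rfl⟩ := hT.exists_chain h1
    by_cases h6 : ∃ t ∈ l, l = [t]
    · obtain ⟨t, ht, hl⟩ := h6
      rw [hl, List.prod_singleton]
      exact h4 t ht
    · push Not at h6
      refine absurd (Subgroup.list_prod_mem _ fun t ht => ?_) h3
      exact Subgroup.subset_closure ⟨Subgroup.subset_closure (h4 t ht),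
        (hT.nu_le_prod h4 h5 ht).resolve_left (h6 t ht)⟩

end NielsenReduced

end Weight

end WordCx

namespace WordCx

open scoped Pointwise

section Basic

variable {n : ℕ}

/-- The subgroup of the free group generated by a set of generators. -/
def FA (A : Finset (Fin n)) : Subgroup (FreeGroup (Fin n)) :=
  Subgroup.closure (FreeGroup.of '' A)

/-- The retraction of the free group killing the generators outside `A`. -/
def pj (A : Finset (Fin n)) : FreeGroup (Fin n) →* FreeGroup (Fin n) :=
  FreeGroup.lift fun i => if i ∈ A then FreeGroup.of i else 1

lemma pj_of (A : Finset (Fin n)) (i : Fin n) :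
    pj A (FreeGroup.of i) = if i ∈ A then FreeGroup.of i else 1 := by simp [pj]

lemma of_mem_FA {A : Finset (Fin n)} {i : Fin n} (h : i ∈ A) : FreeGroup.of i ∈ FA A :=
  Subgroup.subset_closure ⟨i, h, rfl⟩

lemma FA_le {A : Finset (Fin n)} {H : Subgroup (FreeGroup (Fin n))}
    (h : ∀ i ∈ A, FreeGroup.of i ∈ H) : FA A ≤ H := by
  refine (Subgroup.closure_le _).2 ?_
  rintro _ ⟨i, hi, rfl⟩
  exact h i hi

lemma FA_mono {A B : Finset (Fin n)} (h : A ⊆ B) : FA A ≤ FA B :=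
  FA_le fun _ hi => of_mem_FA (h hi)

lemma FA_univ (x : FreeGroup (Fin n)) : x ∈ FA Finset.univ := by
  induction x using FreeGroup.induction_on with
  | C1 => exact one_mem _
  | of i => exact of_mem_FA (Finset.mem_univ i)
  | inv_of i h => exact inv_mem h
  | mul x y hx hy => exact mul_mem hx hy

lemma pj_mem (A : Finset (Fin n)) (x : FreeGroup (Fin n)) : pj A x ∈ FA A := by
  induction x using FreeGroup.induction_on with
  | C1 => simp
  | of i =>
    rw [pj_of]
    split_ifs with h
    · exact of_mem_FA h
    · exact one_mem _
  | inv_of i h => rw [map_inv]; exact inv_mem h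
  | mul x y hx hy => rw [map_mul]; exact mul_mem hx hy

lemma pj_eq_of_mem {A B : Finset (Fin n)} (hAB : A ⊆ B) {x : FreeGroup (Fin n)} (hx : x ∈ FA A) :
    pj B x = x := by
  have : FA A ≤ (pj B).eqLocus (MonoidHom.id _) :=
    FA_le fun i hi => by
      change pj B (FreeGroup.of i) = FreeGroup.of i
      rw [pj_of, if_pos (hAB hi)]
  exact this hx

lemma mem_FA_iff {A : Finset (Fin n)} {x : FreeGroup (Fin n)} : x ∈ FA A ↔ pj A x = x :=
  ⟨pj_eq_of_mem subset_rfl, fun h => h ▸ pj_mem A x⟩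

lemma pj_pj (A B : Finset (Fin n)) (x : FreeGroup (Fin n)) : pj A (pj B x) = pj (A ∩ B) x := by
  have : (pj A).comp (pj B) = pj (A ∩ B) := by
    ext i
    simp only [MonoidHom.comp_apply, pj_of, Finset.mem_inter]
    by_cases h1 : i ∈ A <;> by_cases h2 : i ∈ B <;> simp [h1, h2, pj_of]
  exact DFunLike.congr_fun this x

lemma pj_eq_one {A B : Finset (Fin n)} (h : Disjoint A B) {x : FreeGroup (Fin n)} (hx : x ∈ FA B) :
    pj A x = 1 := by
  have : FA B ≤ (pj A).ker := FA_le fun i hi => by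
    rw [MonoidHom.mem_ker, pj_of, if_neg (Finset.disjoint_right.1 h hi)]
  exact this hx

lemma mem_FA_inter {A B : Finset (Fin n)} {x : FreeGroup (Fin n)} (hA : x ∈ FA A) (hB : x ∈ FA B) :
    x ∈ FA (A ∩ B) := by
  rw [mem_FA_iff, ← pj_pj, mem_FA_iff.1 hB, mem_FA_iff.1 hA]

/-- A generator of the free group or its inverse. -/
def ltr (a : Fin n × Bool) : FreeGroup (Fin n) := FreeGroup.mk [a]

lemma ltr_true (i : Fin n) : ltr (i, true) = FreeGroup.of i := rfl

lemma ltr_inv (a : Fin n × Bool) : (ltr a)⁻¹ = ltr (a.1, !a.2) := by simp [ltr, FreeGroup.invRev]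

lemma ltr_false (i : Fin n) : ltr (i, false) = (FreeGroup.of i)⁻¹ := by
  rw [← ltr_true, ltr_inv]; rfl

lemma ltr_injective : Function.Injective (ltr (n := n)) := by
  intro a b h
  have := congrArg FreeGroup.toWord h
  simpa [ltr, FreeGroup.toWord_mk] using this

lemma ltr_mem {A : Finset (Fin n)} {a : Fin n × Bool} : ltr a ∈ FA A ↔ a.1 ∈ A := by
  obtain ⟨i, b⟩ := a
  have h : FreeGroup.of i ∈ FA A ↔ i ∈ A := by
    refine ⟨fun h => ?_, of_mem_FA⟩
    rw [mem_FA_iff, pj_of] at h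
    by_contra hi
    rw [if_neg hi] at h
    exact FreeGroup.of_ne_one i h.symm
  cases b
  · rw [ltr_false, inv_mem_iff, h]
  · rw [ltr_true, h]

lemma FA_injective : Function.Injective (FA (n := n)) := by
  intro A B h
  ext i
  rw [← ltr_mem (a := (i, true)), h, ltr_mem]

/-- Automorphisms preserving the free factor generated by `A` and fixing the other generators. -/
def GA (A : Finset (Fin n)) : Subgroup (MulAut (FreeGroup (Fin n))) where
  carrier := {g | (∀ b ∉ A, g (FreeGroup.of b) = FreeGroup.of b) ∧ ∀ x, g x ∈ FA A ↔ x ∈ FA A}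
  one_mem' := ⟨fun _ _ => rfl, fun _ => Iff.rfl⟩
  mul_mem' := fun {g h} hg hh => ⟨fun b hb => by rw [MulAut.mul_apply, hh.1 b hb, hg.1 b hb],
    fun x => by rw [MulAut.mul_apply, hg.2, hh.2]⟩
  inv_mem' := fun {g} hg => ⟨fun b hb => by
    conv_lhs => rw [← hg.1 b hb]
    exact MulAut.inv_apply_self _ _ _, fun x => by
    rw [← hg.2, MulAut.apply_inv_self]⟩

lemma mem_GA_of {A : Finset (Fin n)} {g : MulAut (FreeGroup (Fin n))}
    (h1 : ∀ b ∉ A, g (FreeGroup.of b) = FreeGroup.of b)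
    (h2 : ∀ b ∈ A, g (FreeGroup.of b) ∈ FA A) (h3 : ∀ b ∈ A, g⁻¹ (FreeGroup.of b) ∈ FA A) :
    g ∈ GA A := by
  refine ⟨h1, fun x => ⟨fun h => ?_, fun h => ?_⟩⟩
  · have : FA A ≤ (FA A).comap (g⁻¹ : MulAut _).toMonoidHom := FA_le fun i hi => h3 i hi
    simpa using this h
  · exact (FA_le fun i hi => h2 i hi : FA A ≤ (FA A).comap g.toMonoidHom) h

lemma GA_fix {A : Finset (Fin n)} {g : MulAut (FreeGroup (Fin n))} (hg : g ∈ GA A) {b : Fin n}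
    (hb : b ∉ A) : g (FreeGroup.of b) = FreeGroup.of b := hg.1 b hb

lemma GA_fix' {A B : Finset (Fin n)} {g : MulAut (FreeGroup (Fin n))} (hg : g ∈ GA A)
    (hB : Disjoint A B) {x : FreeGroup (Fin n)} (hx : x ∈ FA B) : g x = x := by
  have : FA B ≤ g.toMonoidHom.eqLocus (MonoidHom.id _) :=
    FA_le fun i hi => GA_fix hg (Finset.disjoint_right.1 hB hi)
  exact this hx

lemma GA_mem {A B : Finset (Fin n)} (hAB : A ⊆ B) {g : MulAut (FreeGroup (Fin n))} (hg : g ∈ GA A)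
    {x : FreeGroup (Fin n)} : g x ∈ FA B ↔ x ∈ FA B := by
  have key : ∀ g ∈ GA A, FA B ≤ (FA B).comap (MulEquiv.toMonoidHom g) := fun g hg =>
    FA_le fun i hi => by
      by_cases h : i ∈ A
      · exact FA_mono hAB ((hg.2 _).2 (of_mem_FA h))
      · exact (show g (FreeGroup.of i) ∈ FA B by rw [GA_fix hg h]; exact of_mem_FA hi)
  refine ⟨fun h => ?_, fun h => key g hg h⟩
  have := key _ (inv_mem hg) h
  simpa using this

lemma GA_mono {A B : Finset (Fin n)} (hAB : A ⊆ B) : GA A ≤ GA B := fun _ hg =>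
  ⟨fun b hb => hg.1 b fun h => hb (hAB h), fun _ => GA_mem hAB hg⟩

lemma GA_univ (g : MulAut (FreeGroup (Fin n))) : g ∈ GA Finset.univ :=
  ⟨fun b hb => absurd (Finset.mem_univ b) hb, fun _ => ⟨fun _ => FA_univ _, fun _ => FA_univ _⟩⟩

lemma smul_FA {A B : Finset (Fin n)} (hAB : A ⊆ B) {g : MulAut (FreeGroup (Fin n))} (hg : g ∈ GA A) :
    g • FA B = FA B := by
  ext x
  rw [Subgroup.mem_pointwise_smul_iff_inv_smul_mem, MulAut.smul_def, GA_mem hAB (inv_mem hg)]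

/-- The endomorphism multiplying one generator on both sides. -/
def tvHom (a : Fin n) (u w : FreeGroup (Fin n)) : FreeGroup (Fin n) →* FreeGroup (Fin n) :=
  FreeGroup.lift fun i => if i = a then u * FreeGroup.of a * w else FreeGroup.of i

lemma tvHom_of (a : Fin n) (u w : FreeGroup (Fin n)) (i : Fin n) : tvHom a u w (FreeGroup.of i) =
    if i = a then u * FreeGroup.of a * w else FreeGroup.of i := by simp [tvHom]

lemma tvHom_eq {a : Fin n} {u w x : FreeGroup (Fin n)} {A : Finset (Fin n)} (ha : a ∉ A)
    (hx : x ∈ FA A) : tvHom a u w x = x := by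
  have : FA A ≤ (tvHom a u w).eqLocus (MonoidHom.id _) := FA_le fun i hi => by
    have : i ≠ a := fun h => ha (h ▸ hi)
    change tvHom a u w (FreeGroup.of i) = FreeGroup.of i
    rw [tvHom_of, if_neg this]
  exact this hx

lemma tvHom_tvHom {a : Fin n} {u w u' w' : FreeGroup (Fin n)} {A : Finset (Fin n)} (ha : a ∉ A)
    (hu : u ∈ FA A) (hw : w ∈ FA A) (x : FreeGroup (Fin n)) :
    tvHom a u' w' (tvHom a u w x) = tvHom a (u * u') (w' * w) x := by
  have : (tvHom a u' w').comp (tvHom a u w) = tvHom a (u * u') (w' * w) := by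
    ext i
    rw [MonoidHom.comp_apply, tvHom_of, tvHom_of]
    split_ifs with h
    · rw [map_mul, map_mul, tvHom_eq ha hu, tvHom_eq ha hw, tvHom_of, if_pos rfl]
      group
    · rw [tvHom_of, if_neg h]
  exact DFunLike.congr_fun this x

lemma tvHom_one (a : Fin n) (x : FreeGroup (Fin n)) : tvHom a 1 1 x = x := by
  have : tvHom a 1 1 = MonoidHom.id _ := by
    ext i
    rw [tvHom_of]
    split_ifs with h <;> simp [h]
  exact DFunLike.congr_fun this x

/-- The automorphism multiplying the generator `a` on both sides by elements of a free factor
not involving `a`. -/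
def tv (a : Fin n) (u w : FA ({a}ᶜ : Finset (Fin n))) : MulAut (FreeGroup (Fin n)) where
  toFun := tvHom a u w
  invFun := tvHom a (u⁻¹ : FA _) (w⁻¹ : FA _)
  left_inv x := by
    rw [tvHom_tvHom (A := {a}ᶜ) (by simp) u.2 w.2]
    simp [tvHom_one]
  right_inv x := by
    rw [tvHom_tvHom (A := {a}ᶜ) (by simp) (u⁻¹).2 (w⁻¹).2]
    simp [tvHom_one]
  map_mul' := map_mul _

lemma tv_apply (a : Fin n) (u w : FA ({a}ᶜ : Finset (Fin n))) (x : FreeGroup (Fin n)) :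
    tv a u w x = tvHom a u w x := rfl

lemma tv_inv_apply (a : Fin n) (u w : FA ({a}ᶜ : Finset (Fin n))) (x : FreeGroup (Fin n)) :
    (tv a u w)⁻¹ x = tvHom a (u⁻¹ : FA _) (w⁻¹ : FA _) x := rfl

lemma tvHom_of_self (a : Fin n) (u w : FreeGroup (Fin n)) :
    tvHom a u w (FreeGroup.of a) = u * FreeGroup.of a * w := by rw [tvHom_of, if_pos rfl]

lemma tvHom_of_ne {a i : Fin n} (h : i ≠ a) (u w : FreeGroup (Fin n)) :
    tvHom a u w (FreeGroup.of i) = FreeGroup.of i := by rw [tvHom_of, if_neg h]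

lemma tv_mem {a : Fin n} {u w : FA ({a}ᶜ : Finset (Fin n))} {A : Finset (Fin n)} (ha : a ∈ A)
    (hu : (u : FreeGroup (Fin n)) ∈ FA A) (hw : (w : FreeGroup (Fin n)) ∈ FA A) : tv a u w ∈ GA A := by
  have key : ∀ u w : FreeGroup (Fin n), u ∈ FA A → w ∈ FA A → ∀ b ∈ A,
      tvHom a u w (FreeGroup.of b) ∈ FA A := by
    intro u w hu hw b hb
    rw [tvHom_of]
    split_ifs
    · exact mul_mem (mul_mem hu (of_mem_FA ha)) hw
    · exact of_mem_FA hb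
  refine mem_GA_of (fun b hb => ?_) (key _ _ hu hw) ?_
  · rw [tv_apply, tvHom_of_ne (by rintro rfl; exact hb ha)]
  · simp only [tv_inv_apply]
    exact key _ _ (by simpa using hu) (by simpa using hw)

/-- The involution of letters exchanging `a` and `b`, compatible with inversion. -/
def swl (a b x : Fin n × Bool) : Fin n × Bool :=
  if x = a then b else if x = (a.1, !a.2) then (b.1, !b.2) else if x = b then a
  else if x = (b.1, !b.2) then (a.1, !a.2) else x

lemma swl_inv (a b x : Fin n × Bool) :
    swl a b (x.1, !x.2) = ((swl a b x).1, !(swl a b x).2) := by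
  obtain ⟨a, e⟩ := a
  obtain ⟨b, f⟩ := b
  obtain ⟨x, g⟩ := x
  simp only [swl, Prod.mk.injEq]
  by_cases h1 : x = a <;> by_cases h2 : x = b <;> simp only [h1, h2, true_and, false_and, if_false] <;>
    cases e <;> cases f <;> cases g <;> simp <;> split_ifs <;> simp_all

lemma swl_swl (a b x : Fin n × Bool) : swl a b (swl a b x) = x := by
  obtain ⟨a, e⟩ := a
  obtain ⟨b, f⟩ := b
  obtain ⟨x, g⟩ := x
  simp only [swl, Prod.mk.injEq]
  by_cases h0 : a = b <;> by_cases h1 : x = a <;> by_cases h2 : x = b <;>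
    cases e <;> cases f <;> cases g <;> simp_all

lemma swl_left (a b : Fin n × Bool) : swl a b a = b := by simp [swl]

lemma swl_of_ne {a b x : Fin n × Bool} (h : x.1 ≠ a.1) (h' : x.1 ≠ b.1) : swl a b x = x := by
  rw [swl, if_neg, if_neg, if_neg, if_neg] <;> rintro rfl <;> simp_all

lemma swl_mem {A : Finset (Fin n)} {a b x : Fin n × Bool} (ha : a.1 ∈ A) (hb : b.1 ∈ A)
    (hx : x.1 ∈ A) : (swl a b x).1 ∈ A := by
  simp only [swl]
  split_ifs <;> assumption

/-- The endomorphism induced by a map of letters. -/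
def swHom (a b : Fin n × Bool) : FreeGroup (Fin n) →* FreeGroup (Fin n) :=
  FreeGroup.lift fun i => ltr (swl a b (i, true))

lemma swHom_ltr (a b x : Fin n × Bool) : swHom a b (ltr x) = ltr (swl a b x) := by
  have h (i : Fin n) : swHom a b (FreeGroup.of i) = ltr (swl a b (i, true)) := by simp [swHom]
  obtain ⟨i, e⟩ := x
  cases e
  · rw [ltr_false, map_inv, h, ltr_inv, ← swl_inv]; rfl
  · rw [ltr_true, h]

lemma swHom_swHom (a b : Fin n × Bool) (x : FreeGroup (Fin n)) : swHom a b (swHom a b x) = x := by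
  have : (swHom a b).comp (swHom a b) = MonoidHom.id _ := by
    ext i
    rw [MonoidHom.comp_apply, ← ltr_true, swHom_ltr, swHom_ltr, swl_swl]; rfl
  exact DFunLike.congr_fun this x

/-- The automorphism exchanging two letters. -/
def sw (a b : Fin n × Bool) : MulAut (FreeGroup (Fin n)) where
  toFun := swHom a b
  invFun := swHom a b
  left_inv := swHom_swHom a b
  right_inv := swHom_swHom a b
  map_mul' := map_mul _

lemma sw_ltr (a b x : Fin n × Bool) : sw a b (ltr x) = ltr (swl a b x) := swHom_ltr a b x

lemma sw_inv (a b : Fin n × Bool) : (sw a b)⁻¹ = sw a b := rfl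

lemma sw_mem {A : Finset (Fin n)} {a b : Fin n × Bool} (ha : a.1 ∈ A) (hb : b.1 ∈ A) :
    sw a b ∈ GA A := by
  have key : ∀ c ∈ A, sw a b (FreeGroup.of c) ∈ FA A := by
    intro c hc
    rw [← ltr_true, sw_ltr, ltr_mem]
    exact swl_mem ha hb hc
  refine mem_GA_of (fun c hc => ?_) key key
  rw [← ltr_true, sw_ltr, swl_of_ne] <;> rintro rfl <;> contradiction

end Basic

end WordCx

namespace WordCx

open scoped Pointwise

section Complex

variable {n : ℕ}

/-- Vertices: an element of the free group with a subgroup. -/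
abbrev Vt (n : ℕ) : Type := FreeGroup (Fin n) × Subgroup (FreeGroup (Fin n))

/-- The standard vertex attached to a letter. -/
def std (A : Finset (Fin n)) (a : Fin n × Bool) : Vt n := (ltr a, FA (A.erase a.1))

lemma std_injective (A : Finset (Fin n)) : Function.Injective (std A) := fun _ _ h =>
  ltr_injective (congrArg Prod.fst h)

/-- The index set of a word of letters. -/
def idxs (σ : List (Fin n × Bool)) : Finset (Fin n) := (σ.map Prod.fst).toFinset

lemma mem_idxs {σ : List (Fin n × Bool)} {i : Fin n} : i ∈ idxs σ ↔ ∃ a ∈ σ, a.1 = i := by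
  simp [idxs]

lemma idxs_subset {σ τ : List (Fin n × Bool)} (h : σ.Sublist τ) : idxs σ ⊆ idxs τ := by
  intro i hi
  rw [mem_idxs] at hi ⊢
  exact hi.imp fun a ha => ⟨h.subset ha.1, ha.2⟩

lemma idxs_cons (a : Fin n × Bool) (σ : List (Fin n × Bool)) :
    idxs (a :: σ) = insert a.1 (idxs σ) := by simp [idxs]

lemma idxs_nil : idxs ([] : List (Fin n × Bool)) = ∅ := rfl

lemma card_idxs_le (σ : List (Fin n × Bool)) : (idxs σ).card ≤ σ.length := by
  simpa [idxs] using List.toFinset_card_le (σ.map Prod.fst)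

/-- The complex of words in translates of standard vertices. -/
def XA (A : Finset (Fin n)) : Set (List (Vt n)) :=
  {v | ∃ g ∈ GA A, ∃ σ : List (Fin n × Bool), (∀ a ∈ σ, a.1 ∈ A) ∧ v = sm g (σ.map (std A))}

lemma sublist_map_exists {α β : Type*} {f : α → β} {l : List α} {t : List β}
    (h : t.Sublist (l.map f)) : ∃ m : List α, m.Sublist l ∧ t = m.map f := by
  obtain ⟨m, h1, h2⟩ := List.sublist_map_iff.1 h
  exact ⟨m, h1, h2⟩

lemma XA_faceClosed (A : Finset (Fin n)) : FaceClosed (XA A) := by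
  rintro _ t ht ⟨g, hg, σ, hσ, rfl⟩
  rw [sm, List.map_map] at ht
  obtain ⟨τ, hτ, rfl⟩ := sublist_map_exists ht
  exact ⟨g, hg, τ, fun a ha => hσ a (hτ.subset ha), by rw [sm, List.map_map]⟩

lemma XA_stable (A : Finset (Fin n)) : ∀ g ∈ GA A, ∀ v ∈ XA A, sm g v ∈ XA A := by
  rintro g hg _ ⟨h, hh, σ, hσ, rfl⟩
  exact ⟨g * h, mul_mem hg hh, σ, hσ, by rw [mul_sm]⟩

lemma std_mem_XA {A : Finset (Fin n)} {σ : List (Fin n × Bool)} (hσ : ∀ a ∈ σ, a.1 ∈ A) :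
    σ.map (std A) ∈ XA A := ⟨1, one_mem _, σ, hσ, by simp [sm]⟩

lemma nil_mem_XA (A : Finset (Fin n)) : [] ∈ XA A := std_mem_XA (σ := []) (by simp)

lemma smul_std_eq {A : Finset (Fin n)} {g : MulAut (FreeGroup (Fin n))} {a b : Fin n × Bool} :
    g • std A a = std A b ↔ g (ltr a) = ltr b ∧ g • FA (A.erase a.1) = FA (A.erase b.1) := by
  rw [std, std, Prod.smul_mk, Prod.mk.injEq]; rfl

lemma GA_le_stab {A W : Finset (Fin n)} {g : MulAut (FreeGroup (Fin n))}
    (hg : g ∈ GA (A \ W)) {a : Fin n × Bool} (ha : a.1 ∈ W) : g • std A a = std A a := by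
  refine smul_std_eq.2 ⟨GA_fix' (B := {a.1}) hg (by simp [ha]) (by simp [ltr_mem]), smul_FA ?_ hg⟩
  intro i hi
  rw [Finset.mem_sdiff] at hi
  rw [Finset.mem_erase]
  exact ⟨by rintro rfl; exact hi.2 ha, hi.1⟩

lemma mem_FA_sdiff {A W : Finset (Fin n)} {x : FreeGroup (Fin n)} :
    x ∈ FA (A \ W) ↔ x ∈ FA A ∧ ∀ i ∈ W, x ∈ FA (A.erase i) := by
  constructor
  · refine fun h => ⟨FA_mono Finset.sdiff_subset h, fun i hi => FA_mono ?_ h⟩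
    intro j hj
    rw [Finset.mem_sdiff] at hj
    exact Finset.mem_erase.2 ⟨by rintro rfl; exact hj.2 hi, hj.1⟩
  · rintro ⟨h, h'⟩
    induction W using Finset.induction_on with
    | empty => simpa using h
    | insert i W hi ih =>
      have := mem_FA_inter (ih fun j hj => h' j (Finset.mem_insert_of_mem hj))
        (h' i (Finset.mem_insert_self _ _))
      refine FA_mono ?_ this
      intro j hj
      simp only [Finset.mem_inter, Finset.mem_sdiff, Finset.mem_erase, Finset.mem_insert] at hj ⊢
      tauto

lemma sm_map_std_eq {A : Finset (Fin n)} {g : MulAut (FreeGroup (Fin n))} {σ : List (Fin n × Bool)} :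
    sm g (σ.map (std A)) = σ.map (std A) ↔ ∀ a ∈ σ, g • std A a = std A a := by
  rw [sm, List.map_map, List.map_inj_left]; rfl

lemma smul_mem_iff {g : MulAut (FreeGroup (Fin n))} {H : Subgroup (FreeGroup (Fin n))}
    {x : FreeGroup (Fin n)} : g x ∈ g • H ↔ x ∈ H :=
  Subgroup.smul_mem_pointwise_smul_iff (a := g) (S := H) (x := x)

lemma Stab_std {A : Finset (Fin n)} {σ : List (Fin n × Bool)} :
    Stab (GA A) (σ.map (std A)) = GA (A \ idxs σ) := by
  ext g
  rw [mem_Stab, sm_map_std_eq]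
  constructor
  · rintro ⟨hg, h⟩
    refine ⟨fun b hb => ?_, fun x => ?_⟩
    · rw [Finset.mem_sdiff, not_and_not_right] at hb
      by_cases hbA : b ∈ A
      · obtain ⟨a, ha, rfl⟩ := mem_idxs.1 (hb hbA)
        have := (smul_std_eq.1 (h a ha)).1
        obtain ⟨i, e⟩ := a
        cases e
        · rw [ltr_false, map_inv, inv_inj] at this; exact this
        · exact this
      · exact GA_fix hg hbA
    · rw [mem_FA_sdiff, mem_FA_sdiff, hg.2]
      refine and_congr_right fun _ => forall₂_congr fun i hi => ?_
      obtain ⟨a, ha, rfl⟩ := mem_idxs.1 hi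
      have := (smul_std_eq.1 (h a ha)).2
      conv_lhs => rw [← this]
      exact smul_mem_iff
  · intro hg
    exact ⟨GA_mono Finset.sdiff_subset hg, fun a ha => GA_le_stab hg (mem_idxs.2 ⟨a, ha, rfl⟩)⟩

/-- Automorphisms in `GA A` permuting the standard vertices. -/
def SP (A : Finset (Fin n)) : Set (MulAut (FreeGroup (Fin n))) :=
  {h | h ∈ GA A ∧ ∀ a : Fin n × Bool, a.1 ∈ A → ∃ b : Fin n × Bool, b.1 ∈ A ∧ h • std A a = std A b}

lemma SP_mul {A : Finset (Fin n)} {g h : MulAut (FreeGroup (Fin n))} (hg : g ∈ SP A) (hh : h ∈ SP A) :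
    g * h ∈ SP A := by
  refine ⟨mul_mem hg.1 hh.1, fun a ha => ?_⟩
  obtain ⟨b, hb, e⟩ := hh.2 a ha
  obtain ⟨c, hc, e'⟩ := hg.2 b hb
  exact ⟨c, hc, by rw [mul_smul, e, e']⟩

lemma sw_smul_std {A : Finset (Fin n)} {a b x : Fin n × Bool} (ha : a.1 ∈ A) (hb : b.1 ∈ A) :
    sw a b • std A x = std A (swl a b x) := by
  refine smul_std_eq.2 ⟨sw_ltr a b x, ?_⟩
  have key : ∀ x, sw a b • FA (A.erase x.1) ≤ FA (A.erase (swl a b x).1) := by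
    intro x y hy
    rw [Subgroup.mem_pointwise_smul_iff_inv_smul_mem, MulAut.smul_def, sw_inv] at hy
    have : FA (A.erase x.1) ≤ (FA (A.erase (swl a b x).1)).comap (sw a b).toMonoidHom := by
      refine FA_le fun i hi => ?_
      rw [Subgroup.mem_comap]
      change sw a b (FreeGroup.of i) ∈ _
      rw [← ltr_true, sw_ltr, ltr_mem, Finset.mem_erase]
      rw [Finset.mem_erase] at hi
      refine ⟨fun h => hi.1 ?_, swl_mem ha hb hi.2⟩
      have h2 : swl a b (i, true) = swl a b x ∨ swl a b (i, true) = swl a b (x.1, !x.2) := by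
        rw [swl_inv]
        generalize swl a b (i, true) = u at *
        generalize swl a b x = v at *
        obtain ⟨u, e⟩ := u
        obtain ⟨v, f⟩ := v
        simp only at h
        subst h
        cases e <;> cases f <;> simp
      have inj : Function.Injective (swl a b) := Function.LeftInverse.injective (swl_swl a b)
      rcases h2 with h2 | h2
      · exact congrArg Prod.fst (inj h2)
      · exact congrArg Prod.fst (inj h2)
    have := this hy
    rw [Subgroup.mem_comap] at this
    change sw a b (sw a b y) ∈ _ at this
    rwa [show sw a b (sw a b y) = y from swHom_swHom a b y] at this
  refine le_antisymm (key x) ?_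
  have := key (swl a b x)
  rw [swl_swl] at this
  intro y hy
  rw [Subgroup.mem_pointwise_smul_iff_inv_smul_mem, MulAut.smul_def, sw_inv]
  refine this ?_
  rw [Subgroup.mem_pointwise_smul_iff_inv_smul_mem, MulAut.smul_def, sw_inv,
    show sw a b (sw a b y) = y from swHom_swHom a b y]
  exact hy

lemma sw_mem_SP {A : Finset (Fin n)} {a b : Fin n × Bool} (ha : a.1 ∈ A) (hb : b.1 ∈ A) :
    sw a b ∈ SP A :=
  ⟨sw_mem ha hb, fun x hx => ⟨swl a b x, swl_mem ha hb hx, sw_smul_std ha hb⟩⟩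

lemma exists_swap {A : Finset (Fin n)} {σ : List (Fin n × Bool)} {a b : Fin n × Bool} (ha : a.1 ∈ A)
    (hb : b.1 ∈ A) (ha' : a.1 ∉ idxs σ) (hb' : b.1 ∉ idxs σ) :
    ∃ h ∈ SP A, sm h (σ.map (std A)) = σ.map (std A) ∧ h • std A a = std A b := by
  refine ⟨sw a b, sw_mem_SP ha hb, sm_map_std_eq.2 fun x hx => ?_, ?_⟩
  · rw [sw_smul_std ha hb, swl_of_ne]
    · rintro h; exact ha' (mem_idxs.2 ⟨x, hx, h⟩)
    · rintro h; exact hb' (mem_idxs.2 ⟨x, hx, h⟩)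
  · rw [sw_smul_std ha hb, swl_left]

lemma erase_inj {A : Finset (Fin n)} {i j : Fin n} (hi : i ∈ A)
    (h : A.erase i = A.erase j) : i = j := by
  by_contra hne
  have : i ∈ A.erase i := h ▸ Finset.mem_erase.2 ⟨hne, hi⟩
  simp at this

lemma smul_std_congr {A : Finset (Fin n)} {g : MulAut (FreeGroup (Fin n))} {a b c d : Fin n × Bool}
    (hb : b.1 ∈ A) (h : g • std A a = std A b) (h' : g • std A c = std A d)
    (hac : a.1 = c.1) : b.1 = d.1 :=
  erase_inj hb (FA_injective (by
    rw [← (smul_std_eq.1 h).2, ← (smul_std_eq.1 h').2, hac]))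

lemma smul_std_congr' {A : Finset (Fin n)} {g : MulAut (FreeGroup (Fin n))} {a b c d : Fin n × Bool}
    (ha : a.1 ∈ A) (h : g • std A a = std A b) (h' : g • std A c = std A d)
    (hbd : b.1 = d.1) : a.1 = c.1 := by
  refine smul_std_congr (g := g⁻¹) ha (a := b) (c := d) ?_ ?_ hbd
  · rw [← h, inv_smul_smul]
  · rw [← h', inv_smul_smul]

lemma smul_std_of_same {A : Finset (Fin n)} {g h : MulAut (FreeGroup (Fin n))}
    {a b c d e : Fin n × Bool} (hac : a.1 = c.1) (hgc : g • std A c = std A d)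
    (hhc : h • std A c = std A d) (hga : g • std A a = std A b) (hha : h • std A a = std A e) :
    b = e := by
  have key : g (ltr a) = h (ltr a) := by
    have h1 : g (ltr c) = h (ltr c) := by rw [(smul_std_eq.1 hgc).1, (smul_std_eq.1 hhc).1]
    obtain ⟨i, x⟩ := a
    obtain ⟨j, y⟩ := c
    simp only at hac
    subst hac
    cases x <;> cases y <;> simp only [ltr_false, ltr_true, map_inv, inv_inj] at h1 ⊢ <;> exact h1
  rw [(smul_std_eq.1 hga).1, (smul_std_eq.1 hha).1] at key
  exact ltr_injective key

lemma exists_SP {A : Finset (Fin n)} {g : MulAut (FreeGroup (Fin n))}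
    (τ : List (Fin n × Bool)) : ∀ σ : List (Fin n × Bool), (∀ a ∈ τ, a.1 ∈ A) → (∀ a ∈ σ, a.1 ∈ A) →
    sm g (τ.map (std A)) = σ.map (std A) →
    ∃ h ∈ SP A, sm h (τ.map (std A)) = σ.map (std A) := by
  induction τ with
  | nil =>
    intro σ _ _ h
    refine ⟨1, ⟨one_mem _, fun a ha => ⟨a, ha, one_smul _ _⟩⟩, ?_⟩
    rw [← h]; rfl
  | cons t τ ih =>
    intro σ hτ hσ h
    obtain ⟨s, σ, rfl⟩ := List.exists_cons_of_length_pos (l := σ) (by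
      have := congrArg List.length h
      simp [sm] at this
      omega)
    simp only [sm, List.map_cons, List.cons.injEq] at h
    obtain ⟨h1, h2⟩ := h
    have hA := hτ t (by simp)
    have hA' := hσ s (by simp)
    obtain ⟨k, hk, e⟩ := ih σ (fun a ha => hτ a (by simp [ha])) (fun a ha => hσ a (by simp [ha])) h2
    obtain ⟨u, hu, hku⟩ := hk.2 t hA
    have pair : ∀ m ∈ τ, ∃ m' ∈ σ, g • std A m = std A m' ∧ k • std A m = std A m' := by
      have h3 : ∀ m ∈ τ, g • std A m = k • std A m := by
        have := h2.trans e.symm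
        rw [sm, List.map_map, List.map_map, List.map_inj_left] at this
        exact this
      intro m hm
      have : g • std A m ∈ σ.map (std A) := by
        rw [← h2, List.map_map]
        exact List.mem_map_of_mem (f := (g • ·) ∘ std A) hm
      obtain ⟨m', hm', he⟩ := List.mem_map.1 this
      exact ⟨m', hm', he.symm, by rw [← h3 m hm, he]⟩
    have pair' : ∀ m' ∈ σ, ∃ m ∈ τ, g • std A m = std A m' ∧ k • std A m = std A m' := by
      intro m' hm'
      have h4 : std A m' ∈ σ.map (std A) := List.mem_map_of_mem hm'
      rw [← h2, List.map_map] at h4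
      obtain ⟨m, hm, he⟩ := List.mem_map.1 h4
      obtain ⟨m'', hm'', e1, e2⟩ := pair m hm
      have : m'' = m' := std_injective A (e1.symm.trans he)
      exact ⟨m, hm, this ▸ e1, this ▸ e2⟩
    by_cases ht : t.1 ∈ idxs τ
    · obtain ⟨m, hm, hmt⟩ := mem_idxs.1 ht
      obtain ⟨m', hm', e1, e2⟩ := pair m hm
      have := smul_std_of_same hmt.symm e1 e2 h1 hku
      refine ⟨k, hk, ?_⟩
      rw [sm, List.map_cons, List.map_cons, List.map_cons, hku, ← this]
      exact congrArg _ e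
    · have hs : s.1 ∉ idxs σ := by
        intro hs
        obtain ⟨m', hm', hms⟩ := mem_idxs.1 hs
        obtain ⟨m, hm, e1, e2⟩ := pair' m' hm'
        exact ht (mem_idxs.2 ⟨m, hm, smul_std_congr' (hτ m (by simp [hm])) e1 h1 hms⟩)
      have hu' : u.1 ∉ idxs σ := by
        intro hs
        obtain ⟨m', hm', hms⟩ := mem_idxs.1 hs
        obtain ⟨m, hm, e1, e2⟩ := pair' m' hm'
        exact ht (mem_idxs.2 ⟨m, hm, smul_std_congr' (hτ m (by simp [hm])) e2 hku hms⟩)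
      obtain ⟨f, hf, f1, f2⟩ := exists_swap hu hA' hu' hs
      refine ⟨f * k, SP_mul hf hk, ?_⟩
      rw [mul_sm]
      have : sm k ((t :: τ).map (std A)) = std A u :: σ.map (std A) := by
        rw [sm, List.map_cons, List.map_cons, hku]
        exact congrArg _ e
      rw [this, sm, List.map_cons, List.map_cons, f2]
      exact congrArg _ f1

/-- The stabilizer of a standard word acts transitively on the new vertices compatible with it. -/
lemma exists_stab_smul {A : Finset (Fin n)} {g : MulAut (FreeGroup (Fin n))} (hg : g ∈ GA A)
    {τ σ : List (Fin n × Bool)} (hτ : ∀ a ∈ τ, a.1 ∈ A) (hσ : ∀ a ∈ σ, a.1 ∈ A)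
    (h : sm g (τ.map (std A)) = σ.map (std A)) {a b : Fin n × Bool} (ha : a.1 ∈ A) (hb : b.1 ∈ A)
    (ha' : a.1 ∉ idxs τ) (hb' : b.1 ∉ idxs σ) :
    ∃ k ∈ GA A, sm k (σ.map (std A)) = σ.map (std A) ∧ k • std A b = g • std A a := by
  obtain ⟨f, hf, e⟩ := exists_SP τ σ hτ hσ h
  obtain ⟨c, hc, e'⟩ := hf.2 a ha
  have hc' : c.1 ∉ idxs σ := by
    intro hcs
    obtain ⟨m', hm', hms⟩ := mem_idxs.1 hcs
    have h4 : std A m' ∈ σ.map (std A) := List.mem_map_of_mem hm'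
    rw [← e, sm, List.map_map] at h4
    obtain ⟨m, hm, he⟩ := List.mem_map.1 h4
    exact ha' (mem_idxs.2 ⟨m, hm, smul_std_congr' (hτ m hm) he e' hms⟩)
  obtain ⟨w, hw, w1, w2⟩ := exists_swap hb hc hb' hc'
  refine ⟨g * f⁻¹ * w, mul_mem (mul_mem hg (inv_mem hf.1)) hw.1, ?_, ?_⟩
  · rw [mul_sm, w1, mul_sm, ← e, ← mul_sm f⁻¹ f, inv_mul_cancel, one_sm, h, e]
  · rw [mul_smul, w2, mul_smul, ← e', inv_smul_smul]

end Complex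

end WordCx

namespace WordCx

open scoped Pointwise

section Acyclic

variable {n : ℕ}

lemma ltr_ne_one (a : Fin n × Bool) : ltr a ≠ 1 := by
  intro h
  have := congrArg FreeGroup.toWord h
  simp [ltr] at this

/-- The images of the letters with index in `I` under an automorphism. -/
def TL (I : Finset (Fin n)) (g : MulAut (FreeGroup (Fin n))) : Set (FreeGroup (Fin n)) :=
  {x | ∃ a : Fin n × Bool, a.1 ∈ I ∧ x = g (ltr a)}

/-- The total weight of a basis. -/
def mu (A : Finset (Fin n)) (g : MulAut (FreeGroup (Fin n))) : ℕ :=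
  ∑ a ∈ A ×ˢ (Finset.univ : Finset Bool), nu (g (ltr a))

lemma mu_eq_of_TL {A : Finset (Fin n)} {g h : MulAut (FreeGroup (Fin n))} (e : TL A g = TL A h) :
    mu A g = mu A h := by
  have key (g : MulAut (FreeGroup (Fin n))) : mu A g = ∑ᶠ x ∈ TL A g, nu x := by
    have : TL A g = ↑((A ×ˢ (Finset.univ : Finset Bool)).image fun a => g (ltr a)) := by
      ext x
      simp only [TL, Set.mem_ofPred_eq, Finset.coe_image, Set.mem_image, Finset.mem_coe,
        Finset.mem_product, Finset.mem_univ, and_true]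
      exact exists_congr fun a => and_congr_right fun _ => eq_comm
    rw [this, finsum_mem_coe_finset, Finset.sum_image]
    · rfl
    · exact fun a _ b _ h => ltr_injective (g.injective h)
  rw [key, key, e]

lemma closure_TL (I : Finset (Fin n)) (g : MulAut (FreeGroup (Fin n))) :
    Subgroup.closure (TL I g) = g • FA I := by
  refine le_antisymm ((Subgroup.closure_le _).2 ?_) ?_
  · rintro _ ⟨a, ha, rfl⟩
    exact smul_mem_iff.2 (ltr_mem.2 ha)
  · intro x hx
    rw [Subgroup.mem_pointwise_smul_iff_inv_smul_mem, MulAut.smul_def] at hx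
    have : FA I ≤ (Subgroup.closure (TL I g)).comap g.toMonoidHom := FA_le fun i hi =>
      Subgroup.subset_closure ⟨(i, true), hi, rfl⟩
    simpa using this hx

lemma TL_diff {I : Finset (Fin n)} {g : MulAut (FreeGroup (Fin n))} (a : Fin n × Bool) :
    TL I g \ {g (ltr a), (g (ltr a))⁻¹} = TL (I.erase a.1) g := by
  ext x
  simp only [TL, Set.mem_sdiff, Set.mem_ofPred_eq, Set.mem_insert_iff, Set.mem_singleton_iff,
    Finset.mem_erase]
  rw [← map_inv, ltr_inv]
  obtain ⟨i, e⟩ := a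
  constructor
  · rintro ⟨⟨⟨j, f⟩, hb, rfl⟩, h⟩
    refine ⟨(j, f), ⟨?_, hb⟩, rfl⟩
    rintro rfl
    apply h
    simp only
    cases e <;> cases f <;> simp
  · rintro ⟨b, ⟨h, hb⟩, rfl⟩
    refine ⟨⟨b, hb, rfl⟩, ?_⟩
    rintro (h' | h')
    · exact h (congrArg Prod.fst (ltr_injective (g.injective h')) :)
    · exact h (congrArg Prod.fst (ltr_injective (g.injective h')) :)

lemma TL_free {I : Finset (Fin n)} {g : MulAut (FreeGroup (Fin n))} :
    ∀ t ∈ TL I g, t ∉ Subgroup.closure (TL I g \ {t, t⁻¹}) := by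
  rintro _ ⟨a, _, rfl⟩ h
  rw [TL_diff, closure_TL, smul_mem_iff, ltr_mem] at h
  simp at h

/-- A pair of basis elements admitting a Nielsen move which lowers the weight. -/
def RedPair (g : MulAut (FreeGroup (Fin n))) (i j : Fin n) : Prop :=
  ∃ a b : Fin n × Bool, a.1 = i ∧ b.1 = j ∧ nu (g (ltr a * ltr b)) < nu (g (ltr a))

lemma nielsenReduced_TL {I : Finset (Fin n)} {g : MulAut (FreeGroup (Fin n))}
    (h : ∀ i ∈ I, ∀ j ∈ I, i ≠ j → ¬ RedPair g i j) : NielsenReduced (TL I g) where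
  inv := by
    rintro _ ⟨a, ha, rfl⟩
    exact ⟨(a.1, !a.2), ha, by rw [← map_inv, ltr_inv]⟩
  one := by
    rintro ⟨a, _, h⟩
    exact ltr_ne_one a (g.injective (by rw [← h, map_one]))
  lt := by
    rintro _ ⟨a, ha, rfl⟩ _ ⟨b, hb, rfl⟩ hne
    have hx : g (ltr a) ≠ 1 := fun h => ltr_ne_one a (g.injective (by rw [h, map_one]))
    have hy : g (ltr b) ≠ 1 := fun h => ltr_ne_one b (g.injective (by rw [h, map_one]))
    have hn := norm_mul (g (ltr a)) (g (ltr b))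
    by_cases hab : a.1 = b.1
    · have : b = a := by
        obtain ⟨i, e⟩ := a
        obtain ⟨j, f⟩ := b
        simp only at hab
        subst hab
        by_contra hef
        apply hne
        rw [← map_mul]
        cases e <;> cases f <;> simp_all [ltr_true, ltr_false]
      subst this
      refine nu_lt_of_norm_lt ?_
      have := two_gp_sq hx
      omega
    · by_contra! hle
      rcases hle.lt_or_eq with hlt | heq
      · exact h _ ha _ hb hab ⟨a, b, rfl, rfl, by rwa [map_mul]⟩
      · have h1 := norm_le_of_nu_le heq.le
        have h2 := norm_le_of_nu_le heq.ge
        have h3 : 2 * gp (g (ltr a))⁻¹ (g (ltr b)) = (g (ltr b)).norm := by omega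
        by_cases hle : (g (ltr b)).norm ≤ (g (ltr a)).norm
        · obtain ⟨K, hK, e⟩ := nu_mul h3 hle
          rw [heq, add_right_inj] at e
          exact code_half_ne h3 hy (Nat.eq_of_mul_eq_mul_right hK e)
        · refine h _ hb _ ha (Ne.symm hab) ⟨(b.1, !b.2), (a.1, !a.2), rfl, rfl, ?_⟩
          rw [← ltr_inv, ← ltr_inv, ← mul_inv_rev, map_inv, map_inv, nu_inv, nu_inv, map_mul, heq]
          exact nu_lt_of_norm_lt (by omega)

lemma TL_eq_of_smul_eq {I J : Finset (Fin n)} {g h : MulAut (FreeGroup (Fin n))}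
    (hg : ∀ i ∈ I, ∀ j ∈ I, i ≠ j → ¬ RedPair g i j)
    (hh : ∀ i ∈ J, ∀ j ∈ J, i ≠ j → ¬ RedPair h i j) (e : g • FA I = h • FA J) : TL I g = TL J h := by
  ext x
  rw [(nielsenReduced_TL hg).mem_iff TL_free, (nielsenReduced_TL hh).mem_iff TL_free,
    closure_TL, closure_TL, e]

/-- Words in the vertices attached to one basis. -/
def Inj (A : Finset (Fin n)) (g : MulAut (FreeGroup (Fin n))) : Set (List (Vt n)) :=
  {s | ∀ x ∈ s, ∃ a : Fin n × Bool, a.1 ∈ A ∧ x = g • std A a}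

lemma Inj_faceClosed (A : Finset (Fin n)) (g : MulAut (FreeGroup (Fin n))) : FaceClosed (Inj A g) :=
  fun _ _ h hs x hx => hs x (h.subset hx)

lemma XA_eq (A : Finset (Fin n)) : XA A = ⋃ g : GA A, Inj A g := by
  ext v
  rw [Set.mem_iUnion]
  constructor
  · rintro ⟨g, hg, σ, hσ, rfl⟩
    refine ⟨⟨g, hg⟩, fun x hx => ?_⟩
    rw [sm, List.map_map] at hx
    obtain ⟨a, ha, rfl⟩ := List.mem_map.1 hx
    exact ⟨a, hσ a ha, rfl⟩
  · rintro ⟨⟨g, hg⟩, hv⟩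
    refine ⟨g, hg, ?_⟩
    induction v with
    | nil => exact ⟨[], by simp, rfl⟩
    | cons x v ih =>
      obtain ⟨σ, h1, h2⟩ := ih fun y hy => hv y (by simp [hy])
      obtain ⟨a, ha, rfl⟩ := hv x (by simp)
      exact ⟨a :: σ, List.forall_mem_cons.2 ⟨ha, h1⟩, by rw [h2]; rfl⟩

lemma Inj_le_of_TL {A : Finset (Fin n)} {g h : MulAut (FreeGroup (Fin n))} (e : TL A g = TL A h) :
    Inj A g ⊆ Inj A h := by
  intro v hv x hx
  obtain ⟨a, ha, rfl⟩ := hv x hx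
  have : g (ltr a) ∈ TL A h := e ▸ ⟨a, ha, rfl⟩
  obtain ⟨b, hb, e'⟩ := this
  refine ⟨b, hb, Prod.ext e' ?_⟩
  change g • FA (A.erase a.1) = h • FA (A.erase b.1)
  rw [← closure_TL, ← closure_TL, ← TL_diff, ← TL_diff, e, e']

/-- The indices not used by a word. -/
def fr (A : Finset (Fin n)) (g : MulAut (FreeGroup (Fin n))) (v : List (Vt n)) : Finset (Fin n) :=
  open Classical in A.filter fun i => ∀ a : Fin n × Bool, a.1 = i → g • std A a ∉ v

lemma mem_fr {A : Finset (Fin n)} {g : MulAut (FreeGroup (Fin n))} {v : List (Vt n)} {i : Fin n} :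
    i ∈ fr A g v ↔ i ∈ A ∧ ∀ a : Fin n × Bool, a.1 = i → g • std A a ∉ v := by
  simp only [fr, Finset.mem_filter]

lemma mem_smul_fr {A : Finset (Fin n)} {g : MulAut (FreeGroup (Fin n))} (hg : g ∈ GA A)
    {v : List (Vt n)} (hv : v ∈ Inj A g) (x : FreeGroup (Fin n)) :
    x ∈ g • FA (fr A g v) ↔ x ∈ FA A ∧ ∀ y ∈ v, x ∈ y.2 := by
  have e : fr A g v = A \ (A \ fr A g v) := by
    rw [Finset.sdiff_sdiff_eq_self]
    exact fun i hi => (mem_fr.1 hi).1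
  obtain ⟨x, rfl⟩ := g.surjective x
  rw [smul_mem_iff, e, mem_FA_sdiff, hg.2]
  refine and_congr_right fun _ => ⟨fun h y hy => ?_, fun h i hi => ?_⟩
  · obtain ⟨a, ha, rfl⟩ := hv y hy
    refine smul_mem_iff.2 (h a.1 (Finset.mem_sdiff.2 ⟨ha, fun h' => ?_⟩))
    exact (mem_fr.1 h').2 a rfl hy
  · rw [Finset.mem_sdiff, mem_fr] at hi
    obtain ⟨hi, h'⟩ := hi
    push Not at h'
    obtain ⟨a, rfl, ha⟩ := h' hi
    exact smul_mem_iff.1 (h _ ha)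

lemma TL_eq_of_mem {A : Finset (Fin n)} {g h : MulAut (FreeGroup (Fin n))} (hg : g ∈ GA A)
    (hh : h ∈ GA A) {v : List (Vt n)} (hgv : v ∈ Inj A g) (hhv : v ∈ Inj A h)
    (rg : ∀ i ∈ fr A g v, ∀ j ∈ fr A g v, i ≠ j → ¬ RedPair g i j)
    (rh : ∀ i ∈ fr A h v, ∀ j ∈ fr A h v, i ≠ j → ¬ RedPair h i j) : TL A g = TL A h := by
  have key : TL (fr A g v) g = TL (fr A h v) h := TL_eq_of_smul_eq rg rh (by
    ext x
    rw [mem_smul_fr hg hgv, mem_smul_fr hh hhv])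
  have aux : ∀ g h : MulAut (FreeGroup (Fin n)), v ∈ Inj A h → TL (fr A g v) g = TL (fr A h v) h →
      TL A g ⊆ TL A h := by
    rintro g h hhv key _ ⟨a, ha, rfl⟩
    by_cases hf : a.1 ∈ fr A g v
    · have : g (ltr a) ∈ TL (fr A h v) h := key ▸ ⟨a, hf, rfl⟩
      obtain ⟨b, hb, e⟩ := this
      exact ⟨b, (mem_fr.1 hb).1, e⟩
    · rw [mem_fr] at hf
      push Not at hf
      obtain ⟨b, hb, hbv⟩ := hf ha
      obtain ⟨c, hc, e⟩ := hhv _ hbv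
      have e' : g (ltr b) = h (ltr c) := congrArg Prod.fst e
      by_cases hab : a = b
      · exact ⟨c, hc, hab ▸ e'⟩
      · have : a = (b.1, !b.2) := by
          obtain ⟨i, x⟩ := a
          obtain ⟨j, y⟩ := b
          simp only at hb
          subst hb
          cases x <;> cases y <;> simp_all
        refine ⟨(c.1, !c.2), hc, ?_⟩
        rw [this, ← ltr_inv, ← ltr_inv, map_inv, map_inv, e']
  exact (aux g h hhv key).antisymm (aux h g hgv key.symm)

lemma exists_tv (a b : Fin n × Bool) (hab : a.1 ≠ b.1) : ∃ t : MulAut (FreeGroup (Fin n)),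
    t (ltr a) = ltr a * ltr b ∧ ∀ B : Finset (Fin n), a.1 ∈ B → b.1 ∈ B → t ∈ GA B ∧ 
      ∀ c : Fin n × Bool, c.1 ≠ a.1 → t (ltr c) = ltr c := by
  obtain ⟨i, e⟩ := a
  have hb (b : Fin n × Bool) (h : i ≠ b.1) : ltr b ∈ FA ({i}ᶜ : Finset (Fin n)) :=
    ltr_mem.2 (by simpa using h.symm)
  have hB (B : Finset (Fin n)) (x : FreeGroup (Fin n)) (u w : FA ({i}ᶜ : Finset (Fin n)))
      (c : Fin n × Bool) (hc : c.1 ≠ i) : tv i u w (ltr c) = ltr c := by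
    rw [tv_apply, tvHom_eq (A := {i}ᶜ) (by simp)]
    exact ltr_mem.2 (by simpa using hc)
  cases e
  · refine ⟨tv i ⟨(ltr b)⁻¹, inv_mem (hb b hab)⟩ 1, ?_, fun B h1 h2 => ⟨tv_mem h1
      (inv_mem (ltr_mem.2 h2)) (one_mem _), hB B 1 _ _⟩⟩
    rw [ltr_false, map_inv, tv_apply, tvHom_of_self]
    simp
  · refine ⟨tv i 1 ⟨ltr b, hb b hab⟩, ?_, fun B h1 h2 => ⟨tv_mem h1 (one_mem _)
      (ltr_mem.2 h2), hB B 1 _ _⟩⟩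
    rw [ltr_true, tv_apply, tvHom_of_self]
    simp

lemma exists_mu_lt {A : Finset (Fin n)} {g : MulAut (FreeGroup (Fin n))} (hg : g ∈ GA A)
    {v : List (Vt n)} (hv : v ∈ Inj A g) {i j : Fin n} (hi : i ∈ fr A g v) (hj : j ∈ fr A g v)
    (hij : i ≠ j) (h : RedPair g i j) : ∃ h ∈ GA A, v ∈ Inj A h ∧ mu A h < mu A g := by
  obtain ⟨a, b, rfl, rfl, hlt⟩ := h
  obtain ⟨t, h1, h2⟩ := exists_tv a b hij
  rw [mem_fr] at hi hj
  refine ⟨g * t, mul_mem hg (h2 A hi.1 hj.1).1, fun x hx => ?_, ?_⟩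
  · obtain ⟨c, hc, rfl⟩ := hv x hx
    refine ⟨c, hc, ?_⟩
    have ha : c.1 ≠ a.1 := fun h => hi.2 c h hx
    have hb : c.1 ≠ b.1 := fun h => hj.2 c h hx
    have := h2 (A.erase c.1) (Finset.mem_erase.2 ⟨ha.symm, hi.1⟩) (Finset.mem_erase.2 ⟨hb.symm, hj.1⟩)
    rw [mul_smul, smul_std_eq.2 ⟨this.2 c ha, smul_FA subset_rfl this.1⟩]
  · have h3 : ∀ c : Fin n × Bool, c.1 = a.1 → nu ((g * t) (ltr c)) < nu (g (ltr c)) := by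
      intro c hc
      have : c = a ∨ c = (a.1, !a.2) := by
        obtain ⟨i, x⟩ := a
        obtain ⟨j, y⟩ := c
        simp only at hc
        subst hc
        cases x <;> cases y <;> simp
      rcases this with rfl | rfl
      · rwa [MulAut.mul_apply, h1]
      · rwa [← ltr_inv, map_inv, map_inv, nu_inv, nu_inv, MulAut.mul_apply, h1]
    refine Finset.sum_lt_sum (fun c _ => ?_) ⟨a, by simpa using hi.1, h3 a rfl⟩
    by_cases hc : c.1 = a.1
    · exact (h3 c hc).le
    · rw [MulAut.mul_apply, (h2 A hi.1 hj.1).2 c hc]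

lemma mu_min {A : Finset (Fin n)} {g : MulAut (FreeGroup (Fin n))} (hg : g ∈ GA A)
    {v : List (Vt n)} (hv : v ∈ Inj A g) (hr : ∀ i ∈ fr A g v, ∀ j ∈ fr A g v, i ≠ j → ¬ RedPair g i j)
    {h : MulAut (FreeGroup (Fin n))} (hh : h ∈ GA A) (hvh : v ∈ Inj A h) :
    mu A g ≤ mu A h ∧ (mu A h ≤ mu A g → Inj A h = Inj A g) := by
  let S : Set ℕ := {m | ∃ h ∈ GA A, v ∈ Inj A h ∧ mu A h = m}
  have hS : S.Nonempty := ⟨_, g, hg, hv, rfl⟩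
  have key : ∀ h ∈ GA A, v ∈ Inj A h → mu A h ≤ sInf S → TL A g = TL A h := by
    intro h hh hvh hle
    refine TL_eq_of_mem hg hh hv hvh hr fun i hi j hj hij hrp => ?_
    obtain ⟨k, hk, hvk, hlt⟩ := exists_mu_lt hh hvh hi hj hij hrp
    have := Nat.sInf_le (s := S) ⟨k, hk, hvk, rfl⟩
    omega
  obtain ⟨k, hk, hvk, hkm⟩ := Nat.sInf_mem hS
  have e := mu_eq_of_TL (key k hk hvk hkm.le)
  refine ⟨by rw [e, hkm]; exact Nat.sInf_le ⟨h, hh, hvh, rfl⟩, fun hle => ?_⟩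
  have := key h hh hvh (by omega)
  exact (Inj_le_of_TL this.symm).antisymm (Inj_le_of_TL this)

/-- The union of the `Inj A g` over all `g` of weight less than `m`. -/
def Ult (A : Finset (Fin n)) (m : ℕ) : Set (List (Vt n)) := {v | ∃ g ∈ GA A, mu A g < m ∧ v ∈ Inj A g}

lemma Ult_faceClosed (A : Finset (Fin n)) (m : ℕ) : FaceClosed (Ult A m) :=
  fun _ _ h ⟨g, hg, hm, hv⟩ => ⟨g, hg, hm, Inj_faceClosed A g h hv⟩

/-- The words of `Inj A g` avoiding a reducible pair. -/
def Red (A : Finset (Fin n)) (g : MulAut (FreeGroup (Fin n))) : Set (List (Vt n)) :=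
  {v | v ∈ Inj A g ∧ ∃ i ∈ fr A g v, ∃ j ∈ fr A g v, i ≠ j ∧ RedPair g i j}

lemma Red_Ex {A : Finset (Fin n)} {g : MulAut (FreeGroup (Fin n))} {p : ℕ}
    (hA : 2 * p + 3 ≤ A.card) : Ex (Red A g) p := by
  classical
  obtain ⟨i₀, -⟩ := Finset.card_pos.1 (show 0 < A.card by omega)
  let f : Fin n × Bool → Vt n := fun a => g • std A a
  have hf : f.Injective := fun a b h => std_injective A (MulAction.injective g h)
  let idx : Vt n → Fin n := Function.extend f Prod.fst fun _ => i₀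
  have hidx (a) : idx (g • std A a) = a.1 := hf.extend_apply _ _ a
  let E : Finset (Fin n × Fin n) := (A ×ˢ A).filter fun e => e.1 ≠ e.2 ∧ RedPair g e.1 e.2
  have e : Red A g = Avoiding (Set.range f) idx A (E.toList.map fun e => {e.1, e.2}) := by
    ext v
    simp only [Red, Avoiding, Set.mem_ofPred_eq, List.mem_map, Finset.mem_toList]
    constructor
    · rintro ⟨hv, i, hi, j, hj, hij, hr⟩
      refine ⟨_, ⟨(i, j), ?_, rfl⟩, fun x hx => ?_⟩
      · simp only [E, Finset.mem_filter, Finset.mem_product]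
        exact ⟨⟨(mem_fr.1 hi).1, (mem_fr.1 hj).1⟩, hij, hr⟩
      · obtain ⟨a, ha, rfl⟩ := hv x hx
        refine ⟨⟨a, rfl⟩, ?_⟩
        rw [hidx]
        simp only [Finset.mem_sdiff, Finset.mem_insert, Finset.mem_singleton, not_or]
        exact ⟨ha, fun h => (mem_fr.1 hi).2 a h hx, fun h => (mem_fr.1 hj).2 a h hx⟩
    · rintro ⟨_, ⟨⟨i, j⟩, hE, rfl⟩, hv⟩
      simp only [E, Finset.mem_filter, Finset.mem_product] at hE
      have hv' : ∀ a : Fin n × Bool, g • std A a ∈ v → a.1 ∈ A ∧ a.1 ≠ i ∧ a.1 ≠ j := by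
        intro a ha
        have := (hv _ ha).2
        rw [hidx] at this
        simpa only [Finset.mem_sdiff, Finset.mem_insert, Finset.mem_singleton, not_or] using this
      refine ⟨fun x hx => ?_, i, mem_fr.2 ⟨hE.1.1, fun a ha h => (hv' a h).2.1 ha⟩, j,
        mem_fr.2 ⟨hE.1.2, fun a ha h => (hv' a h).2.2 ha⟩, hE.2⟩
      obtain ⟨a, rfl⟩ := (hv x hx).1
      exact ⟨a, (hv' a hx).1, rfl⟩
  rw [e]
  have hL : ∀ i : Fin n, ∃ x ∈ Set.range f, idx x = i := fun i => ⟨_, ⟨(i, true), rfl⟩, hidx _⟩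
  refine Avoiding_Ex _ _ hL p _ A ?_ hA
  intro e he
  simp only [List.mem_map] at he
  obtain ⟨e, -, rfl⟩ := he
  exact ⟨by simp, Finset.card_le_two⟩

lemma Inj_Ex {A : Finset (Fin n)} {g : MulAut (FreeGroup (Fin n))} (hA : A.Nonempty) (p : ℕ) :
    Ex (Inj A g) p := by
  obtain ⟨i, hi⟩ := hA
  refine Ex_cone (g • std A (i, true)) (fun s hs => ?_) p
  rintro x hx
  rcases List.mem_cons.1 hx with rfl | hx
  · exact ⟨_, hi, rfl⟩
  · exact hs x hx

lemma Ult_Ex {A : Finset (Fin n)} {p : ℕ} (hA : 2 * p + 1 ≤ A.card) (m : ℕ) : Ex (Ult A m) p := by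
  classical
  induction m with
  | zero =>
    have : Ult A 0 = ∅ := by ext; simp [Ult]
    rw [this]
    exact Ex_empty p
  | succ m ih =>
    let S : Set (MulAut (FreeGroup (Fin n))) := {g | g ∈ GA A ∧ mu A g = m}
    let X : Finset S → Set (List (Vt n)) := fun F => Ult A m ∪ {v | ∃ g ∈ F, v ∈ Inj A g.1}
    have hX : Ult A (m + 1) = ⋃ F, X F := by
      ext v
      simp only [Set.mem_iUnion, X, Set.mem_union, Ult, Set.mem_ofPred_eq]
      constructor
      · rintro ⟨g, hg, hm, hv⟩
        rcases (Nat.lt_succ_iff.1 hm).lt_or_eq with h | h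
        · exact ⟨∅, Or.inl ⟨g, hg, h, hv⟩⟩
        · exact ⟨{⟨g, hg, h⟩}, Or.inr ⟨⟨g, hg, h⟩, by simp, hv⟩⟩
      · rintro ⟨F, ⟨g, hg, hm, hv⟩ | ⟨⟨g, hg, hm⟩, _, hv⟩⟩
        · exact ⟨g, hg, by omega, hv⟩
        · exact ⟨g, hg, by omega, hv⟩
    have hfc (F) : FaceClosed (X F) := by
      rintro s t hst (h | ⟨g, hg, h⟩)
      · exact Or.inl (Ult_faceClosed A m hst h)
      · exact Or.inr ⟨g, hg, Inj_faceClosed A _ hst h⟩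
    rw [hX]
    refine Ex_directed (fun F F' => ⟨F ∪ F', ?_, ?_⟩) fun F => ?_
    · rintro v (h | ⟨g, hg, h⟩)
      exacts [Or.inl h, Or.inr ⟨g, Finset.mem_union_left _ hg, h⟩]
    · rintro v (h | ⟨g, hg, h⟩)
      exacts [Or.inl h, Or.inr ⟨g, Finset.mem_union_right _ hg, h⟩]
    induction F using Finset.induction_on with
    | empty =>
      have : X ∅ = Ult A m := by ext; simp [X]
      rw [this]
      exact ih
    | insert g F hgF ihF =>
      by_cases hdup : ∃ k ∈ F, Inj A k.1 = Inj A g.1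
      · have : X (insert g F) = X F := by
          obtain ⟨k, hk, e⟩ := hdup
          ext v
          simp only [X, Set.mem_union, Set.mem_ofPred_eq, Finset.mem_insert]
          refine or_congr_right ⟨?_, fun ⟨x, hx, h⟩ => ⟨x, Or.inr hx, h⟩⟩
          rintro ⟨x, rfl | hx, h⟩
          exacts [⟨k, hk, e ▸ h⟩, ⟨x, hx, h⟩]
        rw [this]
        exact ihF
      · push Not at hdup
        have e : X (insert g F) = X F ∪ Inj A g.1 := by
          ext v
          simp only [X, Set.mem_union, Set.mem_ofPred_eq, Finset.mem_insert]
          constructor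
          · rintro (h | ⟨x, rfl | hx, h⟩)
            exacts [Or.inl (Or.inl h), Or.inr h, Or.inl (Or.inr ⟨x, hx, h⟩)]
          · rintro ((h | ⟨x, hx, h⟩) | h)
            exacts [Or.inl h, Or.inr ⟨x, Or.inr hx, h⟩, Or.inr ⟨g, Or.inl rfl, h⟩]
        have eI : X F ∩ Inj A g.1 = Red A g.1 := by
          ext v
          constructor
          · rintro ⟨h, hv⟩
            refine ⟨hv, ?_⟩
            by_contra! hr
            rcases h with ⟨k, hk, hkm, hvk⟩ | ⟨k, hk, hvk⟩
            · have := (mu_min g.2.1 hv hr hk hvk).1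
              have := g.2.2
              omega
            · refine hdup k hk ((mu_min g.2.1 hv hr k.2.1 hvk).2 ?_)
              rw [k.2.2, g.2.2]
          · rintro ⟨hv, i, hi, j, hj, hij, hr⟩
            obtain ⟨k, hk, hvk, hlt⟩ := exists_mu_lt g.2.1 hv hi hj hij hr
            exact ⟨Or.inl ⟨k, hk, by rw [← g.2.2]; exact hlt, hvk⟩, hv⟩
        rw [e]
        refine Ex_union (hfc F) (Inj_faceClosed A _) ihF
          (Inj_Ex (Finset.card_pos.1 (by omega)) p) fun q hq => ?_
        rw [eI]
        exact Red_Ex (by omega)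

/-- The complex of words in translates of standard vertices is highly acyclic. -/
theorem XA_Ex {A : Finset (Fin n)} {p : ℕ} (hA : 2 * p + 1 ≤ A.card) : Ex (XA A) p := by
  have : XA A = ⋃ m, Ult A m := by
    rw [XA_eq]
    ext v
    simp only [Set.mem_iUnion, Ult, Set.mem_ofPred_eq, Subtype.exists]
    constructor
    · rintro ⟨g, hg, hv⟩
      exact ⟨mu A g + 1, g, hg, by omega, hv⟩
    · rintro ⟨m, g, hg, -, hv⟩
      exact ⟨g, hg, hv⟩
  rw [this]
  refine Ex_directed (fun a b => ⟨max a b, ?_, ?_⟩) fun m => Ult_Ex hA m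
  · rintro v ⟨g, hg, hm, hv⟩
    exact ⟨g, hg, lt_of_lt_of_le hm (le_max_left _ _), hv⟩
  · rintro v ⟨g, hg, hm, hv⟩
    exact ⟨g, hg, lt_of_lt_of_le hm (le_max_right _ _), hv⟩

end Acyclic

end WordCx

namespace WordCx

open Finsupp

open scoped Pointwise

section

variable {G S V Z : Type*} [Group G] [MulAction G S] [MulAction G V] [MulAction G Z]
  {K : Subgroup G} {X : Set (List V)} {N : AddSubgroup (Z → ℤ)}

/-- Surjectivity criterion: a compatible family of cocycles on stabilizers of letters extends. -/
lemma extend_of_vertices {hX : FaceClosed X} {hK : ∀ g ∈ K, ∀ v ∈ X, sm g v ∈ X}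
    (hN : Stable G N) {x₀ : V} (hx₀ : [x₀] ∈ X)
    (hfree : ∀ g ∈ K, ∀ s : S, g • s = s → g = 1) {i : ℕ}
    (hEx : ∀ q, q ≤ i + 1 → Ex X q)
    (hE2 : ∀ a b, a + b = i + 1 → 2 ≤ b → (dbl S K X hX hK N).trunc.E2 a b)
    {y : List S → List V → Z → ℤ} (hy : y ∈ Cc K X N (i + 1) 1) (hy0 : del y = 0)
    (hv : ∀ v ∈ X, v.length = 2 → ∃ g ∈ K, ∃ v₀, v = sm g v₀ ∧
      Null (Stab K v₀) N i (fun s => del (y s) v₀)) :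
    ∃ c : List S → Z → ℤ, c ∈ Co K N (i + 1) ∧ del c = 0 ∧
      ∀ x, [x] ∈ X → Null (Stab K [x]) N i ((fun s => y s [x]) - c) := by
  obtain ⟨κ, hκ, hκK⟩ := exists_kappa K hfree
  set C := dbl S K X hX hK N
  obtain ⟨v, hv, hvi, hdv⟩ := exists_dS_lift (K := K) hX hN hK (C.dX_mem hy) (fun v hvX hvp => by
    obtain ⟨g, hg, v₀, rfl, hn⟩ := hv v hvX hvp
    refine ⟨g, hg, v₀, rfl, ?_⟩
    have hv₀ : v₀ ∈ X := by simpa using hK _ (inv_mem hg) _ hvX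
    convert hn using 1
    funext s
    exact dbl_dX hv₀ s)
  have hExX : ∀ a b, a + b ≤ i + 1 → C.trunc.ExX a b := fun a b hb => by
    cases a with
    | zero => exact C.trunc_ExX_zero b
    | succ a => exact C.trunc_ExX_succ (exX_dbl hκ hκK (fun q hq => hEx q (by omega)) a)
  obtain ⟨c, hc, hc0, b, hb, hyb⟩ := C.trunc.surj_of C.trunc_zero (i := i) (y := y)
    (fun a b hab hb => ⟨hE2 a b hab hb, hExX a b (by omega)⟩)
    (hExX _ _ (by omega)) (hExX _ _ (by omega))
    (C.trunc_InjX_succ (injX_dbl x₀ hx₀ _)) (by rwa [C.trunc_succ]) hy0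
    ⟨v, C.mem_trunc hv hvi, hdv.symm⟩
  obtain ⟨hb1, hb2⟩ := C.of_mem_trunc hb
  obtain ⟨hc1, -⟩ := C.of_mem_trunc hc
  refine ⟨fun s => c s [], at_nil_mem hc1, ?_, fun x hx => ⟨fun s => b s [x], Cc_at hb1 [x],
    fun hi => by rw [hb2 hi]; rfl, ?_⟩⟩
  · rw [del_at]
    funext s
    exact congrFun (congrFun hc0 s) []
  · rw [del_at]
    funext s
    have h1 := congrFun (congrFun hyb s) [x]
    have h2 : C.dX c s [x] = c s [] := by
      rw [dbl_dX hx, del_cons, del_nil, sub_zero]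
    have h3 : y s [x] = C.dX c s [x] + del b s [x] := h1
    rw [Pi.sub_apply, h3, h2, add_sub_cancel_left]

end

section Coef

variable {n : ℕ} {R : Type} [DecidableEq R]

variable (n R) in
/-- Functions of tuples in the free group which are additive in each slot. -/
def T : AddSubgroup ((R → FreeGroup (Fin n)) → ℤ) where
  carrier := {f | ∀ h r x y, f (Function.update h r (x * y)) =
    f (Function.update h r x) + f (Function.update h r y)}
  zero_mem' := fun _ _ _ _ => rfl
  add_mem' {f g} hf hg := fun h r x y => by
    have h1 := hf h r x y
    have h2 := hg h r x y
    simp only [Pi.add_apply]; linarith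
  neg_mem' {f} hf := fun h r x y => by
    have h1 := hf h r x y
    simp only [Pi.neg_apply]; linarith

lemma T_comp {f : (R → FreeGroup (Fin n)) → ℤ} (hf : f ∈ T n R)
    (φ : R → FreeGroup (Fin n) →* FreeGroup (Fin n)) : (fun h => f fun r => φ r (h r)) ∈ T n R := by
  intro h r x y
  have key : ∀ w, (fun r' => φ r' (Function.update h r w r')) =
      Function.update (fun r' => φ r' (h r')) r (φ r w) := fun w => by
    ext r'
    by_cases e : r' = r
    · subst e; simp
    · simp [e]
  simp only [key, map_mul]
  exact hf _ _ _ _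

lemma T_stable : Stable (MulAut (FreeGroup (Fin n))) (T n R) := fun g _ hf =>
  T_comp hf fun _ => g.toMonoidHom

/-- Kill the generators in `A` in every slot. -/
def pr (A : Finset (Fin n)) (h : R → FreeGroup (Fin n)) : R → FreeGroup (Fin n) :=
  fun r => pj Aᶜ (h r)

omit [DecidableEq R] in
lemma pr_pr (A B : Finset (Fin n)) (h : R → FreeGroup (Fin n)) :
    pr A (pr B h) = pr (A ∪ B) h := by
  funext r
  simp only [pr]
  rw [pj_pj, Finset.compl_union]

lemma T_pr (A : Finset (Fin n)) {f : (R → FreeGroup (Fin n)) → ℤ} (hf : f ∈ T n R) :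
    f ∘ pr A ∈ T n R := T_comp hf fun _ => pj Aᶜ

omit [DecidableEq R] in
lemma smul_pr {A B : Finset (Fin n)} (hAB : A ⊆ B) {g : MulAut (FreeGroup (Fin n))} (hg : g ∈ GA A)
    (h : R → FreeGroup (Fin n)) : g • pr B h = pr B h := by
  funext r
  exact GA_fix' hg (Finset.disjoint_left.2 fun i hi hi' => Finset.mem_compl.1 hi' (hAB hi))
    (pj_mem _ _)

lemma pj_conj {B C : Finset (Fin n)} {g : MulAut (FreeGroup (Fin n))}
    (h1 : ∀ i ∈ B, g (FreeGroup.of i) ∈ FA C) (h2 : ∀ i ∉ B, g (FreeGroup.of i) ∈ FA Cᶜ)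
    (x : FreeGroup (Fin n)) : pj Cᶜ (g x) = g (pj Bᶜ x) := by
  have : (pj Cᶜ).comp g.toMonoidHom = g.toMonoidHom.comp (pj Bᶜ) := by
    ext i
    change pj Cᶜ (g (FreeGroup.of i)) = g (pj Bᶜ (FreeGroup.of i))
    by_cases hi : i ∈ B
    · rw [pj_eq_one disjoint_compl_left (h1 i hi), pj_of, if_neg (by simpa using hi), map_one]
    · rw [pj_eq_of_mem subset_rfl (h2 i hi), pj_of, if_pos (by simpa using hi)]
  exact DFunLike.congr_fun this x

lemma pj_smul {A B : Finset (Fin n)} (hAB : A ⊆ B) {g : MulAut (FreeGroup (Fin n))} (hg : g ∈ GA A)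
    (x : FreeGroup (Fin n)) : pj Bᶜ (g x) = g (pj Bᶜ x) :=
  pj_conj (fun i hi => (GA_mem hAB hg).2 (of_mem_FA hi)) (fun i hi => by
    rw [GA_fix hg fun h => hi (hAB h)]; exact of_mem_FA (by simpa using hi)) x

omit [DecidableEq R] in
lemma pr_smul {A B : Finset (Fin n)} (hAB : A ⊆ B) {g : MulAut (FreeGroup (Fin n))} (hg : g ∈ GA A)
    (h : R → FreeGroup (Fin n)) : pr B (g • h) = pr B h := by
  rw [← smul_pr hAB hg h]
  funext r
  exact pj_smul hAB hg _

omit [DecidableEq R] in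
lemma pr_conj {A : Finset (Fin n)} {u : MulAut (FreeGroup (Fin n))} (hu : u ∈ GA A)
    {τ σ : List (Fin n × Bool)} (h : sm u (τ.map (std A)) = σ.map (std A)) (x : R → FreeGroup (Fin n)) :
    pr (A \ idxs σ) (u • x) = u • pr (A \ idxs τ) x := by
  have hmap : ∀ τ σ : List (Fin n × Bool), sm u (τ.map (std A)) = σ.map (std A) →
      (∀ a ∈ τ, ∃ b ∈ σ, u • std A a = std A b) ∧ ∀ b ∈ σ, ∃ a ∈ τ, u • std A a = std A b := by
    intro τ
    induction τ with
    | nil =>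
      intro σ h
      cases σ with
      | nil => simp
      | cons b σ => simp at h
    | cons a τ ih =>
      intro σ h
      cases σ with
      | nil => simp at h
      | cons b σ =>
        simp only [List.map_cons, sm_cons, List.cons.injEq] at h
        obtain ⟨i1, i2⟩ := ih σ h.2
        constructor
        · intro x hx
          rcases List.mem_cons.1 hx with rfl | hx
          · exact ⟨b, by simp, h.1⟩
          · obtain ⟨b, hb, e⟩ := i1 x hx
            exact ⟨b, by simp [hb], e⟩
        · intro x hx
          rcases List.mem_cons.1 hx with rfl | hx
          · exact ⟨a, by simp, h.1⟩
          · obtain ⟨b, hb, e⟩ := i2 x hx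
            exact ⟨b, by simp [hb], e⟩
  obtain ⟨h1, h2⟩ := hmap τ σ h
  funext r
  refine pj_conj (fun i hi => ?_) (fun i hi => ?_) _
  · rw [Finset.mem_sdiff] at hi
    refine mem_FA_sdiff.2 ⟨(GA_mem subset_rfl hu).2 (of_mem_FA hi.1), fun j hj => ?_⟩
    obtain ⟨b, hb, rfl⟩ := mem_idxs.1 hj
    obtain ⟨a, ha, e⟩ := h2 b hb
    rw [← (smul_std_eq.1 e).2, smul_mem_iff]
    refine of_mem_FA (Finset.mem_erase.2 ⟨?_, hi.1⟩)
    rintro rfl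
    exact hi.2 (mem_idxs.2 ⟨a, ha, rfl⟩)
  · by_cases hiA : i ∈ A
    · have : i ∈ idxs τ := by
        by_contra hn
        exact hi (Finset.mem_sdiff.2 ⟨hiA, hn⟩)
      obtain ⟨a, ha, rfl⟩ := mem_idxs.1 this
      obtain ⟨b, hb, e⟩ := h1 a ha
      have hb' : ltr b ∈ FA (A \ idxs σ)ᶜ := ltr_mem.2 (by
        have : b.1 ∈ idxs σ := mem_idxs.2 ⟨b, hb, rfl⟩
        simp [this])
      rw [← (smul_std_eq.1 e).1] at hb'
      obtain ⟨i, s⟩ := a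
      cases s
      · rw [ltr_false, map_inv] at hb'
        exact (inv_mem_iff (H := FA (A \ idxs σ)ᶜ)).1 hb'
      · exact hb'
    · rw [GA_fix hu hiA]
      exact of_mem_FA (by simp [hiA])

/-- Comparison with the part killing `A`, for the group of automorphisms of the factor `A`. -/
def Van (n : ℕ) (R : Type) [Fintype R] [DecidableEq R] (i : ℕ) : Prop :=
  ∀ A : Finset (Fin n), 2 * i + Fintype.card R + 2 ≤ A.card →
    ∀ c : List (MulAut (FreeGroup (Fin n))) → (R → FreeGroup (Fin n)) → ℤ,
    c ∈ Co (GA A) (T n R) (i + 1) → del c = 0 → Null (GA A) (T n R) i (c - fun s => c s ∘ pr A)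

/-- Injectivity of stabilization. -/
def StInj (n : ℕ) (R : Type) [Fintype R] [DecidableEq R] (i : ℕ) : Prop :=
  ∀ A : Finset (Fin n), 2 * i + Fintype.card R + 2 ≤ A.card → ∀ a ∈ A,
    ∀ c : List (MulAut (FreeGroup (Fin n))) → (R → FreeGroup (Fin n)) → ℤ,
    c ∈ Co (GA A) (T n R) (i + 1) → del c = 0 → Null (GA (A.erase a)) (T n R) i c →
    Null (GA A) (T n R) i c

/-- Surjectivity of stabilization. -/
def StSurj (n : ℕ) (R : Type) [Fintype R] [DecidableEq R] (i : ℕ) : Prop :=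
  ∀ A : Finset (Fin n), 2 * i + Fintype.card R + 3 ≤ A.card → ∀ a ∈ A,
    ∀ y : List (MulAut (FreeGroup (Fin n))) → (R → FreeGroup (Fin n)) → ℤ,
    y ∈ Co (GA (A.erase a)) (T n R) (i + 1) → del y = 0 → (∀ s, y s ∘ pr A = y s) →
    ∃ z ∈ Co (GA A) (T n R) (i + 1), del z = 0 ∧
      Null (GA (A.erase a)) (T n R) i (y - z)

end Coef

end WordCx

namespace WordCx

open Finsupp

open scoped Pointwise

section Coef

variable {n : ℕ} {R : Type} [DecidableEq R]

/-- Cochains on automorphisms with values in functions of tuples. -/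
abbrev Cn (n : ℕ) (R : Type) : Type :=
  List (MulAut (FreeGroup (Fin n))) → (R → FreeGroup (Fin n)) → ℤ

lemma Co_pr {A B : Finset (Fin n)} (hAB : A ⊆ B) {j : ℕ} {c : Cn n R}
    (hc : c ∈ Co (GA A) (T n R) j) : (fun s => c s ∘ pr B) ∈ Co (GA A) (T n R) j :=
  Co_comp id (fun _ h => h) (fun _ _ _ => rfl) (pr B)
    (fun g hg z => by rw [pr_smul hAB hg]; exact (smul_pr hAB hg z).symm)
    (fun f hf => T_pr B hf) hc

lemma Null.pr {A B : Finset (Fin n)} (hAB : A ⊆ B) {j : ℕ} {c : Cn n R}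
    (hc : Null (GA A) (T n R) j c) : Null (GA A) (T n R) j (fun s => c s ∘ WordCx.pr B) :=
  Null.comp id (fun _ h => h) (fun _ _ _ => rfl) (WordCx.pr B)
    (fun g hg z => by rw [pr_smul hAB hg]; exact (smul_pr hAB hg z).symm)
    (fun f hf => T_pr B hf) hc

lemma sdiff_idxs_cons (A : Finset (Fin n)) (a : Fin n × Bool) (τ : List (Fin n × Bool)) :
    A \ idxs (a :: τ) = (A \ idxs τ).erase a.1 := by
  rw [idxs_cons, Finset.sdiff_insert]

variable (n R) in
/-- The double complex for the factor `A`. -/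
abbrev dA (A : Finset (Fin n)) :
    DoubleCx (List (MulAut (FreeGroup (Fin n))) → List (Vt n) → (R → FreeGroup (Fin n)) → ℤ) :=
  dbl (MulAut (FreeGroup (Fin n))) (GA A) (XA A) (XA_faceClosed A) (XA_stable A) (T n R)

lemma Null.del_faces {G S Z W : Type*} [Group G] [MulAction G S] [MulAction G Z] {K : Subgroup G}
    {N : AddSubgroup (Z → ℤ)} {j : ℕ} {f : List W → List S → Z → ℤ} {v : List W}
    (h : ∀ t : List W, t.Sublist v → t.length + 1 = v.length → Null K N j (f t)) :
    Null K N j (WordCx.del f v) := by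
  classical
  let P : AddSubgroup (List S → Z → ℤ) :=
    { carrier := {c | Null K N j c}
      zero_mem' := Null.zero
      add_mem' := fun h h' => Null.add h h'
      neg_mem' := fun h => Null.neg h }
  rw [del_congr (d := fun t => if t.Sublist v ∧ t.length + 1 = v.length then f t else 0)
    fun t h1 h2 => (if_pos ⟨h1, h2⟩).symm]
  refine del_mem P (fun t => ?_) v
  split_ifs with ht
  exacts [h t ht.1 ht.2, zero_mem P]

variable [Fintype R]

lemma E2_dA {A : Finset (Fin n)} {j p : ℕ} (hA : 2 * j + p + Fintype.card R + 3 ≤ A.card)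
    (hI : StInj n R j) (hS : StSurj n R j) (hV : Van n R j) : (dA n R A).trunc.E2 j p := by
  intro y hy hy0 ⟨b, hb, hyb⟩
  rw [DoubleCx.trunc_succ] at hy
  change del y = 0 at hy0
  change (dA n R A).dX y = del b at hyb
  obtain ⟨hb, hb0⟩ := (dA n R A).of_mem_trunc hb
  have hcard : ∀ τ : List (Fin n × Bool), τ.length ≤ p + 1 →
      2 * j + Fintype.card R + 2 ≤ (A \ idxs τ).card := fun τ hτ => by
    have h1 := card_idxs_le τ
    have h2 := Finset.le_card_sdiff (idxs τ) A
    omega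
  obtain ⟨z, hz, hQ⟩ := exists_Cc (S := MulAut (FreeGroup (Fin n))) (K := GA A) (XA_stable A)
    (T_stable (n := n) (R := R)) (j + 1) p
    (fun v z => del z = 0 ∧ ∀ g ∈ GA A, ∀ (τ : List (Fin n × Bool)) (a : Fin n × Bool),
      v = sm g (τ.map (std A)) → (∀ b ∈ τ, b.1 ∈ A) → a.1 ∈ A → a.1 ∉ idxs τ →
      Null (GA (A \ idxs (a :: τ))) (T n R) j
        ((fun s => y s ((a :: τ).map (std A)) ∘ pr (A \ idxs τ)) - tr g⁻¹ z))
    (fun g hg v z h => ⟨by rw [del_tr, h.1]; rfl, fun g' hg' τ a hv hτ ha ha' => by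
      have := h.2 (g⁻¹ * g') (mul_mem (inv_mem hg) hg') τ a (by rw [mul_sm, ← hv, inv_sm_sm])
        hτ ha ha'
      rwa [mul_inv_rev, inv_inv, tr_mul] at this⟩)
    (fun v hv hp => by
      obtain ⟨g, hg, τ, hτ, rfl⟩ := hv
      rw [length_sm, List.length_map] at hp
      have hB : 2 * j + Fintype.card R + 3 ≤ (A \ idxs τ).card := by
        have h1 := card_idxs_le τ
        have h2 := Finset.le_card_sdiff (idxs τ) A
        omega
      obtain ⟨i₀, hi₀⟩ := Finset.card_pos.1 (show 0 < (A \ idxs τ).card by omega)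
      have hi₀' := Finset.mem_sdiff.1 hi₀
      set a₀ : Fin n × Bool := (i₀, true)
      have hy1 : (fun s => y s ((a₀ :: τ).map (std A))) ∈ Co (GA ((A \ idxs τ).erase i₀)) (T n R) (j + 1) := by
        have := Cc_at hy ((a₀ :: τ).map (std A))
        rwa [Stab_std, sdiff_idxs_cons] at this
      obtain ⟨z, hz, hz0, hyz⟩ := hS (A \ idxs τ) hB i₀ hi₀ _
        (Co_pr (Finset.erase_subset _ _) hy1) (by
          rw [del_precomp, del_at, hy0]; rfl) (fun s => by
          funext h
          simp only [Function.comp]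
          rw [pr_pr, Finset.union_self])
      refine ⟨g, hg, τ.map (std A), rfl, z, by rwa [Stab_std], hz0, ?_⟩
      intro g' hg' τ' a hv hτ' ha ha'
      obtain ⟨k, hk, hk1, hk2⟩ := exists_stab_smul hg' hτ' hτ hv.symm ha hi₀'.1 ha' (b := a₀) hi₀'.2
      set u := k⁻¹ * g' with hu
      have huA : u ∈ GA A := mul_mem (inv_mem hk) hg'
      have hu1 : sm u (τ'.map (std A)) = τ.map (std A) := by
        rw [hu, mul_sm, ← hv]
        conv_lhs => rw [← hk1]
        rw [inv_sm_sm]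
      have hu2 : sm u ((a :: τ').map (std A)) = (a₀ :: τ).map (std A) := by
        rw [List.map_cons, sm_cons, hu1, List.map_cons, hu, mul_smul, ← hk2, inv_smul_smul]
      have h1 := Null.tr (K' := GA (A \ idxs (a :: τ'))) T_stable u⁻¹ (fun k hk => by
        rw [← Stab_std] at hk
        have : u⁻¹⁻¹ * k * u⁻¹ ∈ Stab (GA A) ((a₀ :: τ).map (std A)) := by
          refine ⟨mul_mem (mul_mem (inv_mem (inv_mem huA)) hk.1) (inv_mem huA), ?_⟩
          rw [← hu2, mul_sm, inv_sm_sm, mul_sm, hk.2, inv_inv]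
        rwa [Stab_std, sdiff_idxs_cons] at this) hyz
      convert h1 using 1
      rw [tr_sub]
      congr 1
      · funext s h
        simp only [tr, Function.comp, inv_inv]
        rw [pr_conj huA hu1, ← hu2]
        exact (hy.1 u huA _ _ _).symm
      · have : g' = k * u := by rw [hu]; group
        rw [this, mul_inv_rev, tr_mul, tr_eq hz]
        have : k⁻¹ ∈ Stab (GA A) (τ.map (std A)) := inv_mem ⟨hk, hk1⟩
        rwa [Stab_std] at this)
  have hz0 : del z = 0 := Cc_ext ((dA n R A).dS_mem hz) (zero_mem _) fun v hv hp s => by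
    have := congrFun (hQ v hv hp).1 s
    rwa [del_at] at this
  refine ⟨z, by rwa [DoubleCx.trunc_succ], hz0, ?_⟩
  have hdz := (dA n R A).dX_mem hz
  obtain ⟨b', hb', hb'0, hbb⟩ := exists_dS_lift (K := GA A) (XA_faceClosed A) (T_stable (n := n) (R := R))
    (XA_stable A) (sub_mem hy hdz) (fun v hv hp => by
      obtain ⟨g, hg, τ, hτ, rfl⟩ := hv
      rw [length_sm, List.length_map] at hp
      refine ⟨g, hg, τ.map (std A), rfl, ?_⟩
      rw [Stab_std]
      have hcτ := hcard τ hp.le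
      obtain ⟨i₁, hi₁⟩ := Finset.card_pos.1 (show 0 < (A \ idxs τ).card by omega)
      have hi₁' := Finset.mem_sdiff.1 hi₁
      set a : Fin n × Bool := (i₁, true)
      have hyτ := Cc_at hy (τ.map (std A))
      have hzτ := Cc_at hdz (τ.map (std A))
      rw [Stab_std] at hyτ hzτ
      have h1 := hV _ hcτ _ hyτ (by rw [del_at, hy0]; rfl)
      have hw := std_mem_XA hτ
      refine (h1.trans (d := fun s => y s (τ.map (std A)) ∘ pr (A \ idxs τ))
        (e := fun s => (dA n R A).dX z s (τ.map (std A))) ?_ :)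
      refine hI _ hcτ i₁ hi₁ _ (sub_mem (Co_pr subset_rfl hyτ) hzτ) ?_ ?_
      · rw [map_sub, del_precomp, del_at, hy0, del_at]
        have : del ((dA n R A).dX z) = 0 := by
          have := (dA n R A).comm z
          rw [show (dA n R A).dS z = 0 from hz0, map_zero] at this
          exact this
        rw [this]
        ext; simp
      · have haτ : ∀ b ∈ a :: τ, b.1 ∈ A := by
          intro b hb
          rcases List.mem_cons.1 hb with rfl | hb
          exacts [hi₁'.1, hτ b hb]
        have hwa := std_mem_XA haτ
        rw [show (A \ idxs τ).erase i₁ = A \ idxs (a :: τ) from (sdiff_idxs_cons A a τ).symm]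
        set L := GA (A \ idxs (a :: τ))
        -- the relation coming from the coboundary of `y`
        have e1 : Null L (T n R) j (fun s => del (y s) ((a :: τ).map (std A)) ∘ pr (A \ idxs τ)) := by
          refine Null.pr (B := A \ idxs τ) (c := fun s => del (y s) ((a :: τ).map (std A)))
            (Finset.sdiff_subset_sdiff subset_rfl (idxs_subset (List.sublist_cons_self a τ))) ?_
          refine ⟨fun s => b s ((a :: τ).map (std A)), ?_, fun hj => by rw [hb0 hj]; rfl, ?_⟩
          · have := Cc_at hb ((a :: τ).map (std A))
            rwa [Stab_std] at this
          · rw [del_at]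
            funext s
            rw [← dbl_dX (hX := XA_faceClosed A) (hK := XA_stable A) (K := GA A) (N := T n R) hwa s]
            exact (congrFun (congrFun hyb s) _).symm
        -- each face
        have e2 : ∀ t : List (Fin n × Bool), t.Sublist τ → t.length = p →
            Null L (T n R) j ((fun s => y s ((a :: t).map (std A)) ∘ pr (A \ idxs τ)) -
              fun s => z s (t.map (std A))) := by
          intro t ht htp
          have hta : (a :: t).Sublist (a :: τ) := ht.cons_cons a
          have hLt : L ≤ GA (A \ idxs (a :: t)) :=
            GA_mono (Finset.sdiff_subset_sdiff subset_rfl (idxs_subset hta))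
          have htA : ∀ b ∈ t, b.1 ∈ A := fun b hb => hτ b (ht.subset hb)
          have hyt := Cc_at hy ((a :: t).map (std A))
          rw [Stab_std] at hyt
          have f1 := (hV _ (hcard (a :: t) (by simp [htp])) _ hyt (by rw [del_at, hy0]; rfl)).mono hLt
          have f2 := Null.pr (B := A \ idxs τ)
            (Finset.sdiff_subset_sdiff subset_rfl (idxs_subset (List.sublist_cons_self a τ))) f1
          have f3 := ((hQ _ (std_mem_XA htA) (by simp [htp])).2 1 (one_mem _) t a (by simp) htA hi₁'.1
            (fun h => hi₁'.2 (idxs_subset ht h))).mono hLt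
          refine f2.add f3 |> fun h => ?_
          convert h using 1
          funext s h
          simp only [Pi.add_apply, Pi.sub_apply, Function.comp, tr, inv_one, one_smul, one_sm]
          rw [pr_pr]
          have : A \ idxs (a :: t) ∪ A \ idxs τ = A \ idxs t := by
            rw [← Finset.sdiff_inter_distrib_right, idxs_cons, Finset.insert_inter_of_notMem hi₁'.2,
              Finset.inter_eq_left.2 (idxs_subset ht)]
          rw [this]
          ring
        have e3 : Null L (T n R) j (del (fun t s => y s ((a :: t).map (std A)) ∘ pr (A \ idxs τ) -
            z s (t.map (std A))) τ) :=
          Null.del_faces fun t ht htp => e2 t ht (by omega)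
        have := e1.add e3
        convert this using 1
        funext s h
        simp only [Pi.add_apply, Pi.sub_apply, Function.comp]
        rw [dbl_dX hw s, List.map_cons, del_cons, del_pi, del_pi]
        simp only [Pi.sub_apply, Function.comp, del_pi, ← del_map]
        have := congrFun (map_sub (del (M := ℤ)) (fun t => y s (std A a :: t.map (std A)) (pr (A \ idxs τ) h))
          (fun t => z s (t.map (std A)) h)) τ
        have h2 : del (fun t => y s (std A a :: t.map (std A)) (pr (A \ idxs τ) h) -
          z s (t.map (std A)) h) τ = _ := this
        simp only [List.map_cons]
        rw [h2, Pi.sub_apply]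
        abel)
  exact ⟨b', (dA n R A).mem_trunc hb' hb'0, by
    rw [show (dA n R A).trunc.dS b' = del b' from rfl, hbb]; simp⟩

lemma free_mul {G : Type*} [Group G] (K : Subgroup G) : ∀ g ∈ K, ∀ s : G, g • s = s → g = 1 :=
  fun _ _ _ h => mul_eq_right.1 h

lemma stInj_of {i : ℕ} (hI : ∀ j < i, StInj n R j) (hS : ∀ j < i, StSurj n R j)
    (hV : ∀ j < i, Van n R j) : StInj n R i := by
  intro A hA a ha c hc hc0 hca
  have hx : [std A (a, true)] ∈ XA A := std_mem_XA (σ := [(a, true)]) (by simpa using ha)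
  refine null_of_vertices (X := XA A) (hX := XA_faceClosed A) (hK := XA_stable A) T_stable
    (nil_mem_XA A) hx (free_mul _) (fun q hq => XA_Ex (by omega))
    (fun j p hjp hp => E2_dA (by omega) (hI j (by omega)) (hS j (by omega)) (hV j (by omega))) hc ?_
  intro x hxX
  obtain ⟨g, hg, τ, hτ, e⟩ := hxX
  obtain ⟨b, rfl⟩ : ∃ b, τ = [b] := by
    have := congrArg List.length e
    rw [length_sm, List.length_map] at this
    exact List.length_eq_one_iff.1 this.symm
  have hb : b.1 ∈ A := hτ b (by simp)
  obtain ⟨k, hk, -, hk2⟩ := exists_stab_smul (one_mem (GA A)) (τ := []) (σ := []) (by simp) (by simp)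
    rfl (a := b) (b := (a, true)) hb ha (by simp [idxs_nil]) (by simp [idxs_nil])
  refine ⟨g * k, mul_mem hg hk, std A (a, true), ?_, ?_⟩
  · rw [mul_smul, hk2, one_smul]
    simpa using e
  · have : Stab (GA A) [std A (a, true)] = GA (A.erase a) := by
      have := Stab_std (A := A) (σ := [(a, true)])
      rwa [sdiff_idxs_cons, idxs_nil, Finset.sdiff_empty] at this
    rwa [this]

omit [DecidableEq R] [Fintype R] in
lemma comm_of_fix {A : Finset (Fin n)} {φ g : MulAut (FreeGroup (Fin n))} (hg : g ∈ GA A)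
    (h1 : ∀ i ∈ A, φ (FreeGroup.of i) = FreeGroup.of i)
    (h2 : ∀ i ∉ A, φ (FreeGroup.of i) ∈ FA Aᶜ) : φ * g = g * φ := by
  have h3 : ∀ x ∈ FA A, φ x = x := fun x hx => by
    have : FA A ≤ MonoidHom.eqLocus φ.toMonoidHom (MonoidHom.id _) := FA_le h1
    exact this hx
  have : φ.toMonoidHom.comp g.toMonoidHom = g.toMonoidHom.comp φ.toMonoidHom := by
    ext i
    change φ (g (FreeGroup.of i)) = g (φ (FreeGroup.of i))
    by_cases hi : i ∈ A
    · rw [h1 i hi, h3 _ ((GA_mem subset_rfl hg).2 (of_mem_FA hi))]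
    · rw [GA_fix hg hi, GA_fix' hg disjoint_compl_right (h2 i hi)]
  exact MulEquiv.ext fun x => DFunLike.congr_fun this x

omit [DecidableEq R] [Fintype R] in
lemma sw_comm {A : Finset (Fin n)} {a b : Fin n × Bool} {g : MulAut (FreeGroup (Fin n))}
    (ha : a.1 ∉ A) (hb : b.1 ∉ A) (hg : g ∈ GA A) : sw a b * g = g * sw a b := by
  refine comm_of_fix hg (fun i hi => ?_) fun i hi => ?_
  · rw [← ltr_true, sw_ltr, swl_of_ne] <;> rintro rfl <;> contradiction
  · rw [← ltr_true, sw_ltr, ltr_mem]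
    exact swl_mem (by simpa using ha) (by simpa using hb) (by simpa using hi)

omit [Fintype R] in
lemma null_tr_sub {B A : Finset (Fin n)} {t : MulAut (FreeGroup (Fin n))} (ht : t ∈ GA A)
    (htc : ∀ g ∈ GA B, t * g = g * t) {i : ℕ} {c : Cn n R}
    (hc : c ∈ Co (GA B) (T n R) (i + 1)) (hc0 : del c = 0) (hcA : ∀ s, c s ∘ pr A = c s) :
    Null (GA B) (T n R) i (tr t c - c) := by
  have h := Null.homotopy (fun s => t⁻¹ • s) (fun g hg s => by
    have := htc g hg
    rw [← mul_smul, ← mul_smul]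
    congr 1
    rw [inv_mul_eq_iff_eq_mul, ← mul_assoc, this, mul_inv_cancel_right]) hc hc0
  convert h using 2
  funext s h
  change c (sm t⁻¹ s) (t⁻¹ • h) = c (sm t⁻¹ s) h
  rw [← hcA]
  simp only [Function.comp]
  rw [pr_smul subset_rfl (inv_mem ht)]

lemma stSurj_of {i : ℕ} (hI : ∀ j < i, StInj n R j) (hS : ∀ j < i, StSurj n R j)
    (hV : ∀ j < i, Van n R j) : StSurj n R i := by
  intro A hA a ha y₀ hy₀ hy₀0 hy₀A
  set v₀ : Vt n := std A (a, true) with hv₀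
  have hx : [v₀] ∈ XA A := std_mem_XA (σ := [(a, true)]) (by simpa using ha)
  have hst : Stab (GA A) [v₀] = GA (A.erase a) := by
    have := Stab_std (A := A) (σ := [(a, true)])
    rwa [sdiff_idxs_cons, idxs_nil, Finset.sdiff_empty] at this
  have htrans : ∀ g ∈ GA A, ∀ b : Fin n × Bool, b.1 ∈ A → ∃ k ∈ GA A, g • std A b = k • v₀ := by
    intro g hg b hb
    obtain ⟨k, hk, -, hk2⟩ := exists_stab_smul (one_mem (GA A)) (τ := []) (σ := []) (by simp)
      (by simp) rfl (a := b) (b := (a, true)) hb ha (by simp [idxs_nil]) (by simp [idxs_nil])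
    exact ⟨g * k, mul_mem hg hk, by rw [mul_smul, hk2, one_smul]⟩
  have hsing : ∀ v ∈ XA A, v.length = 1 → ∃ k ∈ GA A, v = sm k [v₀] := by
    rintro v ⟨g, hg, τ, hτ, e⟩ hv
    obtain ⟨b, rfl⟩ : ∃ b, τ = [b] := by
      have := congrArg List.length e
      rw [length_sm, List.length_map, hv] at this
      exact List.length_eq_one_iff.1 this.symm
    obtain ⟨k, hk, e'⟩ := htrans g hg b (hτ b (by simp))
    exact ⟨k, hk, by rw [e]; simpa using e'⟩
  obtain ⟨y, hy, hQ⟩ := exists_Cc (S := MulAut (FreeGroup (Fin n))) (K := GA A) (XA_stable A)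
    (T_stable (n := n) (R := R)) (i + 1) 1
    (fun v w => ∃ g ∈ GA A, v = sm g [v₀] ∧ w = tr g y₀)
    (fun g hg v c => by
      rintro ⟨k, hk, rfl, rfl⟩
      exact ⟨g * k, mul_mem hg hk, by rw [mul_sm], by rw [tr_mul]⟩)
    (fun v hv hp => by
      obtain ⟨k, hk, rfl⟩ := hsing v hv hp
      exact ⟨k, hk, [v₀], rfl, y₀, by rwa [hst], 1, one_mem _, by simp, by
        funext s z; simp [tr]⟩)
  have hval : ∀ g ∈ GA A, (fun s => y s [g • v₀]) = tr g y₀ := by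
    intro g hg
    obtain ⟨k, hk, e, h⟩ := hQ (sm g [v₀]) (XA_stable A g hg _ hx) rfl
    have h' : (fun s => y s [g • v₀]) = tr k y₀ := h
    rw [h']
    have hgk : k⁻¹ * g ∈ GA (A.erase a) := by
      rw [← hst]
      refine ⟨mul_mem (inv_mem hk) hg, ?_⟩
      rw [mul_sm, e, inv_sm_sm]
    conv_rhs => rw [show g = k * (k⁻¹ * g) by group, tr_mul, tr_eq hy₀ hgk]
  have hy0 : del y = 0 := Cc_ext ((dA n R A).dS_mem hy) (zero_mem _) fun v hv hp s => by
    obtain ⟨g, hg, rfl⟩ := hsing v hv hp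
    have := congrArg (fun c => del c s) (hval g hg)
    simp only [del_at, del_tr, hy₀0] at this
    exact this
  obtain ⟨c, hc, hc0, hcx⟩ := extend_of_vertices (X := XA A) (hX := XA_faceClosed A)
    (hK := XA_stable A) T_stable hx (free_mul _) (i := i) (fun q hq => XA_Ex (by omega))
    (fun j p hjp hp => E2_dA (by omega) (hI j (by omega)) (hS j (by omega)) (hV j (by omega)))
    hy hy0 (by
      rintro v ⟨g, hg, τ, hτ, e⟩ hv
      obtain ⟨b, b', rfl⟩ : ∃ b b', τ = [b, b'] := by
        have := congrArg List.length e
        rw [length_sm, List.length_map, hv] at this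
        exact List.length_eq_two.1 this.symm
      refine ⟨g, hg, _, e, ?_⟩
      have hb : b.1 ∈ A := hτ b (by simp)
      have hb' : b'.1 ∈ A := hτ b' (by simp)
      rw [Stab_std]
      obtain ⟨k, hk, hkb⟩ := htrans 1 (one_mem _) b hb
      rw [one_smul] at hkb
      have hkb' : (sw b b' * k) • v₀ = std A b' := by
        rw [mul_smul, ← hkb, sw_smul_std hb hb', swl_left]
      have hsw : sw b b' ∈ GA A := sw_mem hb hb'
      have e1 : (fun s => y s [std A b]) = tr k y₀ := by rw [hkb]; exact hval k hk
      have e2 : (fun s => y s [std A b']) = tr (sw b b') (fun s => y s [std A b]) := by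
        rw [e1, ← tr_mul, ← hval _ (mul_mem hsw hk), hkb']
      have hcb := Cc_at hy [std A b]
      have hcb' : (fun s => y s [std A b]) ∈ Co (GA (A \ idxs [b, b'])) (T n R) (i + 1) := by
        rw [← Stab_std]
        exact Co_mono (Stab_mono (v := [std A b]) (by simp)) _ hcb
      have h := null_tr_sub hsw (fun g hg => sw_comm (by simp [idxs]) (by simp [idxs]) hg) hcb'
        (by rw [del_at, hy0]; rfl) (fun s => by
          rw [congrFun e1 s]
          funext z
          simp only [tr, Function.comp]
          rw [← hy₀A, Function.comp, Function.comp, pr_smul subset_rfl (inv_mem hk),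
            pr_smul subset_rfl (inv_mem hk), pr_pr, Finset.union_self])
      rw [← e2] at h
      convert h using 1
      funext s
      simp [del_cons])
  refine ⟨c, hc, hc0, ?_⟩
  have h := hcx v₀ hx
  rw [hst] at h
  convert h using 2
  have := hval 1 (one_mem _)
  rw [one_smul] at this
  rw [this]
  funext s z
  simp [tr]

end Coef

end WordCx

namespace WordCx


open scoped Pointwise

section Expand

variable {n : ℕ}

/-- The exponent sum of a generator. -/
def ex (b : Fin n) : FreeGroup (Fin n) →* Multiplicative ℤ :=
  FreeGroup.lift fun i => if i = b then Multiplicative.ofAdd 1 else 1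

lemma ex_of (b i : Fin n) : (ex b (FreeGroup.of i)).toAdd = if i = b then 1 else 0 := by
  simp only [ex, FreeGroup.lift_apply_of]
  split_ifs <;> rfl

lemma ex_smul {A : Finset (Fin n)} {b : Fin n} (hb : b ∉ A) {g : MulAut (FreeGroup (Fin n))}
    (hg : g ∈ GA A) (x : FreeGroup (Fin n)) : ex b (g x) = ex b x := by
  have h0 : FA A ≤ (ex b).ker := FA_le fun i hi => by
    rw [MonoidHom.mem_ker, ex, FreeGroup.lift_apply_of, if_neg]
    rintro rfl
    exact hb hi
  have : (ex b).comp g.toMonoidHom = ex b := by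
    ext i
    change ex b (g (FreeGroup.of i)) = ex b (FreeGroup.of i)
    by_cases hi : i ∈ A
    · have h1 : ex b (g (FreeGroup.of i)) = 1 := h0 ((GA_mem subset_rfl hg).2 (of_mem_FA hi))
      have h2 : ex b (FreeGroup.of i) = 1 := h0 (of_mem_FA hi)
      rw [h1, h2]
    · rw [GA_fix hg hi]
  exact DFunLike.congr_fun this x

/-- Weight of an assignment of a generator to a slot. -/
def wt (A : Finset (Fin n)) : Option (Fin n) → FreeGroup (Fin n) → ℤ
  | none, _ => 1
  | some b, x => if b ∈ A then 0 else (ex b x).toAdd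

/-- Replace the content of a slot. -/
def sb (A : Finset (Fin n)) : Option (Fin n) → FreeGroup (Fin n) → FreeGroup (Fin n)
  | none, x => pj A x
  | some b, _ => FreeGroup.of b

lemma hom_expand (A : Finset (Fin n)) (φ : FreeGroup (Fin n) → ℤ)
    (hφ : ∀ x y, φ (x * y) = φ x + φ y) (x : FreeGroup (Fin n)) :
    φ x = ∑ o, wt A o x * φ (sb A o x) := by
  let φ' : FreeGroup (Fin n) →* Multiplicative ℤ :=
    MonoidHom.mk' (fun x => Multiplicative.ofAdd (φ x)) fun x y => by rw [hφ]; rfl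
  let ψ : FreeGroup (Fin n) →* Multiplicative ℤ :=
    MonoidHom.mk' (fun x => Multiplicative.ofAdd (∑ o, wt A o x * φ (sb A o x))) fun x y => by
      rw [← ofAdd_add]
      congr 1
      rw [← Finset.sum_add_distrib]
      refine Finset.sum_congr rfl fun o _ => ?_
      cases o with
      | none => simp [wt, sb, hφ]
      | some b =>
        simp only [wt, sb, map_mul, toAdd_mul]
        split_ifs <;> ring
  have h1 : φ 1 = 0 := by have := hφ 1 1; rw [mul_one] at this; omega
  have : φ' = ψ := by
    ext i
    change φ (FreeGroup.of i) = ∑ o, wt A o (FreeGroup.of i) * φ (sb A o (FreeGroup.of i))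
    rw [Fintype.sum_option]
    simp only [wt, sb, pj_of, ex_of]
    by_cases hi : i ∈ A
    · rw [if_pos hi, one_mul, Finset.sum_eq_zero, add_zero]
      intro b _
      by_cases hb : b ∈ A
      · simp [hb]
      · have : i ≠ b := by rintro rfl; contradiction
        simp [this]
    · rw [if_neg hi, h1, Finset.sum_eq_single i]
      · simp [hi]
      · intro b _ hb
        simp [hb.symm]
      · simp
  exact congrArg Multiplicative.toAdd (DFunLike.congr_fun this x)

end Expand

section Coef

variable {n : ℕ} {R : Type} [DecidableEq R]

/-- Partial expansion of a cochain in the slots of a finite set. -/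
def Ez (A : Finset (Fin n)) (F : Finset R) (z : R → Option (Fin n)) (c : Cn n R) : Cn n R :=
  fun s h => (∏ r ∈ F, wt A (z r) (h r)) * c s fun r => if r ∈ F then sb A (z r) (h r) else h r

lemma Ez_insert (A : Finset (Fin n)) {F : Finset R} {r : R} (hr : r ∉ F) (z : R → Option (Fin n))
    {c : Cn n R} (hc : ∀ s, c s ∈ T n R) :
    Ez A F z c = ∑ o, Ez A (insert r F) (Function.update z r o) c := by
  funext s h
  rw [Finset.sum_apply, Finset.sum_apply]
  simp only [Ez]
  set k : R → FreeGroup (Fin n) := fun r => if r ∈ F then sb A (z r) (h r) else h r with hk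
  have h1 := hom_expand A (fun x => c s (Function.update k r x)) (fun x y => hc s k r x y) (h r)
  have h2 : Function.update k r (h r) = k := by
    rw [Function.update_eq_self_iff]; simp [hk, hr]
  rw [h2] at h1
  rw [h1, Finset.mul_sum]
  refine Finset.sum_congr rfl fun o _ => ?_
  rw [Finset.prod_insert hr, Function.update_self]
  have h3 : ∏ x ∈ F, wt A (Function.update z r o x) (h x) = ∏ x ∈ F, wt A (z x) (h x) :=
    Finset.prod_congr rfl fun x hx => by
      rw [Function.update_of_ne]; rintro rfl; contradiction
  have h4 : (fun x => if x ∈ insert r F then sb A (Function.update z r o x) (h x) else h x) =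
      Function.update k r (sb A o (h r)) := by
    funext x
    by_cases hx : x = r
    · subst hx; simp
    · simp [hx, hk]
  rw [h3, h4]
  ring

lemma null_of_Ez [Fintype R] {A : Finset (Fin n)} {K : Subgroup (MulAut (FreeGroup (Fin n)))} {i : ℕ}
    {c : Cn n R} (hc : ∀ s, c s ∈ T n R)
    (h : ∀ z, Null K (T n R) i (Ez A Finset.univ z c)) : Null K (T n R) i c := by
  have key : ∀ F : Finset R, (∀ z, Null K (T n R) i (Ez A F z c)) → Null K (T n R) i c := by
    intro F
    induction F using Finset.induction_on with
    | empty =>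
      intro h
      have e : Ez A ∅ (fun _ => none) c = c := by funext s h; simp [Ez]
      simpa only [e] using h fun _ => none
    | insert r F hr ih =>
      intro h
      refine ih fun z => ?_
      rw [Ez_insert A hr z hc]
      exact Null.sum _ fun o _ => h _
  exact key _ h

/-- Extend a tuple indexed by the empty slots. -/
def ext' (z : R → Option (Fin n)) (h : {r // z r = none} → FreeGroup (Fin n)) (r : R) :
    FreeGroup (Fin n) :=
  if hr : z r = none then h ⟨r, hr⟩ else FreeGroup.of ((z r).get (Option.ne_none_iff_isSome.1 hr))

lemma T_ext' (z : R → Option (Fin n)) {f : (R → FreeGroup (Fin n)) → ℤ} (hf : f ∈ T n R) :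
    f ∘ ext' z ∈ T n {r // z r = none} := by
  intro h r x y
  have key : ∀ w, ext' z (Function.update h r w) = Function.update (ext' z h) r.1 w := fun w => by
    funext r'
    by_cases e : r' = r.1
    · subst e
      simp [ext', r.2]
    · by_cases e' : z r' = none
      · have : (⟨r', e'⟩ : {r // z r = none}) ≠ r := fun h => e (congrArg Subtype.val h)
        simp [ext', e, e', this]
      · simp [ext', e, e']
  simp only [Function.comp, key]
  exact hf _ _ _ _

lemma Null.weight {Z Z' : Type*} {G S : Type*} [Group G] [MulAction G S] [MulAction G Z]
    [MulAction G Z'] {K : Subgroup G} {N : AddSubgroup (Z → ℤ)} {N' : AddSubgroup (Z' → ℤ)}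
    (η : Z' → Z) (w : Z' → ℤ) (hη : ∀ g ∈ K, ∀ z, η (g • z) = g • η z)
    (hw : ∀ g ∈ K, ∀ z, w (g • z) = w z) (hN : ∀ f ∈ N, (fun z => w z * f (η z)) ∈ N') {i : ℕ}
    {c : List S → Z → ℤ} (hc : Null K N i c) : Null K N' i (fun s z => w z * c s (η z)) := by
  obtain ⟨b, hb, hb0, rfl⟩ := hc
  refine ⟨fun s z => w z * b s (η z), ⟨fun g hg s z => ?_, fun s => hN _ (hb.2.1 s), fun s hs => ?_⟩,
    fun hi => ?_, ?_⟩
  · change w (g • z) * b (sm g s) (η (g • z)) = w z * b s (η z)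
    rw [hη g hg, hw g hg, hb.1 g hg]
  · funext z
    change w z * b s (η z) = 0
    rw [hb.2.2 s hs]
    simp
  · rw [hb0 hi]
    funext s z
    simp
  · funext s z
    rw [del_pi, del_pi]
    exact congrFun (del_comp (AddMonoidHom.mulLeft (w z)) fun t => b t (η z)) s

/-- Project every slot to the factor `A`. -/
def pA (A : Finset (Fin n)) {R : Type} (h : R → FreeGroup (Fin n)) : R → FreeGroup (Fin n) :=
  fun r => pj A (h r)

lemma pj_smul' {A : Finset (Fin n)} {g : MulAut (FreeGroup (Fin n))} (hg : g ∈ GA A)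
    (x : FreeGroup (Fin n)) : pj A (g x) = g (pj A x) := by
  have : (pj A).comp g.toMonoidHom = g.toMonoidHom.comp (pj A) := by
    ext i
    change pj A (g (FreeGroup.of i)) = g (pj A (FreeGroup.of i))
    by_cases hi : i ∈ A
    · rw [pj_eq_of_mem subset_rfl ((GA_mem subset_rfl hg).2 (of_mem_FA hi)), pj_of, if_pos hi]
    · rw [GA_fix hg hi, pj_of, if_neg hi, map_one]
  exact DFunLike.congr_fun this x

lemma pA_smul {A : Finset (Fin n)} {g : MulAut (FreeGroup (Fin n))} (hg : g ∈ GA A)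
    {R : Type} (h : R → FreeGroup (Fin n)) : pA A (g • h) = g • pA A h :=
  funext fun _ => pj_smul' hg _

lemma T_pA (A : Finset (Fin n)) {f : (R → FreeGroup (Fin n)) → ℤ} (hf : f ∈ T n R) :
    f ∘ pA A ∈ T n R := T_comp hf fun _ => pj A

lemma T_apply_one {f : (R → FreeGroup (Fin n)) → ℤ} (hf : f ∈ T n R) {h : R → FreeGroup (Fin n)}
    {r : R} (hr : h r = 1) : f h = 0 := by
  have := hf h r 1 1
  rw [mul_one, ← hr, Function.update_eq_self] at this
  omega

lemma T_weight [Fintype R] (A : Finset (Fin n)) (z : R → Option (Fin n))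
    {f : ({r // z r = none} → FreeGroup (Fin n)) → ℤ} (hf : f ∈ T n {r // z r = none}) :
    (fun h : R → FreeGroup (Fin n) => (∏ r, wt A (z r) (h r)) * f fun r => h r) ∈ T n R := by
  intro h r x y
  beta_reduce
  rw [← Finset.mul_prod_erase _ _ (Finset.mem_univ r), ← Finset.mul_prod_erase _ _ (Finset.mem_univ r),
    ← Finset.mul_prod_erase _ _ (Finset.mem_univ r)]
  have h1 : ∀ w, ∏ r' ∈ Finset.univ.erase r, wt A (z r') (Function.update h r w r') =
      ∏ r' ∈ Finset.univ.erase r, wt A (z r') (h r') := fun w =>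
    Finset.prod_congr rfl fun r' hr' => by rw [Function.update_of_ne (Finset.ne_of_mem_erase hr')]
  simp only [h1, Function.update_self]
  by_cases hr : z r = none
  · have h2 : ∀ w, (fun r' : {r // z r = none} => Function.update h r w r') =
        Function.update (fun r' : {r // z r = none} => h r') ⟨r, hr⟩ w := fun w => by
      funext r'
      by_cases e : r' = ⟨r, hr⟩
      · subst e; simp
      · have : (r' : R) ≠ r := fun h => e (Subtype.ext h)
        simp [e, this]
    simp only [h2]
    have h3 := hf (fun r' : {r // z r = none} => h r') ⟨r, hr⟩ x y
    rw [h3, hr]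
    simp only [wt]
    ring
  · have h2 : ∀ w, (fun r' : {r // z r = none} => Function.update h r w r') =
        fun r' : {r // z r = none} => h r' :=
      fun w => by
        funext r'
        rw [Function.update_of_ne]
        rintro rfl
        exact hr r'.2
    simp only [h2]
    obtain ⟨b, hb⟩ := Option.ne_none_iff_exists'.1 hr
    rw [hb]
    simp only [wt, map_mul, toAdd_mul]
    split_ifs <;> ring

end Coef

end WordCx

namespace WordCx

open scoped Pointwise

section Coef

variable {n : ℕ} {R : Type} [DecidableEq R]

omit [DecidableEq R] in
lemma ext'_smul {A : Finset (Fin n)} {z : R → Option (Fin n)} (hz : ∀ r b, z r = some b → b ∉ A)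
    {g : MulAut (FreeGroup (Fin n))} (hg : g ∈ GA A) (h : {r // z r = none} → FreeGroup (Fin n)) :
    ext' z (g • h) = g • ext' z h := by
  funext r
  by_cases hr : z r = none
  · simp [ext', hr]
  · have : (z r).get (Option.ne_none_iff_isSome.1 hr) ∉ A := hz r _ (Option.some_get _).symm
    simp only [ext', hr, dite_false, Pi.smul_apply]
    exact (GA_fix hg this).symm

lemma Null.pA {A : Finset (Fin n)} {i : ℕ} {c : Cn n R} (hc : Null (GA A) (T n R) i c) :
    Null (GA A) (T n R) i (fun s => c s ∘ WordCx.pA A) :=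
  Null.comp id (fun _ h => h) (fun _ _ _ => rfl) (WordCx.pA A) (fun _ hg z => pA_smul hg z)
    (fun _ hf => T_pA A hf) hc

lemma null_Ez [Fintype R] {A : Finset (Fin n)} {i : ℕ} {z : R → Option (Fin n)}
    (hz : ∀ r b, z r = some b → b ∉ A) {c : Cn n R}
    (h : Null (GA A) (T n {r // z r = none}) i (fun s => (c s ∘ ext' z) ∘ pA A)) :
    Null (GA A) (T n R) i (Ez A Finset.univ z c) := by
  have := Null.weight (G := MulAut (FreeGroup (Fin n))) (N' := T n R)
    (fun (h : R → FreeGroup (Fin n)) (r : {r // z r = none}) => h r)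
    (fun h => ∏ r, wt A (z r) (h r)) (fun _ _ _ => rfl) (fun g hg h => by
      refine Finset.prod_congr rfl fun r _ => ?_
      cases hr : z r with
      | none => rfl
      | some b =>
        simp only [wt, Pi.smul_apply, MulAut.smul_def]
        rw [ex_smul (hz r b hr) hg]) (fun f hf => T_weight A z hf) h
  convert this using 1
  funext s h
  simp only [Ez, Finset.mem_univ, if_true, Function.comp]
  congr 2
  funext r
  by_cases hr : z r = none
  · simp [ext', hr, sb, pA]
  · obtain ⟨b, hb⟩ := Option.ne_none_iff_exists'.1 hr
    simp [ext', hb, sb]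

/-- Vanishing of the component supported on a free factor of corank one. -/
def Cstat (n : ℕ) (R : Type) [Fintype R] [DecidableEq R] (i : ℕ) : Prop :=
  ∀ A : Finset (Fin n), 2 * i + Fintype.card R + 2 ≤ A.card → ∀ a ∈ A,
    ∀ c : Cn n R, c ∈ Co (GA A) (T n R) (i + 1) → del c = 0 →
    Null (GA (A.erase a)) (T n R) i (fun s => c s ∘ pA (A.erase a))

omit [DecidableEq R] in
lemma pA_pr_disjoint (A : Finset (Fin n)) (h : R → FreeGroup (Fin n)) (r : R) :
    pr A (pA A h) r = 1 :=
  pj_eq_one (by exact disjoint_compl_left) (pj_mem _ _)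

lemma van_of [Fintype R] [Nonempty R] {i : ℕ}
    (hI : ∀ (R' : Type) [Fintype R'] [DecidableEq R'], StInj n R' i)
    (hV : ∀ (R' : Type) [Fintype R'] [DecidableEq R'] [Nonempty R'],
      Fintype.card R' < Fintype.card R → Van n R' i)
    (hC : Cstat n R i) : Van n R i := by
  intro A hA c hc hc0
  have hR : 0 < Fintype.card R := Fintype.card_pos
  obtain ⟨a, ha⟩ : A.Nonempty := Finset.card_pos.1 (by omega)
  have hA' : (A.erase a).card + 1 = A.card := Finset.card_erase_add_one ha
  set d : Cn n R := c - fun s => c s ∘ pr A with hd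
  have hdm : d ∈ Co (GA A) (T n R) (i + 1) := sub_mem hc (Co_pr subset_rfl hc)
  have hd0 : del d = 0 := by
    rw [hd, map_sub, hc0, zero_sub, del_precomp (pr A) c, hc0, neg_eq_zero]; rfl
  have hdp : ∀ s h, pr A h = h → d s h = 0 := fun s h hh => by
    change c s h - c s (pr A h) = 0
    rw [hh, sub_self]
  refine hI R A hA a ha d hdm hd0 (null_of_Ez (A := A.erase a) hdm.2.1 fun z => ?_)
  by_cases hz : ∀ r b, z r = some b → b ∉ A.erase a
  swap
  · push Not at hz
    obtain ⟨r, b, hr, hb⟩ := hz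
    convert Null.zero using 1
    funext s h
    simp only [Ez]
    rw [Finset.prod_eq_zero (Finset.mem_univ r), zero_mul]; · rfl
    rw [hr, wt, if_pos hb]
  set R₁ := {r // z r = none} with hR₁
  set d₁ : Cn n R₁ := fun s => d s ∘ ext' z with hd₁
  have hd₁m : d₁ ∈ Co (GA (A.erase a)) (T n R₁) (i + 1) :=
    Co_comp id (fun g hg => GA_mono (Finset.erase_subset _ _) hg) (fun _ _ _ => rfl) (ext' z)
      (fun g hg h => ext'_smul hz hg h) (fun f hf => T_ext' z hf) hdm
  have hd₁0 : del d₁ = 0 := by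
    rw [hd₁, del_precomp (ext' z) d, hd0]; rfl
  refine null_Ez hz ?_
  by_cases hall : ∀ r, z r = none
  · have := hC A hA a ha d hdm hd0
    have e : ∀ h : R₁ → FreeGroup (Fin n), ext' z h = fun r => h ⟨r, hall r⟩ := fun h => by
      funext r; simp [ext', hall r]
    have h2 := Null.comp (K' := GA (A.erase a)) (N' := T n R₁) id (fun _ h => h) (fun _ _ _ => rfl)
      (ext' z) (fun g hg h => ext'_smul hz hg h) (fun f hf => T_ext' z hf) this
    convert h2 using 1
    funext s h
    simp only [Function.comp]
    rw [e, e]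
    rfl
  push Not at hall
  obtain ⟨r₀, hr₀⟩ := hall
  have hcard : Fintype.card R₁ < Fintype.card R :=
    Fintype.card_subtype_lt hr₀
  by_cases hne : Nonempty R₁
  · have h1 := (hV R₁ hcard (A.erase a) (by omega) d₁ hd₁m hd₁0).pA
    convert h1 using 1
    funext s h
    change d₁ s (pA _ h) = d₁ s (pA _ h) - d₁ s (pr _ (pA _ h))
    rw [T_apply_one (hd₁m.2.1 s) (pA_pr_disjoint _ h (Classical.arbitrary R₁)), sub_zero]
  have hemp : IsEmpty R₁ := not_nonempty_iff.1 hne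
  have hpA : (fun s => (d s ∘ ext' z) ∘ pA (A.erase a)) = d₁ := by
    funext s h
    change d₁ s _ = d₁ s _
    rw [Subsingleton.elim (pA _ h) h]
  rw [hpA]
  have hsome : ∀ r, ∃ b, z r = some b := fun r => by
    rw [← Option.ne_none_iff_exists']
    exact fun h => hemp.false ⟨r, h⟩
  have hext : ∀ r b h, z r = some b → ext' z h r = FreeGroup.of b := fun r b h hr => by
    simp [ext', hr]
  by_cases hza : ∃ r₁, z r₁ = some a
  swap
  · convert Null.zero using 1
    funext s h
    refine hdp s _ ?_
    funext r
    obtain ⟨b, hb⟩ := hsome r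
    have hbA : b ∉ A := fun h => hz r b hb (Finset.mem_erase.2 ⟨by rintro rfl; exact hza ⟨r, hb⟩, h⟩)
    rw [pr, hext r b h hb, pj_of, if_pos (by simpa using hbA)]
  obtain ⟨r₁, hr₁⟩ := hza
  obtain ⟨x, hx⟩ : (A.erase a).Nonempty := Finset.card_pos.1 (by omega)
  refine hI R₁ (A.erase a) (by omega) x hx d₁ hd₁m hd₁0 ?_
  have hxa : x ≠ a := Finset.ne_of_mem_erase hx
  have hxA : x ∈ A := Finset.mem_of_mem_erase hx
  obtain ⟨t, ht1, ht2⟩ := exists_tv (x, true) (a, true) hxa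
  have ht := (ht2 A hxA ha).1
  have htf : ∀ i, i ≠ x → t (FreeGroup.of i) = FreeGroup.of i := fun i hi =>
    (ht2 A hxA ha).2 (i, true) hi
  have htx : t (FreeGroup.of x) = FreeGroup.of x * FreeGroup.of a := ht1
  set B := (A.erase a).erase x with hB
  have hBA : B ⊆ A := (Finset.erase_subset _ _).trans (Finset.erase_subset _ _)
  have htc : ∀ g ∈ GA B, t * g = g * t := fun g hg => comm_of_fix hg
    (fun i hi => htf i (Finset.ne_of_mem_erase hi)) fun i hi => by
      by_cases hix : i = x
      · rw [hix, htx]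
        exact mul_mem (of_mem_FA (by simp [hB])) (of_mem_FA (by simp [hB]))
      · rw [htf i hix]
        exact of_mem_FA (by simpa using hi)
  set δ : Cn n R₁ := fun s => d s ∘ fun h => Function.update (ext' z h) r₁ (FreeGroup.of x) with hδ
  have hT : ∀ f, f ∈ T n R₁ := fun f h r => (hemp.false r).elim
  have hδm : δ ∈ Co (GA B) (T n R₁) (i + 1) :=
    Co_comp id (fun g hg => GA_mono hBA hg) (fun _ _ _ => rfl) _
      (fun g hg h => by
        have hz' : ∀ r b, z r = some b → b ∉ B := fun r b hr hb =>
          hz r b hr (Finset.erase_subset _ _ hb)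
        rw [ext'_smul hz' hg]
        funext r
        by_cases hr : r = r₁
        · subst hr
          simp only [Function.update_self, Pi.smul_apply]
          exact (GA_fix hg (by simp [hB])).symm
        · simp only [Function.update_of_ne hr, Pi.smul_apply]; rfl) (fun f hf => hT _) hdm
  have hδ0 : del δ = 0 := by
    rw [hδ, del_precomp _ d, hd0]; rfl
  have hth : ∀ g ∈ GA B, ∀ s : MulAut (FreeGroup (Fin n)), t • g • s = g • t • s := fun g hg s => by
    rw [smul_smul, smul_smul, htc g hg]
  have n1 := Null.homotopy (fun s => t • s) hth hδm hδ0
  have n2 := Null.homotopy (fun s => t • s) hth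
    (Co_mono (GA_mono (Finset.erase_subset x (A.erase a))) _ hd₁m) hd₁0
  have key : ∀ s h, d₁ (sm t s) h = δ s h - δ (sm t s) h := fun s h => by
    have e1 : Function.update (ext' z h) r₁ (FreeGroup.of x * FreeGroup.of a) =
        t • Function.update (ext' z h) r₁ (FreeGroup.of x) := by
      funext r
      by_cases hr : r = r₁
      · subst hr
        simpa using htx.symm
      · obtain ⟨b, hb⟩ := hsome r
        simp only [Function.update_of_ne hr, Pi.smul_apply]
        rw [hext r b h hb]
        exact (htf b (by rintro rfl; exact hz r b hb hx)).symm
    have e2 : Function.update (ext' z h) r₁ (FreeGroup.of a) = ext' z h := by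
      rw [Function.update_eq_self_iff, hext r₁ a h hr₁]
    have e3 := hdm.2.1 (sm t s) (ext' z h) r₁ (FreeGroup.of x) (FreeGroup.of a)
    rw [e1, e2, hdm.1 t ht] at e3
    simp only [hd₁, hδ, Function.comp]
    linarith
  have n3 := (n1.add n2).neg
  convert n3 using 1
  funext s h
  have := key s h
  simp only [Pi.neg_apply, Pi.add_apply, Pi.sub_apply]
  change _ = -(δ (sm t s) h - δ s h + (d₁ (sm t s) h - d₁ s h))
  linarith

end Coef

end WordCx

namespace WordCx

open scoped Pointwise

section FreeGroups

lemma basis_mem {Φ ι : Type*} [Group Φ] (b : FreeGroupBasis ι Φ) (H : Subgroup Φ)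
    (h : ∀ i, b i ∈ H) (f : Φ) : f ∈ H := by
  let L : Φ →* H := b.lift fun i => ⟨b i, h i⟩
  have : H.subtype.comp L = MonoidHom.id Φ := b.ext_hom _ _ fun i => by
    simp [L, FreeGroupBasis.lift]
  have h2 := DFunLike.congr_fun this f
  change (L f : Φ) = f at h2
  exact h2 ▸ (L f).2

/-- A crossed homomorphism on a free group can be prescribed on a basis. -/
lemma exists_crossed {Φ ι Y M : Type*} [Group Φ] [MulAction Φ Y] [AddCommGroup M]
    (b : FreeGroupBasis ι Φ) (u : ι → Y → M) : ∃ U : Φ → Y → M,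
    (∀ f g y, U (f * g) y = U g y + U f (g • y)) ∧ ∀ i y, U (b i) y = u i y := by
  let L : Φ →* (Y → Multiplicative M) ⋊[mulAutArrow] Φ :=
    b.lift fun i => ⟨fun y => Multiplicative.ofAdd (u i ((b i)⁻¹ • y)), b i⟩
  have hL : ∀ i, L (b i) = ⟨fun y => Multiplicative.ofAdd (u i ((b i)⁻¹ • y)), b i⟩ := fun i => by
    simp [L, FreeGroupBasis.lift]
  have hr : SemidirectProduct.rightHom.comp L = MonoidHom.id Φ := b.ext_hom _ _ fun i => by
    simp [hL]
  have hr' : ∀ f, (L f).right = f := fun f => DFunLike.congr_fun hr f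
  refine ⟨fun f y => ((L f).left (f • y)).toAdd, fun f g y => ?_, fun i y => ?_⟩
  · have : (L (f * g)).left ((f * g) • y) = (L f).left (f • g • y) * (L g).left (g • y) := by
      rw [map_mul, SemidirectProduct.mul_left, hr', Pi.mul_apply, mul_smul]
      congr 1
      change (L g).left (f⁻¹ • f • g • y) = _
      rw [inv_smul_smul]
    beta_reduce
    rw [this, toAdd_mul, add_comm]
  · beta_reduce
    rw [hL]
    simp

variable {G S Z : Type*} [Group G] [MulAction G S] [MulAction G Z] {F : Subgroup G}
  {N : AddSubgroup (Z → ℤ)}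

lemma exists_section (hfree : ∀ g ∈ F, ∀ s : S, g • s = s → g = 1) :
    ∃ u : S → G, (∀ s, u s ∈ F) ∧ ∀ f ∈ F, ∀ s, u (f • s) = f * u s := by
  obtain ⟨u, hu, -⟩ := exists_equivariant (⊤ : Subgroup F) (fun f s => (f : G) • (s : S))
    (fun f g : F => f * g) (fun s => one_smul _ _) (fun f g s => mul_smul _ _ _)
    (fun f g h => mul_assoc _ _ _) (fun _ _ => True) (fun _ _ _ _ _ => trivial) (fun s => by
      refine ⟨1, Subgroup.mem_top _, s, (one_smul _ _).symm, 1, trivial, fun k _ hk => ?_⟩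
      rw [mul_one]
      exact Subtype.ext (hfree k k.2 s hk))
  exact ⟨fun s => u s, fun s => (u s).2, fun f hf s => congrArg Subtype.val (hu ⟨f, hf⟩ trivial s)⟩

variable (hfree : ∀ g ∈ F, ∀ s : S, g • s = s → g = 1)
  (hFZ : ∀ g ∈ F, ∀ f ∈ N, ∀ z, f (g • z) = f z)

include hFZ in
lemma Co_inv {j : ℕ} {c : List S → Z → ℤ} (hc : c ∈ Co F N j) {f : G} (hf : f ∈ F) (s : List S) :
    c (sm f s) = c s := by
  funext z
  rw [← hc.1 f hf s z, hFZ f hf _ (hc.2.1 _)]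

lemma del_cone_eq {M : Type*} [AddCommGroup M] {c : List S → M} (hc0 : del c = 0) (ρ : S) :
    del (fun s => c (ρ :: s)) = c := by
  funext s
  have := congrFun hc0 (ρ :: s)
  rw [del_cons] at this
  exact (sub_eq_zero.1 this).symm

include hfree hFZ in
/-- Free groups have no cohomology above degree one. -/
lemma null_free [IsFreeGroup F] (ρ : S) {k : ℕ} {c : List S → Z → ℤ} (hc : c ∈ Co F N (k + 3))
    (hc0 : del c = 0) : Null F N (k + 2) c := by
  obtain ⟨ι, ⟨B⟩⟩ := IsFreeGroup.nonempty_basis (G := F)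
  obtain ⟨u, huF, hu⟩ := exists_section hfree
  set b : List S → Z → ℤ := fun s => c (ρ :: s) with hb
  have hbN : ∀ s, b s ∈ N := fun s => hc.2.1 _
  have hbl : ∀ s, s.length ≠ k + 2 → b s = 0 := fun s hs => hc.2.2 _ (by simpa using hs)
  have hdb : del b = c := del_cone_eq hc0 ρ
  let _ : MulAction F (List S) :=
    { smul := fun f s => sm (f : G) s, one_smul := one_sm, mul_smul := fun f g s => mul_sm _ _ s }
  have hsmul : ∀ (f : F) (s : List S), f • s = sm (f : G) s := fun _ _ => rfl
  obtain ⟨U, hU, hUB⟩ := exists_crossed (M := N) B fun i y =>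
    ⟨b (sm (B i : G) (ρ :: y)) - b (ρ :: y), sub_mem (hbN _) (hbN _)⟩
  set x : List S → Z → ℤ := fun s => if s.length = k + 1 then
    match s with
    | [] => 0
    | a :: t => (U ⟨u a, huF a⟩ (sm (u a)⁻¹ (a :: t)) : N)
    else 0 with hx
  have hxN : ∀ s, x s ∈ N := fun s => by
    simp only [hx]
    split_ifs
    · cases s with
      | nil => exact zero_mem _
      | cons a t => exact Subtype.mem _
    · exact zero_mem _
  have hxf : ∀ (f : F) (s : List S), s.length = k + 1 → x (sm (f : G) s) = x s + (U f s : N) := by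
    intro f s hs
    cases s with
    | nil => simp at hs
    | cons a t =>
      have hs' : ((f : G) • a :: sm (f : G) t).length = k + 1 := by simpa using hs
      have hx2 : x (a :: t) = (U ⟨u a, huF a⟩ (sm (u a)⁻¹ (a :: t)) : N) := if_pos hs
      have hx3 : x ((f : G) • a :: sm (f : G) t) = (U ⟨u ((f : G) • a), huF _⟩
        (sm (u ((f : G) • a))⁻¹ ((f : G) • a :: sm (f : G) t)) : N) := if_pos hs'
      rw [sm_cons, hx3, hx2]
      have e : (⟨u ((f : G) • a), huF _⟩ : F) = f * ⟨u a, huF a⟩ := Subtype.ext (hu f f.2 a)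
      rw [e, hU, ← AddSubgroup.coe_add]
      congr 1
      have e2 : (sm (u ((f : G) • a))⁻¹ ((f : G) • a :: sm (f : G) t)) = sm (u a)⁻¹ (a :: t) := by
        rw [hu f f.2, mul_inv_rev, mul_sm, ← sm_cons, inv_sm_sm]
      rw [e2, hsmul]
      congr 2
      exact sm_inv_sm (u a) (a :: t)
  have hgen : ∀ i s, (b - del x) (sm (B i : G) s) = (b - del x) s := by
    intro i s
    rw [Pi.sub_apply, Pi.sub_apply]
    by_cases hs : s.length = k + 2
    · set v : List S → Z → ℤ := (fun s => b (sm (B i : G) s)) - b with hv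
      have hv0 : del v = 0 := by
        rw [hv, map_sub, hdb]
        funext s
        rw [Pi.sub_apply, del_sm, hdb, Co_inv hFZ hc (B i).2, sub_self]; rfl
      have h1 : del (fun t => x (sm (B i : G) t)) s =
          del (x + fun t => v (ρ :: t)) s := del_congr fun t _ ht => by
        rw [hxf _ _ (by omega), hUB]; rfl
      rw [← del_sm, h1, map_add, del_cone_eq hv0]
      simp only [Pi.add_apply, hv, Pi.sub_apply]
      abel
    · rw [hbl _ hs, hbl _ (by simpa using hs), del_eq_zero (fun t _ ht => if_neg (by rw [length_sm] at ht; omega)),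
        del_eq_zero (fun t _ ht => if_neg (by omega))]
  have hinv : ∀ (f : F) s, (b - del x) (sm (f : G) s) = (b - del x) s := fun f => by
    refine basis_mem B (⟨⟨⟨{f : F | ∀ s, (b - del x) (sm (f : G) s) = (b - del x) s}, ?_⟩, ?_⟩, ?_⟩ :
      Subgroup F) hgen f
    · intro f g hf hg s
      rw [Subgroup.coe_mul, mul_sm]
      exact (hf _).trans (hg _)
    · intro s
      rw [Subgroup.coe_one, one_sm]
    · intro f hf s
      have := hf (sm (f : G)⁻¹ s)
      rw [sm_inv_sm] at this
      rw [Subgroup.coe_inv]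
      exact this.symm
  have hN : ∀ s, (b - del x) s ∈ N := fun s => sub_mem (hbN s) (del_mem N hxN s)
  refine ⟨b - del x, ⟨fun g hg s z => ?_, hN, fun s hs => ?_⟩, fun h => by omega, ?_⟩
  · rw [hinv ⟨g, hg⟩, hFZ g hg _ (hN s)]
  · rw [Pi.sub_apply, hbl s hs, del_eq_zero (fun t _ ht => if_neg (by omega)), sub_zero]
  · rw [map_sub, del_del, sub_zero, hdb]

include hFZ in
lemma null_of_values (ρ : S) {c : List S → Z → ℤ} (hc : c ∈ Co F N 2) (hc0 : del c = 0)
    (h : ∀ f ∈ F, ∀ s : S, c [s, f • s] = 0) : Null F N 1 c := by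
  refine ⟨fun s => c (ρ :: s), ⟨fun f hf s z => ?_, fun s => hc.2.1 _, fun s hs =>
    hc.2.2 _ (by simpa using hs)⟩, fun h => by omega, del_cone_eq hc0 ρ⟩
  have : c (ρ :: sm f s) = c (ρ :: s) := by
    match s with
    | [] => rfl
    | [a] =>
      have h1 := congrFun hc0 [ρ, a, f • a]
      simp only [del_cons, del_nil, sub_zero, Pi.zero_apply, h f hf a] at h1
      simp only [sm_cons, sm_nil]
      have h2 : c [ρ, f • a] = c [ρ, a] := by
        have h3 := sub_eq_zero.1 h1
        exact sub_eq_zero.1 (by simpa using h3.symm)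
      exact h2
    | a :: b :: t =>
      rw [hc.2.2 _ (by simp), hc.2.2 _ (by simp)]
  change c (ρ :: sm f s) (f • z) = _
  rw [this, hFZ f hf _ (hc.2.1 _)]

include hfree hFZ in
lemma exists_of_values (Λ : G → Z → ℤ) (hΛ : ∀ f ∈ F, ∀ g ∈ F, Λ (f * g) = Λ f + Λ g)
    (hN : ∀ f ∈ F, Λ f ∈ N) : ∃ c ∈ Co F N 2, del c = 0 ∧ ∀ f ∈ F, ∀ s : S, c [s, f • s] = Λ f := by
  obtain ⟨u, huF, hu⟩ := exists_section hfree
  set x : List S → Z → ℤ := fun s => match s with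
    | [a] => Λ (u a)
    | _ => 0 with hx
  have hxl : ∀ s, s.length ≠ 1 → x s = 0 := fun s hs => by
    match s with
    | [] => rfl
    | [a] => simp at hs
    | a :: b :: t => rfl
  have hxN : ∀ s, x s ∈ N := fun s => by
    match s with
    | [] => exact zero_mem _
    | [a] => exact hN _ (huF a)
    | a :: b :: t => exact zero_mem _
  have h2 : ∀ a b : S, del x [a, b] = Λ (u b) - Λ (u a) := fun a b => by
    have : x [] = 0 := rfl
    simp [del_cons, hx]
  have hl : ∀ s, s.length ≠ 2 → del x s = 0 := fun s hs =>
    del_eq_zero fun t _ ht => hxl t (by omega)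
  have hdN : ∀ s, del x s ∈ N := fun s => del_mem N hxN s
  refine ⟨del x, ⟨fun f hf s z => ?_, hdN, hl⟩, del_del x, fun f hf s => ?_⟩
  · rw [hFZ f hf _ (hdN _)]
    match s with
    | [] => rfl
    | [a] => rw [hl _ (by simp), hl _ (by simp)]
    | [a, b] =>
      simp only [sm_cons, sm_nil]
      rw [h2, h2, hu f hf, hu f hf, hΛ f hf _ (huF _), hΛ f hf _ (huF _), add_sub_add_left_eq_sub]
    | a :: b :: c :: t => rw [hl _ (by simp), hl _ (by simp)]
  · rw [h2, hu f hf, hΛ f hf _ (huF _), add_sub_cancel_right]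

end FreeGroups

end WordCx

namespace WordCx

open scoped Pointwise

section HS

variable {G S V Z : Type*} [Group G] [MulAction G S] [MulAction G V] [MulAction G Z]
  {F : Subgroup G} {N : AddSubgroup (Z → ℤ)}

lemma faceClosed_univ : FaceClosed (Set.univ : Set (List V)) := fun _ _ _ _ => Set.mem_univ _

variable (G S V N) in
/-- The double complex of all words. -/
abbrev hs : DoubleCx (List S → List V → Z → ℤ) :=
  dbl S (⊤ : Subgroup G) Set.univ faceClosed_univ (fun _ _ _ _ => Set.mem_univ _) N

lemma hs_dX (c : List S → List V → Z → ℤ) (s : List S) :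
    (hs G S V N).dX c s = del (c s) :=
  funext fun _ => dbl_dX (Set.mem_univ _) s

lemma hs_exX [Nonempty V] (hfree : ∀ g : G, ∀ s : S, g • s = s → g = 1) (j p : ℕ) :
    (hs G S V N).ExX (j + 1) p := by
  obtain ⟨κ, hκ, hκK⟩ := exists_kappa (⊤ : Subgroup G) fun g _ s => hfree g s
  exact exX_dbl hκ hκK (fun q _ => Ex_cone (Classical.arbitrary V) (fun _ _ => Set.mem_univ _) q) j

lemma Stab_top_cons (hF : ∀ g, ∀ v : V, g • v = v ↔ g ∈ F) {v : List V} (hv : v ≠ []) :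
    Stab (⊤ : Subgroup G) v = F := by
  ext g
  rw [mem_Stab]
  refine ⟨fun h => ?_, fun h => ⟨trivial, ?_⟩⟩
  · obtain ⟨a, v, rfl⟩ := List.exists_cons_of_ne_nil hv
    exact (hF g a).1 (by simpa using (List.cons.inj h.2).1)
  · unfold sm
    conv_rhs => rw [← List.map_id v]
    exact List.map_congr_left fun a _ => (hF g a).2 h

lemma lift_zero (ρ : S) {p : ℕ} {w : List S → List V → Z → ℤ}
    (hw : w ∈ Cc (⊤ : Subgroup G) Set.univ N 1 p) (hw0 : del w = 0) :
    ∃ y ∈ Cc (⊤ : Subgroup G) Set.univ N 0 p, del y = w := by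
  have h1 : ∀ a b, w [b] = w [a] := fun a b => by
    have := congrFun hw0 [a, b]
    simp only [del_cons, del_nil, sub_zero, Pi.zero_apply] at this
    exact sub_eq_zero.1 this
  have hyl : ∀ s : List S, s.length ≠ 0 →
      (match s with | [] => w [ρ] | _ => 0 : List V → Z → ℤ) = 0 := fun s hs => by
    cases s with
    | nil => simp at hs
    | cons a s => rfl
  refine ⟨fun s => match s with | [] => w [ρ] | _ => 0, ⟨fun g hg s v z => ?_, fun s v => ?_, hyl,
    fun s v hv => ?_⟩, ?_⟩
  · cases s with
    | nil =>
      change w [ρ] (sm g v) (g • z) = w [ρ] v z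
      rw [← congrFun (h1 ρ (g • ρ)) (sm g v)]
      exact hw.1 g hg [ρ] v z
    | cons a s => rfl
  · cases s with
    | nil => exact hw.2.1 _ _
    | cons a s => exact zero_mem _
  · cases s with
    | nil => exact hw.2.2.2 _ _ hv
    | cons a s => rfl
  · funext s
    match s with
    | [] => exact (hw.2.2.1 [] (by simp)).symm
    | [a] =>
      simp only [del_cons, del_nil, sub_zero]
      exact h1 a ρ
    | a :: b :: t =>
      rw [hw.2.2.1 (a :: b :: t) (by simp)]
      exact del_eq_zero fun t' _ ht' => hyl t' (by rw [List.length_cons, List.length_cons] at ht'; omega)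

lemma lift_null (hF : ∀ g, ∀ v : V, g • v = v ↔ g ∈ F) (hN : Stable G N) {j p : ℕ}
    (h : ∀ c ∈ Co (S := S) F N (j + 1), del c = 0 → Null F N j c) {w : List S → List V → Z → ℤ}
    (hw : w ∈ Cc (⊤ : Subgroup G) Set.univ N (j + 1) (p + 1)) (hw0 : del w = 0) :
    ∃ y ∈ Cc (⊤ : Subgroup G) Set.univ N j (p + 1), del y = w := by
  obtain ⟨b, hb, -, hbw⟩ := exists_dS_lift faceClosed_univ hN (fun _ _ _ _ => Set.mem_univ _) hw
    fun v _ hv => by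
      have hv' : v ≠ [] := by rintro rfl; simp at hv
      refine ⟨1, trivial, v, (one_sm v).symm, ?_⟩
      have := Cc_at hw v
      rw [Stab_top_cons hF hv'] at this ⊢
      refine h _ this ?_
      rw [del_at, hw0]; rfl
  exact ⟨b, hb, hbw⟩

/-- Equivariant families of homomorphisms from `F` to `N`, indexed by words of length `p`. -/
def IsHomC (F : Subgroup G) (N : AddSubgroup (Z → ℤ)) (p : ℕ) (Λ : List V → G → Z → ℤ) : Prop :=
  (∀ g v, ∀ f ∈ F, ∀ z, Λ (sm g v) (g * f * g⁻¹) (g • z) = Λ v f z) ∧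
  (∀ v, ∀ f ∈ F, ∀ f' ∈ F, Λ v (f * f') = Λ v f + Λ v f') ∧
  (∀ v, ∀ f ∈ F, Λ v f ∈ N) ∧ ∀ v, v.length ≠ p → ∀ f ∈ F, Λ v f = 0

variable (V) in
/-- Vanishing of the cohomology with coefficients in homomorphisms from `F` to `N`. -/
def VanHom (F : Subgroup G) (N : AddSubgroup (Z → ℤ)) (p : ℕ) : Prop :=
  ∀ Λ : List V → G → Z → ℤ, IsHomC F N (p + 1) Λ →
    (∀ f ∈ F, del (fun v => Λ v f) = 0) → ∃ Λ' : List V → G → Z → ℤ, IsHomC F N p Λ' ∧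
      (p = 0 → ∀ v, ∀ f ∈ F, Λ' v f = 0) ∧ ∀ f ∈ F, del (fun v => Λ' v f) = fun v => Λ v f

lemma closed_triple {M : Type*} [AddCommGroup M] {c : List S → M} (hc0 : del c = 0) (x y z : S) :
    c [x, y] + c [y, z] = c [x, z] := by
  have h1 := congrFun hc0 [x, y, z]
  simp only [del_cons, del_nil, sub_zero, Pi.zero_apply] at h1
  have : c [x, y] + c [y, z] - c [x, z] = 0 := by rw [← h1]; abel
  exact sub_eq_zero.1 this

lemma values_indep (hFZ : ∀ g ∈ F, ∀ f ∈ N, ∀ z, f (g • z) = f z) {c : List S → Z → ℤ}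
    (hc : c ∈ Co F N 2) (hc0 : del c = 0) {f : G} (hf : f ∈ F) (s t : S) :
    c [s, f • s] = c [t, f • t] := by
  have h1 := closed_triple hc0 s t (f • t)
  have h2 := closed_triple hc0 s (f • s) (f • t)
  have h3 : c [f • s, f • t] = c [s, t] := Co_inv hFZ hc hf [s, t]
  rw [h3, ← h1, add_comm] at h2
  exact add_left_cancel h2

lemma lift_one [F.Normal] [IsFreeGroup F] (ρ : S)
    (hfree : ∀ g ∈ F, ∀ s : S, g • s = s → g = 1) (hF : ∀ g, ∀ v : V, g • v = v ↔ g ∈ F)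
    (hFZ : ∀ g ∈ F, ∀ f ∈ N, ∀ z, f (g • z) = f z) (hN : Stable G N) {p : ℕ}
    (hV : VanHom V F N p) {w : List S → List V → Z → ℤ}
    (hw : w ∈ Cc (⊤ : Subgroup G) Set.univ N 2 (p + 1)) (hw0 : del w = 0)
    (hb : ∃ b ∈ Cc (⊤ : Subgroup G) Set.univ N 1 (p + 2), (hs G S V N).dX w = del b) :
    ∃ z ∈ Cc (⊤ : Subgroup G) Set.univ N 2 p, del z = 0 ∧ (p = 0 → z = 0) ∧
      ∃ y ∈ Cc (⊤ : Subgroup G) Set.univ N 1 (p + 1), w = (hs G S V N).dX z + del y := by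
  have hconj : ∀ (g : G) {f}, f ∈ F → g * f * g⁻¹ ∈ F := fun g f hf =>
    Subgroup.Normal.conj_mem inferInstance f hf g
  have hFv : ∀ f ∈ F, ∀ v : List V, sm f v = v := fun f hf v => by
    cases v with
    | nil => rfl
    | cons a v =>
      have : f ∈ Stab (⊤ : Subgroup G) (a :: v) := by
        rw [Stab_top_cons hF (List.cons_ne_nil a v)]; exact hf
      exact this.2
  have hwC : ∀ v : List V, v.length = p + 1 → (fun s => w s v) ∈ Co F N 2 := fun v hv => by
    have := Cc_at hw v
    rwa [Stab_top_cons hF (by rintro rfl; simp at hv)] at this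
  have hwC0 : ∀ v : List V, del (fun s => w s v) = 0 := fun v => by rw [del_at, hw0]; rfl
  have hind : ∀ v, ∀ f ∈ F, ∀ s t, w [s, f • s] v = w [t, f • t] v := fun v f hf s t => by
    by_cases hv : v.length = p + 1
    · exact values_indep hFZ (hwC v hv) (hwC0 v) hf s t
    · rw [hw.2.2.2 _ _ (Or.inr hv), hw.2.2.2 _ _ (Or.inr hv)]
  have hinv : ∀ v, ∀ f ∈ F, ∀ s, w (sm f s) v = w s v := fun v f hf s => by
    by_cases hv : v.length = p + 1
    · exact Co_inv hFZ (hwC v hv) hf s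
    · rw [hw.2.2.2 _ _ (Or.inr hv), hw.2.2.2 _ _ (Or.inr hv)]
  obtain ⟨Λ', hΛ', hp0, hdΛ⟩ := hV (fun v f => w [ρ, f • ρ] v) ⟨fun g v f hf z => by
      have h1 := congrFun (hind (sm g v) _ (hconj g hf) ρ (g • ρ)) (g • z)
      beta_reduce
      rw [h1]
      have h2 : (g * f * g⁻¹) • g • ρ = g • f • ρ := by
        rw [← mul_smul, inv_mul_cancel_right, mul_smul]
      rw [h2]
      exact hw.1 g trivial [ρ, f • ρ] v z,
    fun v f hf f' hf' => by
      have h1 := closed_triple (hwC0 v) ρ (f • ρ) (f • f' • ρ)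
      have h2 := hinv v f hf [ρ, f' • ρ]
      beta_reduce at h1 ⊢
      rw [mul_smul, ← h1]
      exact congrArg _ h2,
    fun v f _ => hw.2.1 _ _, fun v hv f _ => hw.2.2.2 _ _ (Or.inr hv)⟩
    (fun f hf => by
      obtain ⟨b, hb, hwb⟩ := hb
      have := congrFun hwb [ρ, f • ρ]
      rw [hs_dX] at this
      refine this.trans ?_
      simp only [del_cons, del_nil, sub_zero]
      funext v z
      have h1 := hb.1 f trivial [ρ] v (f⁻¹ • (f • z))
      rw [hFv f hf, smul_inv_smul] at h1
      have h2 := hFZ f⁻¹ (inv_mem hf) _ (hb.2.1 [ρ] v) (f • z)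
      rw [inv_smul_smul] at h2
      simp only [Pi.sub_apply, Pi.zero_apply]
      have h3 := hFZ f hf _ (hb.2.1 (sm f [ρ]) v) z
      have h4 := hb.1 f trivial [ρ] v z
      rw [hFv f hf] at h4
      have h5 : b [f • ρ] v z = b [ρ] v z := h3.symm.trans h4
      rw [h5, sub_self])
  have hz : ∃ z ∈ Cc (⊤ : Subgroup G) Set.univ N 2 p, del z = 0 ∧ (p = 0 → z = 0) ∧
      ∀ f ∈ F, ∀ s : S, ∀ v : List V, v.length = p → z [s, f • s] v = Λ' v f := by
    by_cases hp : p = 0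
    · exact ⟨0, zero_mem _, map_zero _, fun _ => rfl, fun f hf s v _ => (hp0 hp v f hf).symm⟩
    obtain ⟨z, hz, hQ⟩ := exists_Cc (K := (⊤ : Subgroup G)) (X := (Set.univ : Set (List V)))
      (fun _ _ _ _ => Set.mem_univ _) hN 2 p
      (fun v (c : List S → Z → ℤ) => del c = 0 ∧ ∀ f ∈ F, ∀ s : S, c [s, f • s] = Λ' v f)
      (fun g _ v c hc => ⟨by rw [del_tr, hc.1]; rfl, fun f hf s => by
        funext z
        have hf' : g⁻¹ * f * g ∈ F := by simpa using hconj g⁻¹ hf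
        have h1 := hc.2 (g⁻¹ * f * g) hf' (g⁻¹ • s)
        have h2 : (g⁻¹ * f * g) • g⁻¹ • s = g⁻¹ • f • s := by
          rw [← mul_smul, mul_inv_cancel_right, mul_smul]
        rw [h2] at h1
        have h3 := hΛ'.1 g v (g⁻¹ * f * g) hf' (g⁻¹ • z)
        have h4 : g * (g⁻¹ * f * g) * g⁻¹ = f := by group
        rw [h4, smul_inv_smul] at h3
        rw [h3]
        exact congrFun h1 _⟩)
      (fun v _ hv => by
        refine ⟨1, trivial, v, (one_sm v).symm, ?_⟩
        rw [Stab_top_cons hF (by rintro rfl; exact hp (by simpa using hv.symm))]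
        obtain ⟨c, hc, h0, h1⟩ := exists_of_values hfree hFZ (Λ' v) (hΛ'.2.1 v) (hΛ'.2.2.1 v)
        exact ⟨c, hc, h0, h1⟩)
    refine ⟨z, hz, ?_, fun h => (hp h).elim, fun f hf s v hv => (hQ v trivial hv).2 f hf s⟩
    funext s v
    by_cases hv : v.length = p
    · have := congrFun (hQ v trivial hv).1 s
      rwa [del_at] at this
    · exact ((hs G S V N).dS_mem hz).2.2.2 s v (Or.inr hv)
  obtain ⟨z, hz, hz0, hzp, hzv⟩ := hz
  refine ⟨z, hz, hz0, hzp, ?_⟩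
  have hu : w - (hs G S V N).dX z ∈ Cc (⊤ : Subgroup G) Set.univ N 2 (p + 1) :=
    sub_mem hw ((hs G S V N).dX_mem hz)
  have hu0 : del (w - (hs G S V N).dX z) = 0 := by
    have h1 : del ((hs G S V N).dX z) = (hs G S V N).dX (del z) := (hs G S V N).comm z
    rw [map_sub, hw0, h1, hz0, map_zero, sub_zero]
  obtain ⟨y, hy, -, hyu⟩ := exists_dS_lift faceClosed_univ hN (fun _ _ _ _ => Set.mem_univ _) hu
    fun v _ hv => by
      refine ⟨1, trivial, v, (one_sm v).symm, ?_⟩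
      have h1 := Cc_at hu v
      rw [Stab_top_cons hF (by rintro rfl; simp at hv)] at h1 ⊢
      refine null_of_values hFZ ρ h1 (by rw [del_at, hu0]; rfl) fun f hf s => ?_
      change w [s, f • s] v - (hs G S V N).dX z [s, f • s] v = 0
      rw [hs_dX, sub_eq_zero, hind v f hf s ρ]
      refine (congrFun (hdΛ f hf) v).symm.trans (del_congr fun t _ ht => ?_)
      exact (hzv f hf s t (by omega)).symm
  exact ⟨y, hy, by rw [hyu]; abel⟩

end HS

end WordCx

namespace WordCx

open scoped Pointwise

section HS

variable {G S V Z : Type*} [Group G] [MulAction G S] [MulAction G V] [MulAction G Z]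
  {F : Subgroup G} {N : AddSubgroup (Z → ℤ)}

lemma hs_injS (ρ : S) {k : ℕ} (x : List S → List V → Z → ℤ)
    (hx : x ∈ (hs G S V N).D 0 k) (hx0 : (hs G S V N).dS x = 0) : x = 0 := by
  change x ∈ Cc (⊤ : Subgroup G) Set.univ N 0 k at hx
  funext s
  cases s with
  | nil =>
    have h1 : del x [ρ] = 0 := congrFun hx0 [ρ]
    rwa [del_cons, del_nil, sub_zero] at h1
  | cons a s => exact hx.2.2.1 _ (by simp)

lemma hs_descend [F.Normal] [IsFreeGroup F] (ρ : S)
    (hfree : ∀ g : G, ∀ s : S, g • s = s → g = 1) (hF : ∀ g, ∀ v : V, g • v = v ↔ g ∈ F)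
    (hFZ : ∀ g ∈ F, ∀ f ∈ N, ∀ z, f (g • z) = f z) (hN : Stable G N) {a b : ℕ}
    (hV : a = 1 → VanHom V F N b) : (hs G S V N).Descend a b := by
  intro x hx _ hdx
  have hw := (hs G S V N).dX_mem hx
  match a, hV with
  | 0, _ =>
    obtain ⟨y, hy, e⟩ := lift_zero ρ hw hdx
    exact ⟨0, zero_mem _, map_zero _, fun _ => rfl, y, hy, by rw [map_zero, zero_add]; exact e.symm⟩
  | 1, hV =>
    exact lift_one ρ (fun g _ => hfree g) hF hFZ hN (hV rfl) hw hdx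
      ⟨0, zero_mem _, by rw [(hs G S V N).dX_dX, map_zero]⟩
  | k + 2, _ =>
    obtain ⟨y, hy, e⟩ := lift_null hF hN (fun c hc hc0 => null_free (fun g _ => hfree g) hFZ ρ hc hc0)
      hw hdx
    exact ⟨0, zero_mem _, map_zero _, fun _ => rfl, y, hy, by rw [map_zero, zero_add]; exact e.symm⟩

lemma hs_E2 [F.Normal] [IsFreeGroup F] (ρ : S)
    (hfree : ∀ g : G, ∀ s : S, g • s = s → g = 1) (hF : ∀ g, ∀ v : V, g • v = v ↔ g ∈ F)
    (hFZ : ∀ g ∈ F, ∀ f ∈ N, ∀ z, f (g • z) = f z) (hN : Stable G N) {a b : ℕ}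
    (hV : a = 1 → VanHom V F N b) : (hs G S V N).E2 a b := by
  intro w hw hw0 hb
  match a, hV with
  | 0, _ =>
    obtain ⟨y, hy, e⟩ := lift_zero ρ hw hw0
    exact ⟨0, zero_mem _, map_zero _, y, hy, by rw [map_zero, zero_add]; exact e.symm⟩
  | 1, hV =>
    obtain ⟨z, hz, hz0, -, h⟩ := lift_one ρ (fun g _ => hfree g) hF hFZ hN (hV rfl) hw hw0 hb
    exact ⟨z, hz, hz0, h⟩
  | k + 2, _ =>
    obtain ⟨y, hy, e⟩ := lift_null hF hN (fun c hc hc0 => null_free (fun g _ => hfree g) hFZ ρ hc hc0)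
      hw hw0
    exact ⟨0, zero_mem _, map_zero _, y, hy, by rw [map_zero, zero_add]; exact e.symm⟩

lemma hs_E2_of_acyclic (ρ : S) (hF : ∀ g, ∀ v : V, g • v = v ↔ g ∈ F) (hN : Stable G N) {a b : ℕ}
    (h : ∀ k, a = k + 1 → ∀ c ∈ Co (S := S) F N (k + 2), del c = 0 → Null F N (k + 1) c) :
    (hs G S V N).E2 a b := by
  intro w hw hw0 _
  have : ∃ y ∈ Cc (⊤ : Subgroup G) Set.univ N a (b + 1), del y = w := by
    cases a with
    | zero => exact lift_zero ρ hw hw0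
    | succ k => exact lift_null hF hN (h k rfl) hw hw0
  obtain ⟨y, hy, e⟩ := this
  exact ⟨0, zero_mem _, map_zero _, y, hy, by rw [map_zero, zero_add]; exact e.symm⟩

lemma hs_flip_boundary [Nonempty V] (hfree : ∀ g : G, ∀ s : S, g • s = s → g = 1) {k : ℕ}
    {n l : List S → List V → Z → ℤ} (hL : (hs G S V N).Link (k + 1) n l)
    (hn : ∃ m ∈ (hs G S V N).D 0 k, (hs G S V N).dX m = n) :
    ∃ m ∈ (hs G S V N).D k 0, (hs G S V N).dS m = l := by
  refine (hs G S V N).flip.link_boundary (fun a b _ => ?_) ?_ (DoubleCx.link_flip _ hL) hn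
  · intro y hy hy0 _
    obtain ⟨z, hz, hzy⟩ := hs_exX hfree b a y hy hy0
    refine ⟨0, zero_mem _, map_zero _, z, hz, ?_⟩
    rw [map_zero, zero_add]
    exact hzy.symm
  · exact injX_dbl (hX := faceClosed_univ) (hK := fun _ _ _ _ => Set.mem_univ _) (Classical.arbitrary V) (Set.mem_univ _) (k + 1)

lemma hs_null [Nonempty V] (hfree : ∀ g : G, ∀ s : S, g • s = s → g = 1) {k : ℕ}
    {n : List S → List V → Z → ℤ} {l : List S → Z → ℤ} (hL : (hs G S V N).Link (k + 2) n (edge l))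
    (hn : ∃ m ∈ (hs G S V N).D 0 (k + 1), (hs G S V N).dX m = n) :
    Null (⊤ : Subgroup G) N (k + 1) l := by
  obtain ⟨m, hm, e⟩ := hs_flip_boundary hfree hL hn
  refine ⟨fun s => m s [], at_nil_mem hm, fun h => by omega, ?_⟩
  rw [del_at]
  funext s
  have h2 : del m s = edge l s := congrFun e s
  rw [h2, edge_nil]

section Comp

variable {Z' : Type*} [MulAction G Z'] {N' : AddSubgroup (Z' → ℤ)}

lemma hs_link_comp (η : Z' → Z) (hη : ∀ (g : G) z, η (g • z) = g • η z)
    (hN : ∀ f ∈ N, f ∘ η ∈ N') {k : ℕ} {n l : List S → List V → Z → ℤ}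
    (hL : (hs G S V N).Link k n l) :
    (hs G S V N').Link k (fun s v => n s v ∘ η) (fun s v => l s v ∘ η) := by
  obtain ⟨e, h1, h2, rfl, rfl⟩ := hL
  refine ⟨fun j s v => e j s v ∘ η, fun j p hjp => ?_, fun j hj => ?_, rfl, rfl⟩
  · have h := h1 j p hjp
    change _ ∈ Cc (⊤ : Subgroup G) Set.univ N j p at h
    refine ⟨fun g hg s v z => ?_, fun s v => hN _ (h.2.1 s v), fun s hs => ?_, fun s v hv => ?_⟩
    · change e j (sm g s) (sm g v) (η (g • z)) = _
      rw [hη]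
      exact h.1 g hg s v _
    · funext v
      change e j s v ∘ η = 0
      rw [h.2.2.1 s hs]; rfl
    · change e j s v ∘ η = 0
      rw [h.2.2.2 s v hv]; rfl
  · let φ : (Z → ℤ) →+ (Z' → ℤ) := ⟨⟨fun f => f ∘ η, rfl⟩, fun _ _ => rfl⟩
    let Φ : (List V → Z → ℤ) →+ (List V → Z' → ℤ) := ⟨⟨fun f v => f v ∘ η, rfl⟩, fun _ _ => rfl⟩
    have h3 : del (fun s => Φ (e j s)) = fun s => Φ (del (e j) s) := del_comp Φ (e j)
    change del (fun s => Φ (e j s)) = (hs G S V N').dX (fun s => Φ (e (j + 1) s))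
    have h2' : del (e j) = (hs G S V N).dX (e (j + 1)) := h2 j hj
    rw [h3, h2']
    funext s
    have h4 : del (fun v => φ (e (j + 1) s v)) = fun v => φ (del (e (j + 1) s) v) :=
      del_comp φ (e (j + 1) s)
    have h5 : (hs G S V N').dX (fun s => Φ (e (j + 1) s)) s = fun v => φ (del (e (j + 1) s) v) :=
      (hs_dX _ _).trans h4
    refine Eq.trans ?_ h5.symm
    funext v
    change φ ((hs G S V N).dX (e (j + 1)) s v) = _
    rw [hs_dX]

end Comp

end HS

section Diff

variable {G S Y Z : Type*} [Group G] [MulAction G S] [MulAction G Y] [MulAction G Z]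
  {F : Subgroup G} {N : AddSubgroup (Z → ℤ)}

variable (Y N) in
/-- Differences of functions on `Y` with values in `N`. -/
def Diff : AddSubgroup (Y × Y × Z → ℤ) where
  carrier := {f | (∀ y₁ y₂, (fun z => f (y₁, y₂, z)) ∈ N) ∧
    ∀ y₁ y₂ y₃ z, f (y₁, y₂, z) + f (y₂, y₃, z) = f (y₁, y₃, z)}
  zero_mem' := ⟨fun _ _ => zero_mem N, fun _ _ _ _ => rfl⟩
  add_mem' hf hg := ⟨fun y₁ y₂ => add_mem (hf.1 y₁ y₂) (hg.1 y₁ y₂), fun y₁ y₂ y₃ _ => by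
    simp only [Pi.add_apply]
    rw [← hf.2 y₁ y₂ y₃, ← hg.2 y₁ y₂ y₃]; abel⟩
  neg_mem' hf := ⟨fun y₁ y₂ => neg_mem (hf.1 y₁ y₂), fun y₁ y₂ y₃ _ => by
    simp only [Pi.neg_apply]
    rw [← hf.2 y₁ y₂ y₃]; abel⟩

lemma Diff_stable (hN : Stable G N) : Stable G (Diff Y N) := fun g _ hf =>
  ⟨fun y₁ y₂ => hN g _ (hf.1 (g • y₁) (g • y₂)), fun _ _ _ _ => hf.2 _ _ _ _⟩

lemma del_eval {Z' : Type*} (η : Z' → Z) (c : List S → Z → ℤ) (s : List S) (z : Z') :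
    del (fun t => c t ∘ η) s z = del c s (η z) :=
  congrFun (congrFun (del_precomp η c) s) z

lemma del_pt {W : Type*} (c : List S → W → ℤ) (s : List S) (w : W) :
    del c s w = del (fun t => c t w) s :=
  (congrFun (del_comp (⟨⟨fun f => f w, rfl⟩, fun _ _ => rfl⟩ : (W → ℤ) →+ ℤ) c) s).symm

/-- The functions on a free `F`-set modulo constants are acyclic for a free group `F`. -/
lemma null_diff [IsFreeGroup F] (ρ : S) (hfree : ∀ g ∈ F, ∀ s : S, g • s = s → g = 1)
    (hFZ : ∀ g ∈ F, ∀ z : Z, g • z = z)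
    (ε : S → Y) (hε : ∀ g ∈ F, ∀ s, ε (g • s) = g • ε s)
    (τ : Y → S) (hτ : ∀ g ∈ F, ∀ y, τ (g • y) = g • τ y) {k : ℕ} {y : List S → Y × Y × Z → ℤ}
    (hy : y ∈ Co F (Diff Y N) (k + 2)) (hy0 : del y = 0) : Null F (Diff Y N) (k + 1) y := by
  let C : List S → Y × Z → ℤ
    | [], _ => 0
    | a :: s, w => y (a :: s) (ε a, w.1, w.2)
  let E : List S → Z → ℤ
    | a :: b :: s, z => - y (b :: s) (ε a, ε b, z)
    | _, _ => 0
  have hCE : ∀ s w, del C s w = E s w.2 := by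
    rintro s ⟨η, z⟩
    have hCcons : ∀ a, (fun t => C (a :: t) (η, z)) = fun t => y (a :: t) (ε a, η, z) := fun a => rfl
    match s with
    | [] => rfl
    | [a] =>
      rw [del_pt, del_cons, del_nil, sub_zero]
    | a :: b :: t =>
      rw [del_pt, del_cons, hCcons]
      have h1 : del (fun t => y (a :: t) (ε a, η, z)) (b :: t) = y (b :: t) (ε a, η, z) := by
        have h2 := congrFun (congrFun hy0 (a :: b :: t)) (ε a, η, z)
        rw [del_pt, del_cons] at h2
        exact (sub_eq_zero.1 h2).symm
      rw [h1]
      have h3 := (hy.2.1 (b :: t)).2 (ε a) (ε b) η z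
      change y (b :: t) (ε b, η, z) - y (b :: t) (ε a, η, z) = - y (b :: t) (ε a, ε b, z)
      rw [← h3]; ring
  have hCl : ∀ s, s.length ≠ k + 2 → C s = 0 := fun s hs => by
    funext w
    cases s with
    | nil => rfl
    | cons a s => exact congrFun (hy.2.2 _ hs) _
  have hEC : E ∈ Co F N (k + 3) := by
    refine ⟨fun g hg s z => ?_, fun s => ?_, fun s hs => ?_⟩
    · match s with
      | [] => rfl
      | [a] => rfl
      | a :: b :: t =>
        change - y (sm g (b :: t)) (ε (g • a), ε (g • b), g • z) = - y (b :: t) (ε a, ε b, z)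
        rw [hε g hg, hε g hg]
        exact congrArg _ (hy.1 g hg (b :: t) (ε a, ε b, z))
    · match s with
      | [] => exact zero_mem _
      | [a] => exact zero_mem _
      | a :: b :: t => exact neg_mem ((hy.2.1 (b :: t)).1 (ε a) (ε b))
    · match s with
      | [] => rfl
      | [a] => rfl
      | a :: b :: t =>
        funext z
        change - y (b :: t) _ = 0
        rw [hy.2.2 _ (by simpa using hs)]; rfl
  have hE0 : del E = 0 := by
    funext s z
    have h1 : del (fun t => E t ∘ (Prod.snd : Y × Z → Z)) s (ε ρ, z) = del E s z :=
      del_eval Prod.snd E s (ε ρ, z)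
    have h2 : (fun t => E t ∘ (Prod.snd : Y × Z → Z)) = del C := by
      funext t w; exact (hCE t w).symm
    rw [← h1, h2, del_del]; rfl
  obtain ⟨l, hl, -, hlE⟩ := null_free hfree (fun g hg f _ z => by rw [hFZ g hg]) ρ hEC hE0
  let B : List S → Y × Z → ℤ := fun s w => C s w - l s w.2
  have hB0 : ∀ w, del (fun s => B s w) = 0 := fun w => by
    have : (fun s => B s w) = (fun s => C s w) - fun s => l s w.2 := rfl
    funext s
    rw [this, map_sub, Pi.sub_apply, ← del_pt C, ← del_pt l, hCE, hlE, sub_self]; rfl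
  have hBg : ∀ g ∈ F, ∀ s w, B (sm g s) (g • w) = B s w := by
    rintro g hg s ⟨η, z⟩
    change C (sm g s) (g • η, g • z) - l (sm g s) (g • z) = C s (η, z) - l s z
    rw [hl.1 g hg]
    congr 1
    cases s with
    | nil => rfl
    | cons a t =>
      change y (sm g (a :: t)) (ε (g • a), g • η, g • z) = y (a :: t) (ε a, η, z)
      rw [hε g hg]
      exact hy.1 g hg (a :: t) (ε a, η, z)
  have hBN : ∀ s η, (fun z => B s (η, z)) ∈ N := fun s η => by
    refine sub_mem (?_ : (fun z => C s (η, z)) ∈ N) (hl.2.1 s)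
    cases s with
    | nil => exact zero_mem _
    | cons a t => exact (hy.2.1 (a :: t)).1 (ε a) η
  have hBl : ∀ s, s.length ≠ k + 2 → ∀ w, B s w = 0 := fun s hs w => by
    change C s w - l s w.2 = 0
    rw [hCl s hs, hl.2.2 s hs]; rfl
  let b : List S → Y × Y × Z → ℤ := fun s q =>
    B (τ q.2.1 :: s) (q.2.1, q.2.2) - B (τ q.1 :: s) (q.1, q.2.2)
  refine ⟨b, ⟨fun g hg s q => ?_, fun s => ⟨fun y₁ y₂ => ?_, fun y₁ y₂ y₃ z => ?_⟩, fun s hs => ?_⟩,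
    fun h => by omega, ?_⟩
  · obtain ⟨y₁, y₂, z⟩ := q
    change B (τ (g • y₂) :: sm g s) (g • (y₂, z)) - B (τ (g • y₁) :: sm g s) (g • (y₁, z)) =
      B (τ y₂ :: s) (y₂, z) - B (τ y₁ :: s) (y₁, z)
    rw [hτ g hg, hτ g hg, ← sm_cons, ← sm_cons, hBg g hg, hBg g hg]
  · exact sub_mem (hBN (τ y₂ :: s) y₂) (hBN (τ y₁ :: s) y₁)
  · simp only [b]; ring
  · funext q
    have h (η : Y) : B (τ η :: s) (η, q.2.2) = 0 :=
      hBl (τ η :: s) (by simpa using hs) _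
    change B (τ q.2.1 :: s) (q.2.1, q.2.2) - B (τ q.1 :: s) (q.1, q.2.2) = 0
    rw [h, h, sub_zero]
  · funext s q
    obtain ⟨y₁, y₂, z⟩ := q
    have h1 : ∀ η, del (fun t => B (τ η :: t) (η, z)) = fun s => B s (η, z) := fun η =>
      del_cone_eq (hB0 (η, z)) (τ η)
    have h2 : (fun t => b t (y₁, y₂, z)) = (fun t => B (τ y₂ :: t) (y₂, z)) -
      fun t => B (τ y₁ :: t) (y₁, z) := rfl
    rw [del_pt, h2, map_sub, h1, h1]
    change (C s (y₂, z) - l s z) - (C s (y₁, z) - l s z) = _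
    rw [sub_sub_sub_cancel_right]
    cases s with
    | nil => exact (congrFun (hy.2.2 [] (by simp)) _).symm
    | cons a t =>
      have h3 := (hy.2.1 (a :: t)).2 (ε a) y₁ y₂ z
      change y (a :: t) (ε a, y₂, z) - y (a :: t) (ε a, y₁, z) = _
      rw [← h3]; ring

/-- A difference of two pullbacks of a coboundary is a coboundary. -/
lemma Null.diff {K : Subgroup G} {Z' : Type*} [MulAction G Z'] {N₁ : AddSubgroup (Z → ℤ)}
    {N' : AddSubgroup (Z' → ℤ)} (η₁ η₂ : Z' → Z) (h₁ : ∀ g ∈ K, ∀ z, η₁ (g • z) = g • η₁ z)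
    (h₂ : ∀ g ∈ K, ∀ z, η₂ (g • z) = g • η₂ z) (hN : ∀ f ∈ N₁, f ∘ η₁ - f ∘ η₂ ∈ N') {i : ℕ}
    {c : List S → Z → ℤ} (hc : Null K N₁ i c) :
    Null K N' i (fun s => c s ∘ η₁ - c s ∘ η₂) := by
  obtain ⟨b, hb, hb0, rfl⟩ := hc
  refine ⟨fun s => b s ∘ η₁ - b s ∘ η₂, ⟨fun g hg s z => ?_, fun s => hN _ (hb.2.1 s), fun s hs => ?_⟩,
    fun h => by rw [hb0 h]; funext s z; rfl, ?_⟩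
  · simp only [Pi.sub_apply, Function.comp_apply]
    rw [h₁ g hg, h₂ g hg, hb.1 g hg, hb.1 g hg]
  · beta_reduce
    rw [hb.2.2 s hs]; funext z; rfl
  · funext s z
    have : (fun s => b s ∘ η₁ - b s ∘ η₂) = (fun s => b s ∘ η₁) - fun s => b s ∘ η₂ := rfl
    rw [this, map_sub]
    simp only [Pi.sub_apply, del_eval, Function.comp_apply]

end Diff

end WordCx

namespace WordCx

open scoped Pointwise

section Pair

variable {n : ℕ} (B : Finset (Fin n)) (a : Fin n)

/-- Pairs of an automorphism of the factor generated by `B` and an extension of it which multiplies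
the generator `a` on the right by an element of this factor. -/
def KP : Subgroup (MulAut (FreeGroup (Fin n)) × MulAut (FreeGroup (Fin n))) where
  carrier := {p | p.1 ∈ GA (insert a B) ∧ p.2 ∈ GA B ∧ (∀ x ∈ FA B, p.1 x = p.2 x) ∧
    (FreeGroup.of a)⁻¹ * p.1 (FreeGroup.of a) ∈ FA B}
  one_mem' := ⟨one_mem _, one_mem _, fun _ _ => rfl, by simp⟩
  mul_mem' {p q} hp hq := by
    refine ⟨mul_mem hp.1 hq.1, mul_mem hp.2.1 hq.2.1, fun x hx => ?_, ?_⟩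
    · change p.1 (q.1 x) = p.2 (q.2 x)
      rw [hq.2.2.1 x hx, hp.2.2.1 _ ((GA_mem subset_rfl hq.2.1).2 hx)]
    · have : (FreeGroup.of a)⁻¹ * (p * q).1 (FreeGroup.of a) =
          (FreeGroup.of a)⁻¹ * p.1 (FreeGroup.of a) *
            p.1 ((FreeGroup.of a)⁻¹ * q.1 (FreeGroup.of a)) := by
        rw [Prod.fst_mul, MulAut.mul_apply, map_mul, map_inv]
        group
      rw [this, hp.2.2.1 _ hq.2.2.2]
      exact mul_mem hp.2.2.2 ((GA_mem subset_rfl hp.2.1).2 hq.2.2.2)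
  inv_mem' {p} hp := by
    have h1 : ∀ x ∈ FA B, p.1⁻¹ x = p.2⁻¹ x := fun x hx => by
      have h2 : p.2⁻¹ x ∈ FA B := (GA_mem subset_rfl (inv_mem hp.2.1)).2 hx
      have h3 := hp.2.2.1 _ h2
      rw [MulAut.apply_inv_self] at h3
      rw [← h3, MulAut.inv_apply_self, h3]
    refine ⟨inv_mem hp.1, inv_mem hp.2.1, h1, ?_⟩
    have h4 : (FreeGroup.of a)⁻¹ * p⁻¹.1 (FreeGroup.of a) =
        (p.1⁻¹ ((FreeGroup.of a)⁻¹ * p.1 (FreeGroup.of a)))⁻¹ := by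
      rw [map_mul, map_inv, MulAut.inv_apply_self, Prod.fst_inv]
      group
    rw [h4, h1 _ hp.2.2.2]
    exact inv_mem ((GA_mem subset_rfl (inv_mem hp.2.1)).2 hp.2.2.2)

variable (n) in
/-- Automorphisms, acted on through the first component. -/
def Fs : Type := MulAut (FreeGroup (Fin n))

variable (n) in
/-- Automorphisms, acted on through the second component. -/
def Sn : Type := MulAut (FreeGroup (Fin n))

variable (n) in
/-- The free group, acted on through the second component. -/
def Wn : Type := FreeGroup (Fin n)

instance : Nonempty (Sn n) := ⟨(1 : MulAut (FreeGroup (Fin n)))⟩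

variable {B a}

instance : MulAction (KP B a) (Fs n) where
  smul p := fun s : MulAut (FreeGroup (Fin n)) => p.1.1 * s
  one_smul := one_mul (M := MulAut (FreeGroup (Fin n)))
  mul_smul p q := mul_assoc p.1.1 q.1.1

instance : MulAction (KP B a) (Sn n) where
  smul p := fun s : MulAut (FreeGroup (Fin n)) => p.1.2 * s
  one_smul := one_mul (M := MulAut (FreeGroup (Fin n)))
  mul_smul p q := mul_assoc p.1.2 q.1.2

instance : MulAction (KP B a) (Wn n) where
  smul p x := p.1.2 (x : FreeGroup (Fin n))
  one_smul _ := rfl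
  mul_smul _ _ _ := rfl

/-- The element by which the generator is multiplied. -/
def wp (p : KP B a) : FA B := ⟨(FreeGroup.of a)⁻¹ * p.1.1 (FreeGroup.of a), p.2.2.2.2⟩

lemma wp_spec (p : KP B a) : p.1.1 (FreeGroup.of a) = FreeGroup.of a * wp p := by
  simp [wp]

lemma wp_mul (p q : KP B a) : (wp (p * q) : FreeGroup (Fin n)) = wp p * p.1.2 (wp q) := by
  rw [← p.2.2.2.1 _ (wp q).2]
  simp [wp, mul_assoc]

lemma wp_one : wp (1 : KP B a) = 1 := Subtype.ext (by simp [wp])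

variable (B) in
/-- The factor generated by `B`, with the affine action of pairs. -/
def Yn (_ : Fin n) : Type := FA B

/-- The affine action. -/
def af (p : KP B a) (y : FA B) : FA B :=
  wp p * ⟨p.1.2 y, (GA_mem subset_rfl p.2.2.1).2 y.2⟩

instance : MulAction (KP B a) (Yn B a) where
  smul := af
  one_smul := fun y : FA B => Subtype.ext <| by
    change (wp (1 : KP B a) : FreeGroup (Fin n)) * y = y
    rw [wp_one, OneMemClass.coe_one, one_mul]
  mul_smul p q := fun y : FA B => Subtype.ext <| by
    change (wp (p * q) : FreeGroup (Fin n)) * p.1.2 (q.1.2 y) = wp p * p.1.2 (wp q * q.1.2 y)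
    rw [wp_mul, map_mul, mul_assoc]

lemma GA_ext {f g : MulAut (FreeGroup (Fin n))} (hf : f ∈ GA (insert a B)) (hg : g ∈ GA (insert a B))
    (h : ∀ x ∈ FA B, f x = g x) (ha : f (FreeGroup.of a) = g (FreeGroup.of a)) : f = g := by
  have : f.toMonoidHom = g.toMonoidHom := by
    ext i
    change f (FreeGroup.of i) = g (FreeGroup.of i)
    by_cases hi : i ∈ insert a B
    · rcases Finset.mem_insert.1 hi with rfl | hi
      · exact ha
      · exact h _ (of_mem_FA hi)
    · rw [GA_fix hf hi, GA_fix hg hi]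
  exact MulEquiv.ext fun x => DFunLike.congr_fun this x

/-- Right multiplication of the generator `a` by an element of the factor generated by `B`. -/
def tw (ha : a ∉ B) (y : FA B) : MulAut (FreeGroup (Fin n)) :=
  tv a 1 ⟨y, FA_mono (fun i hi => by simpa using fun h : i = a => ha (h ▸ hi)) y.2⟩

lemma tw_of (ha : a ∉ B) (y : FA B) : tw ha y (FreeGroup.of a) = FreeGroup.of a * y := by
  rw [tw, tv_apply, tvHom_of_self]; simp

lemma tw_fix (ha : a ∉ B) (y : FA B) {x : FreeGroup (Fin n)} (hx : x ∈ FA B) : tw ha y x = x :=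
  tvHom_eq ha hx

lemma tw_mem (ha : a ∉ B) (y : FA B) : tw ha y ∈ GA (insert a B) :=
  tv_mem (by simp) (one_mem _) (FA_mono (Finset.subset_insert _ _) y.2)

/-- Right multiplications as pairs. -/
def io (ha : a ∉ B) (y : FA B) : KP B a :=
  ⟨(tw ha y, 1), tw_mem ha y, one_mem _, fun _ hx => tw_fix ha y hx, by simp [tw_of]⟩

lemma wp_io (ha : a ∉ B) (y : FA B) : wp (io ha y) = y := Subtype.ext (by
  change (FreeGroup.of a)⁻¹ * tw ha y (FreeGroup.of a) = _
  simp [tw_of])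

variable (B a) in
/-- The kernel of the second projection. -/
def Fk : Subgroup (KP B a) := ((MonoidHom.snd _ _).comp (KP B a).subtype).ker

lemma mem_Fk {p : KP B a} : p ∈ Fk B a ↔ p.1.2 = 1 := Iff.rfl

instance : (Fk B a).Normal := MonoidHom.normal_ker _

lemma io_mem (ha : a ∉ B) (y : FA B) : io ha y ∈ Fk B a := mem_Fk.2 rfl

lemma KP_ext {p q : KP B a} (h : p.1.2 = q.1.2) (hw : wp p = wp q) : p = q := by
  refine Subtype.ext (Prod.ext (GA_ext p.2.1 q.2.1 (fun x hx => ?_) ?_) h)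
  · rw [p.2.2.2.1 x hx, q.2.2.2.1 x hx, h]
  · rw [wp_spec, wp_spec, hw]

lemma io_wp (ha : a ∉ B) {p : KP B a} (hp : p ∈ Fk B a) : io ha (wp p) = p :=
  KP_ext (mem_Fk.1 hp).symm (wp_io ha _)

lemma io_mul (ha : a ∉ B) (x y : FA B) : io ha (x * y) = io ha x * io ha y :=
  KP_ext (mul_one _).symm (Subtype.ext (by rw [wp_mul, wp_io, wp_io, wp_io]; rfl))

lemma io_one (ha : a ∉ B) : io ha 1 = 1 := KP_ext rfl (by rw [wp_io, wp_one])

lemma isFreeGroup_Fk (ha : a ∉ B) : IsFreeGroup (Fk B a) := by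
  let e : FA B ≃* Fk B a :=
    { toFun := fun y => ⟨io ha y, io_mem ha y⟩
      invFun := fun p => wp p.1
      left_inv := fun y => wp_io ha y
      right_inv := fun p => Subtype.ext (io_wp ha p.2)
      map_mul' := fun x y => Subtype.ext (io_mul ha x y) }
  exact IsFreeGroup.ofMulEquiv e

/-- The diagonal embedding. -/
def dg (ha : a ∉ B) {g : MulAut (FreeGroup (Fin n))} (hg : g ∈ GA B) : KP B a :=
  ⟨(g, g), GA_mono (Finset.subset_insert _ _) hg, hg, fun _ _ => rfl, by simp [GA_fix hg ha]⟩

lemma wp_dg (ha : a ∉ B) {g : MulAut (FreeGroup (Fin n))} (hg : g ∈ GA B) : wp (dg ha hg) = 1 :=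
  Subtype.ext (by
    change (FreeGroup.of a)⁻¹ * g (FreeGroup.of a) = _
    simp [GA_fix hg ha])

lemma wp_conj (p : KP B a) {f : KP B a} (hf : f ∈ Fk B a) :
    (wp (p * f * p⁻¹) : FreeGroup (Fin n)) = wp p * p.1.2 (wp f) * (wp p : FreeGroup (Fin n))⁻¹ := by
  have h1 : p.1.2 (wp p⁻¹ : FreeGroup (Fin n)) = (wp p : FreeGroup (Fin n))⁻¹ := by
    have := wp_mul p p⁻¹
    rw [mul_inv_cancel, wp_one] at this
    exact eq_inv_of_mul_eq_one_right this.symm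
  have h2 : (p * f).1.2 = p.1.2 := by
    change p.1.2 * f.1.2 = _
    rw [mem_Fk.1 hf, mul_one]
  rw [wp_mul, wp_mul, h2, h1]

lemma io_conj (ha : a ∉ B) {g : MulAut (FreeGroup (Fin n))} (hg : g ∈ GA B) (y : FA B) :
    dg ha hg * io ha y * (dg ha hg)⁻¹ = io ha ⟨g y, (GA_mem subset_rfl hg).2 y.2⟩ := by
  have h1 := (inferInstance : (Fk B a).Normal).conj_mem _ (io_mem ha y) (dg ha hg)
  rw [← io_wp ha h1]
  congr 1
  refine Subtype.ext ?_
  rw [wp_conj _ (io_mem ha y), wp_dg, wp_io]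
  change 1 * g y * 1⁻¹ = g y
  group

lemma Fs_free (p : KP B a) (s : Fs n) (h : p • s = s) : p = 1 := by
  have h1 : p.1.1 = 1 := (mul_eq_right (M := MulAut (FreeGroup (Fin n)))).1 h
  refine KP_ext ?_ ?_
  · change p.1.2 = 1
    have h2 : ∀ x ∈ FA B, p.1.2 x = x := fun x hx => by rw [← p.2.2.2.1 x hx, h1]; rfl
    refine GA_ext (GA_mono (Finset.subset_insert a B) p.2.2.1) (one_mem _) h2 ?_
    by_cases ha : a ∈ B
    · exact h2 _ (of_mem_FA ha)
    · exact GA_fix p.2.2.1 ha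
  · exact Subtype.ext (by simp [wp, h1])

lemma Sn_fix (p : KP B a) (v : Sn n) : p • v = v ↔ p ∈ Fk B a :=
  mul_eq_right (M := MulAut (FreeGroup (Fin n)))

lemma tw_smul (ha : a ∉ B) (p : KP B a) (y : FA B) :
    p.1.1 * tw ha y = tw ha (af p y) * p.1.2 := by
  refine GA_ext (mul_mem p.2.1 (tw_mem ha _))
    (mul_mem (tw_mem ha _) (GA_mono (Finset.subset_insert a B) p.2.2.1)) (fun x hx => ?_) ?_
  · rw [MulAut.mul_apply, MulAut.mul_apply, tw_fix ha _ hx, p.2.2.2.1 x hx,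
      tw_fix ha _ ((GA_mem subset_rfl p.2.2.1).2 hx)]
  · rw [MulAut.mul_apply, MulAut.mul_apply, tw_of, GA_fix p.2.2.1 ha, tw_of, map_mul, wp_spec,
      p.2.2.2.1 _ y.2]
    exact mul_assoc _ _ _

end Pair

end WordCx

namespace WordCx

open scoped Pointwise

section Pair

variable {n : ℕ} {B : Finset (Fin n)} {a : Fin n} {R : Type} [DecidableEq R]

variable (n R B) in
/-- Multi-additive functions supported on the factor generated by `B`. -/
def NT : AddSubgroup ((R → Wn n) → ℤ) where
  carrier := {f | f ∈ T n R ∧ ∀ h : R → FreeGroup (Fin n), f (pA B h) = f h}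
  zero_mem' := ⟨zero_mem (T n R), fun _ => rfl⟩
  add_mem' hf hg := ⟨add_mem (S := AddSubgroup _) hf.1 hg.1,
    fun h => congrArg₂ (· + ·) (hf.2 h) (hg.2 h)⟩
  neg_mem' hf := ⟨neg_mem (S := AddSubgroup _) hf.1, fun h => congrArg Neg.neg (hf.2 h)⟩

lemma NT_stable : Stable (KP B a) (NT n B R) := fun p f hf =>
  ⟨T_stable p.1.2 f hf.1, fun h => by
    change f (p.1.2 • pA B h) = f (p.1.2 • h)
    rw [← pA_smul p.2.2.1]
    exact hf.2 _⟩

omit [DecidableEq R] in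
lemma pA_idem (h : R → FreeGroup (Fin n)) : pA B (pA B h) = pA B h :=
  funext fun _ => pj_eq_of_mem subset_rfl (pj_mem _ _)

lemma pA_mem_NT {f : (R → FreeGroup (Fin n)) → ℤ} (hf : f ∈ T n R) :
    (fun h : R → Wn n => f (pA B h)) ∈ NT n B R :=
  ⟨T_pA B hf, fun h => congrArg f (pA_idem h)⟩

/-- The tuple with an extra slot. -/
def oc {α : Type} (x : α) (h : R → α) : Option R → α := fun o => o.elim x h

omit [DecidableEq R] in
lemma smul_oc (g : MulAut (FreeGroup (Fin n))) (x : FreeGroup (Fin n)) (h : R → FreeGroup (Fin n)) :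
    g • oc x h = oc (g x) (g • h) := by
  funext o; cases o <;> rfl

lemma oc_update_none {α : Type} (x : α) (h : R → α) (y : α) :
    Function.update (oc x h) none y = oc y h := by
  funext o; cases o <;> simp [oc]

lemma oc_update_some {α : Type} (x : α) (h : R → α) (r : R) (y : α) :
    Function.update (oc x h) (some r) y = oc x (Function.update h r y) := by
  funext o
  cases o with
  | none => simp [oc]
  | some s => by_cases e : s = r <;> simp [oc, e]

omit [DecidableEq R] in
lemma oc_eta {α : Type} (h : Option R → α) : oc (h none) (h ∘ some) = h := by
  funext o; cases o <;> rfl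

lemma T_oc_mul {f : (Option R → FreeGroup (Fin n)) → ℤ} (hf : f ∈ T n (Option R))
    (x y : FreeGroup (Fin n)) (h : R → FreeGroup (Fin n)) :
    f (oc (x * y) h) = f (oc x h) + f (oc y h) := by
  have := hf (oc 1 h) none x y
  simpa only [oc_update_none] using this

lemma T_oc {f : (Option R → FreeGroup (Fin n)) → ℤ} (hf : f ∈ T n (Option R))
    (x : FreeGroup (Fin n)) : (fun h => f (oc x h)) ∈ T n R := fun h r y z => by
  have := hf (oc x h) (some r) y z
  simpa only [oc_update_some] using this

lemma T_oc_conj {f : (Option R → FreeGroup (Fin n)) → ℤ} (hf : f ∈ T n (Option R))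
    (x y : FreeGroup (Fin n)) (h : R → FreeGroup (Fin n)) :
    f (oc (x * y * x⁻¹) h) = f (oc y h) := by
  have h1 := T_oc_mul hf x⁻¹ (x * y) h
  have h2 := T_oc_mul hf (x * y) x⁻¹ h
  rw [inv_mul_cancel_left] at h1
  omega

lemma mem_T_oc {f : (Option R → FreeGroup (Fin n)) → ℤ}
    (h1 : ∀ x y h, f (oc (x * y) h) = f (oc x h) + f (oc y h))
    (h2 : ∀ x, (fun h => f (oc x h)) ∈ T n R) : f ∈ T n (Option R) := fun h o x y => by
  rw [← oc_eta h]
  cases o with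
  | none => simpa only [oc_update_none] using h1 x y _
  | some r => simpa only [oc_update_some] using h2 (h none) (h ∘ some) r x y

lemma vanHom_pair [Fintype R] (ha : a ∉ B) {p : ℕ} (hV : Van n (Option R) p)
    (hB : 2 * p + Fintype.card R + 3 ≤ B.card) : VanHom (Sn n) (Fk B a) (NT n B R) p := by
  intro Λ hΛ hΛ0
  obtain ⟨hΛg, hΛm, hΛN, hΛl⟩ := hΛ
  let w : FreeGroup (Fin n) → FA B := fun x => ⟨pj B x, pj_mem B x⟩
  have hw1 : ∀ x y, w (x * y) = w x * w y := fun x y => Subtype.ext (map_mul _ _ _)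
  have hΛ1 : ∀ v, Λ v 1 = 0 := fun v => by
    have := hΛm v 1 (one_mem _) 1 (one_mem _)
    rwa [mul_one, left_eq_add] at this
  let c : Cn n (Option R) := fun v h => Λ v (io ha (w (h none))) (h ∘ some)
  have hc : c ∈ Co (GA B) (T n (Option R)) (p + 1) := by
    refine ⟨fun g hg v h => ?_, fun v => ?_, fun v hv => ?_⟩
    · have h1 := hΛg (dg ha hg) v (io ha (w (h none))) (io_mem ha _) (h ∘ some)
      rw [io_conj] at h1
      refine Eq.trans ?_ h1
      have h2 : w (g (h none)) = ⟨g (w (h none)), (GA_mem subset_rfl hg).2 (w (h none)).2⟩ :=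
        Subtype.ext (pj_smul' hg _)
      change Λ (sm (dg ha hg) v) (io ha (w (g (h none)))) _ = _
      rw [h2]
      rfl
    · refine mem_T_oc (fun x y h => ?_) fun x => ?_
      swap
      · exact (hΛN v (io ha (w x)) (io_mem ha _)).1
      change Λ v (io ha (w (x * y))) h = Λ v (io ha (w x)) h + Λ v (io ha (w y)) h
      rw [hw1, io_mul, hΛm v _ (io_mem ha _) _ (io_mem ha _)]
      rfl
    · funext h
      exact congrFun (hΛl v hv _ (io_mem ha _)) _
  have hc0 : del c = 0 := by
    funext v h
    rw [del_pt]
    exact (del_pt (fun v => Λ v (io ha (w (h none)))) v (h ∘ some)).symm.trans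
      (congrFun (congrFun (hΛ0 _ (io_mem ha (w (h none)))) v) (h ∘ some))
  have h1 := hV B (by rw [Fintype.card_option]; omega) c hc hc0
  have h2 : c - (fun s => c s ∘ pr B) = c := by
    funext v h
    have h3 : w (pr B h none) = 1 := Subtype.ext (by
      change pj B (pj Bᶜ (h none)) = 1
      exact pj_eq_one disjoint_compl_right (pj_mem _ _))
    change c v h - Λ v (io ha (w (pr B h none))) _ = c v h
    rw [h3, io_one]
    exact (congrArg (c v h - ·) (congrFun (hΛ1 v) _)).trans (sub_zero _)
  rw [h2] at h1
  obtain ⟨b, hb, hb0, hbc⟩ := h1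
  refine ⟨fun v f z => b v (oc (wp f : FreeGroup (Fin n)) (pA B z)),
    ⟨fun g v f hf z => ?_, fun v f hf f' hf' => ?_, fun v f hf => ⟨?_, fun h => ?_⟩, fun v hv f hf => ?_⟩,
    fun hp v f hf => ?_, fun f hf => ?_⟩
  · have hz : ∀ (v : List (MulAut (FreeGroup (Fin n)))) (z : R → FreeGroup (Fin n)),
        b (sm g.1.2 v) (oc (wp (g * f * g⁻¹) : FreeGroup (Fin n)) (pA B (g.1.2 • z))) =
          b v (oc (wp f : FreeGroup (Fin n)) (pA B z)) := fun v z => ?_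
    · exact hz v z
    rw [wp_conj g hf, T_oc_conj (hb.2.1 _), pA_smul g.2.2.1, ← smul_oc]
    exact hb.1 _ g.2.2.1 v _
  · funext z
    change b v (oc (wp (f * f') : FreeGroup (Fin n)) (pA B z)) = _
    rw [wp_mul, mem_Fk.1 hf]
    exact T_oc_mul (hb.2.1 v) _ _ _
  · exact T_pA B (T_oc (hb.2.1 v) _)
  · change b v (oc _ (pA B (pA B h))) = b v (oc _ (pA B h))
    rw [pA_idem]
  · funext z
    exact congrFun (hb.2.2 v hv) _
  · funext z
    exact congrFun (congrFun (hb0 hp) v) _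
  · funext v z
    rw [del_pt]
    refine (del_pt b v (oc (wp f : FreeGroup (Fin n)) (pA B z))).symm.trans ?_
    rw [hbc]
    change Λ v (io ha (w (wp f : FreeGroup (Fin n)))) (pA B z) = _
    have h3 : w (wp f : FreeGroup (Fin n)) = wp f :=
      Subtype.ext (pj_eq_of_mem subset_rfl (wp f).2)
    rw [h3, io_wp ha hf]
    exact (hΛN v f hf).2 z

end Pair

end WordCx

namespace WordCx

open scoped Pointwise

section Pair

variable {n : ℕ} {B : Finset (Fin n)} {a : Fin n} {R : Type} [DecidableEq R]

variable (n) in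
/-- Functions which do not depend on the slot `r₀` and are additive in the other slots. -/
def TX (r₀ : R) : AddSubgroup ((R → FreeGroup (Fin n)) → ℤ) where
  carrier := {f | (∀ h x, f (Function.update h r₀ x) = f h) ∧
    ∀ h, ∀ r ≠ r₀, ∀ x y, f (Function.update h r (x * y)) =
      f (Function.update h r x) + f (Function.update h r y)}
  zero_mem' := ⟨fun _ _ => rfl, fun _ _ _ _ _ => rfl⟩
  add_mem' {f g} hf hg := ⟨fun h x => congrArg₂ (· + ·) (hf.1 h x) (hg.1 h x),
    fun h r hr x y => by
      simp only [Pi.add_apply]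
      rw [hf.2 h r hr, hg.2 h r hr]; abel⟩
  neg_mem' {f} hf := ⟨fun h x => congrArg Neg.neg (hf.1 h x),
    fun h r hr x y => by
      simp only [Pi.neg_apply]
      rw [hf.2 h r hr]; abel⟩

lemma smul_update (g : MulAut (FreeGroup (Fin n))) (h : R → FreeGroup (Fin n)) (r : R)
    (x : FreeGroup (Fin n)) : g • Function.update h r x = Function.update (g • h) r (g x) := by
  funext r'
  by_cases e : r' = r
  · subst e; simp
  · simp [e]

lemma pA_update (h : R → FreeGroup (Fin n)) (r : R) (x : FreeGroup (Fin n)) :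
    pA B (Function.update h r x) = Function.update (pA B h) r (pj B x) := by
  funext r'
  by_cases e : r' = r
  · subst e; simp [pA]
  · simp [pA, e]

lemma TX_smul (r₀ : R) (g : MulAut (FreeGroup (Fin n))) {f : (R → FreeGroup (Fin n)) → ℤ}
    (hf : f ∈ TX n r₀) : (fun h => f (g • h)) ∈ TX n r₀ :=
  ⟨fun h x => by
    beta_reduce
    rw [smul_update]
    exact hf.1 _ _,
  fun h r hr x y => by
    beta_reduce
    rw [smul_update, smul_update, smul_update, map_mul]
    exact hf.2 _ r hr _ _⟩

lemma mem_TX {f : (R → FreeGroup (Fin n)) → ℤ} (hf : f ∈ T n R) (r₀ : R) (x : FreeGroup (Fin n)) :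
    (fun h => f (Function.update (pA B h) r₀ x)) ∈ TX n r₀ :=
  ⟨fun h y => by
    beta_reduce
    rw [pA_update, Function.update_idem],
  fun h r hr y z => by
    beta_reduce
    rw [pA_update, pA_update, pA_update, Function.update_comm hr, Function.update_comm hr,
      Function.update_comm hr, map_mul]
    exact hf _ _ _ _⟩

lemma TX_update {f : (R → FreeGroup (Fin n)) → ℤ} (hf : f ∈ T n R) (r₀ : R) (x : FreeGroup (Fin n)) :
    (fun h => f (Function.update h r₀ x)) ∈ TX n r₀ :=
  ⟨fun h y => by
    beta_reduce
    rw [Function.update_idem],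
  fun h r hr y z => by
    beta_reduce
    rw [Function.update_comm hr, Function.update_comm hr, Function.update_comm hr]
    exact hf _ _ _ _⟩

variable (n) in
/-- The functions `TX`, acted on through the second component. -/
def TW (r₀ : R) : AddSubgroup ((R → Wn n) → ℤ) := TX n r₀

lemma TW_stable (r₀ : R) : Stable (KP B a) (TW n r₀) := fun p _ hf => TX_smul r₀ p.1.2 hf

/-- Replace the slot `r₀` by a difference. -/
def et (r₀ : R) (q : Yn B a × Yn B a × (R → Wn n)) : R → Wn n :=
  let y₁ : FA B := q.1
  let y₂ : FA B := q.2.1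
  let h : R → FreeGroup (Fin n) := q.2.2
  Function.update h r₀ ((y₁ : FreeGroup (Fin n))⁻¹ * (y₂ : FreeGroup (Fin n)))

lemma et_smul (r₀ : R) (p : KP B a) (q : Yn B a × Yn B a × (R → Wn n)) :
    et r₀ (p • q) = p • et r₀ q := by
  obtain ⟨y₁, y₂, h⟩ := q
  let x₁ : FA B := y₁
  let x₂ : FA B := y₂
  let h' : R → FreeGroup (Fin n) := h
  change Function.update (p.1.2 • h') r₀ (((wp p : FreeGroup (Fin n)) * p.1.2 (x₁ : FreeGroup (Fin n)))⁻¹ *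
    ((wp p : FreeGroup (Fin n)) * p.1.2 (x₂ : FreeGroup (Fin n)))) =
    p.1.2 • Function.update h' r₀ ((x₁ : FreeGroup (Fin n))⁻¹ * (x₂ : FreeGroup (Fin n)))
  rw [smul_update, map_mul, map_inv]
  congr 1
  group

lemma et_Diff (r₀ : R) {f : (R → Wn n) → ℤ} (hf : f ∈ NT n B R) :
    f ∘ et r₀ ∈ Diff (Yn B a) (TW n r₀) := by
  refine ⟨fun (y₁ y₂ : FA B) => TX_update hf.1 r₀ ((y₁ : FreeGroup (Fin n))⁻¹ * y₂),
    fun (y₁ y₂ y₃ : FA B) (h : R → FreeGroup (Fin n)) => ?_⟩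
  have := hf.1 h r₀ ((y₁ : FreeGroup (Fin n))⁻¹ * y₂) ((y₂ : FreeGroup (Fin n))⁻¹ * y₃)
  rw [mul_assoc, mul_inv_cancel_left] at this
  exact this.symm

end Pair

end WordCx

namespace WordCx

open scoped Pointwise

section Pair

variable {n : ℕ} {B : Finset (Fin n)} {a : Fin n} {R : Type}

variable (B) in
/-- Restriction of the values of a cochain to the factor generated by `B`. -/
def lam (c : Cn n R) (s : List (Fs n)) (h : R → Wn n) : ℤ := c s (pA B h)

lemma smul_pA {p : KP B a} (h : R → FreeGroup (Fin n)) : p.1.2 • pA B h = p.1.1 • pA B h :=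
  funext fun r => (p.2.2.2.1 _ (pj_mem B (h r))).symm

lemma del_lam (c : Cn n R) (hc0 : del c = 0) : del (lam B c) = 0 := by
  funext s z
  exact (del_eval (fun h : R → Wn n => pA B h) c s z).trans (congrFun (congrFun hc0 s) _)

variable [DecidableEq R]

lemma lam_mem {c : Cn n R} {i : ℕ} (hc : c ∈ Co (GA (insert a B)) (T n R) i) :
    lam B c ∈ Co (⊤ : Subgroup (KP B a)) (NT n B R) i := by
  refine ⟨fun p _ s (h : R → FreeGroup (Fin n)) => ?_, fun s => pA_mem_NT (hc.2.1 s), fun s hs => ?_⟩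
  · change c (sm p.1.1 s) (pA B (p.1.2 • h)) = c s (pA B h)
    rw [pA_smul p.2.2.1, smul_pA]
    exact hc.1 _ p.2.1 s _
  · exact funext fun h => congrFun (hc.2.2 s hs) _

variable (n) in
/-- Functions on `Yn × (R → Wn)` with values in `TW`. -/
def TY (B : Finset (Fin n)) (a : Fin n) (r₀ : R) : AddSubgroup (Yn B a × (R → Wn n) → ℤ) where
  carrier := {f | ∀ y, (fun h => f (y, h)) ∈ TW n r₀}
  zero_mem' _ := zero_mem (TW n r₀)
  add_mem' hf hg y := add_mem (hf y) (hg y)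
  neg_mem' hf y := neg_mem (hf y)

/-- The cochain which takes its value at `e * y` in the slot `r₀`. -/
def gam (B : Finset (Fin n)) (a : Fin n) (r₀ : R) (c : Cn n R) (s : List (Fs n)) (q : Yn B a × (R → Wn n)) : ℤ :=
  let y : FA B := q.1
  let h : R → FreeGroup (Fin n) := q.2
  c s (Function.update (pA B h) r₀ (FreeGroup.of a * (y : FreeGroup (Fin n))))

lemma gam_mem (r₀ : R) {c : Cn n R} {i : ℕ} (hc : c ∈ Co (GA (insert a B)) (T n R) i) :
    gam B a r₀ c ∈ Co (⊤ : Subgroup (KP B a)) (TY n B a r₀) i := by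
  refine ⟨?_, fun s (y : FA B) => mem_TX (hc.2.1 s) r₀ (FreeGroup.of a * (y : FreeGroup (Fin n))),
    fun s hs => ?_⟩
  · rintro p - s ⟨y, h⟩
    let x : FA B := y
    let h' : R → FreeGroup (Fin n) := h
    change c (sm p.1.1 s) (Function.update (pA B (p.1.2 • h')) r₀ (FreeGroup.of a *
      ((wp p : FreeGroup (Fin n)) * p.1.2 (x : FreeGroup (Fin n))))) =
      c s (Function.update (pA B h') r₀ (FreeGroup.of a * (x : FreeGroup (Fin n))))
    rw [pA_smul p.2.2.1, smul_pA, ← p.2.2.2.1 _ x.2, ← mul_assoc, ← wp_spec, ← map_mul,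
      ← smul_update]
    exact hc.1 _ p.2.1 s _
  · exact funext fun h => congrFun (hc.2.2 s hs) _

lemma del_gam (r₀ : R) (c : Cn n R) (hc0 : del c = 0) : del (gam B a r₀ c) = 0 := by
  funext s z
  exact (del_eval (fun q : Yn B a × (R → Wn n) =>
    let y : FA B := q.1
    let h : R → FreeGroup (Fin n) := q.2
    Function.update (pA B h) r₀ (FreeGroup.of a * (y : FreeGroup (Fin n)))) c s z).trans
    (congrFun (congrFun hc0 s) _)

lemma gam_sub (r₀ : R) {c : Cn n R} {i : ℕ} (hc : c ∈ Co (GA (insert a B)) (T n R) i)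
    (s : List (Fs n)) (y₁ y₂ : Yn B a) (h : R → Wn n) :
    lam B c s (et r₀ (y₁, y₂, h)) = gam B a r₀ c s (y₂, h) - gam B a r₀ c s (y₁, h) := by
  let x₁ : FA B := y₁
  let x₂ : FA B := y₂
  let h' : R → FreeGroup (Fin n) := h
  change c s (pA B (Function.update h' r₀ ((x₁ : FreeGroup (Fin n))⁻¹ * (x₂ : FreeGroup (Fin n))))) =
    c s (Function.update (pA B h') r₀ (FreeGroup.of a * (x₂ : FreeGroup (Fin n)))) -
    c s (Function.update (pA B h') r₀ (FreeGroup.of a * (x₁ : FreeGroup (Fin n))))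
  rw [pA_update, pj_eq_of_mem subset_rfl (mul_mem (inv_mem x₁.2) x₂.2), eq_sub_iff_add_eq,
    add_comm, ← hc.2.1 s, mul_assoc, mul_inv_cancel_left]

lemma null_et (ha : a ∉ B) (r₀ : R) {c : Cn n R} {i : ℕ}
    (hc : c ∈ Co (GA (insert a B)) (T n R) (i + 1)) (hc0 : del c = 0) :
    Null (⊤ : Subgroup (KP B a)) (Diff (Yn B a) (TW n r₀)) i (fun s => lam B c s ∘ et r₀) := by
  obtain ⟨κ, -, hκ⟩ := exists_kappa (⊤ : Subgroup (KP B a)) fun g _ (s : Fs n) => Fs_free g s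
  let θ : Yn B a × (R → Wn n) → Fs n → Fs n := fun q s => 
    let y : FA B := q.1
    (tw ha y * (κ s).1.2 : MulAut (FreeGroup (Fin n)))
  have hθ : ∀ p ∈ (⊤ : Subgroup (KP B a)), ∀ z s, θ (p • z) (p • s) = p • θ z s := by
    rintro p - ⟨y, h⟩ s
    let x : FA B := y
    change tw ha (af p x) * (κ (p • s)).1.2 = p.1.1 * (tw ha x * (κ s).1.2)
    rw [hκ p trivial, ← mul_assoc, tw_smul]
    exact (mul_assoc _ _ _).symm
  have h1 := Null.homotopy' (N := TY n B a r₀) (c := gam B a r₀ c) θ hθ (fun s (y : FA B) => by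
    have := linearCombination_mem (TX n r₀) (fun t => mem_TX (B := B) (hc.2.1 t) r₀
      (FreeGroup.of a * (y : FreeGroup (Fin n)))) (prism (fun s => tw ha y * (κ s).1.2) s)
    exact (congrArg (· ∈ TX n r₀) (funext fun h => linearCombination_pi _ _ h)).mp this) (gam_mem r₀ hc) (del_gam r₀ c hc0)
  have h2 := (Null.diff (fun q : Yn B a × Yn B a × (R → Wn n) => (q.1, q.2.2)) (fun q => (q.2.1, q.2.2))
    (fun _ _ _ => rfl) (fun _ _ _ => rfl) (N₁ := TY n B a r₀) (N' := Diff (Yn B a) (TW n r₀)) (fun f hf =>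
      ⟨fun y₁ y₂ => sub_mem (hf y₁) (hf y₂), fun y₁ y₂ y₃ z => by simp⟩) h1)
  convert h2 using 1
  funext s q
  obtain ⟨y₁, y₂, h⟩ := q
  have h3 : ∀ y : Yn B a, gam B a r₀ c (s.map (θ (y, h))) (y, h) =
      c (s.map fun t => (κ t).1.2) (Function.update (pA B fun r => (h r : FreeGroup (Fin n))) r₀ (FreeGroup.of a)) := fun y => by
    let x : FA B := y
    let h' : R → FreeGroup (Fin n) := h
    change c (s.map fun t => tw ha x * (κ t).1.2) (Function.update (pA B h') r₀
      (FreeGroup.of a * (x : FreeGroup (Fin n)))) = c _ (Function.update (pA B h') r₀ (FreeGroup.of a))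
    have h4 : pA B h' = tw ha x • pA B h' := funext fun r => (tw_fix ha x (pj_mem B _)).symm
    conv_lhs => rw [h4, ← tw_of ha x, ← smul_update]
    rw [← hc.1 _ (tw_mem ha x) (s.map fun t => (κ t).1.2), sm, List.map_map]
    rfl
  change lam B c s (et r₀ (y₁, y₂, h)) = (gam B a r₀ c (s.map (θ (y₁, h))) (y₁, h) - gam B a r₀ c s (y₁, h)) -
    (gam B a r₀ c (s.map (θ (y₂, h))) (y₂, h) - gam B a r₀ c s (y₂, h))
  rw [h3, h3, gam_sub r₀ hc]
  ring

end Pair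

end WordCx

namespace WordCx

open scoped Pointwise

section Pair

variable {n : ℕ} {B : Finset (Fin n)} {a : Fin n} {R : Type}

variable (B a) in
/-- The pair consisting of `1` and the entry in the slot `r₀`. -/
def un (r₀ : R) (h : R → Wn n) : Yn B a × Yn B a × (R → Wn n) :=
  ((1 : FA B), (⟨pj B (h r₀), pj_mem B _⟩ : FA B), fun r => pj B (h r))

variable [DecidableEq R]

lemma et_un (r₀ : R) (h : R → FreeGroup (Fin n)) : et r₀ (un B a r₀ h) = pA B h := by
  change Function.update (pA B h) r₀ (1⁻¹ * pA B h r₀) = pA B h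
  rw [inv_one, one_mul, Function.update_eq_self]

lemma hat_mem (ha : a ∉ B) (r₀ : R) {k : ℕ} {m : List (Fs n) → List (Sn n) → Yn B a × Yn B a × (R → Wn n) → ℤ}
    (hm : m ∈ Cc (⊤ : Subgroup (KP B a)) Set.univ (Diff (Yn B a) (TW n r₀)) 0 k) :
    (fun s v => m s v ∘ un B a r₀) ∈ Cc (⊤ : Subgroup (KP B a)) Set.univ (NT n B R) 0 k := by
  have hF : ∀ (w y₁ y₂ : FA B) (v : List (Sn n)) (h : R → FreeGroup (Fin n)),
      m [] v ((w * y₁ : FA B), (w * y₂ : FA B), h) = m [] v (y₁, y₂, h) := fun w y₁ y₂ v h => by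
    have h1 := hm.1 (io ha w) trivial [] v (y₁, y₂, h)
    have h2 : sm (io ha w) v = v := (List.map_congr_left fun x _ =>
      (Sn_fix _ x).2 (io_mem ha w)).trans (List.map_id v)
    have h3 (y : FA B) : af (io ha w) y = w * y := Subtype.ext (by
      change (wp (io ha w) : FreeGroup (Fin n)) * y = w * y
      rw [wp_io])
    rw [h2] at h1
    refine Eq.trans ?_ h1
    change _ = m [] v (af (io ha w) y₁, af (io ha w) y₂, h)
    rw [h3, h3]
  refine ⟨fun p _ s v (h : R → FreeGroup (Fin n)) => ?_, fun s v => ?_, fun s hs => ?_, fun s v hv => ?_⟩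
  · cases s with
    | cons b s => 
      have h1 : ∀ b (s : List (Fs n)), m (b :: s) = 0 := fun b s => hm.2.2.1 _ (by simp)
      change m ((p • b) :: sm p s) _ _ = m (b :: s) _ _
      rw [h1, h1]; rfl
    | nil =>
      let x : FA B := ⟨pj B (h r₀), pj_mem B _⟩
      let y : FA B := ⟨p.1.2 x, (GA_mem subset_rfl p.2.2.1).2 x.2⟩
      have h1 := hm.1 p trivial [] v (un B a r₀ h)
      refine Eq.trans ?_ h1
      have h2 : un B a r₀ (p.1.2 • h) = ((1 : FA B), y, p.1.2 • pA B h) := by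
        refine Prod.ext rfl (Prod.ext (Subtype.ext (pj_smul' p.2.2.1 _)) (pA_smul p.2.2.1 h))
      have h3 : (p • un B a r₀ h) = ((wp p * 1 : FA B), (wp p * y : FA B), p.1.2 • pA B h) := by
        refine Prod.ext (Subtype.ext ?_) rfl
        change (wp p : FreeGroup (Fin n)) * p.1.2 1 = wp p * 1
        rw [map_one]
      rw [h3]
      exact (congrArg (m [] (sm p v)) h2).trans (hF (wp p) 1 y (sm p v) _).symm
  · cases s with
    | cons b s =>
      have h1 : m (b :: s) = 0 := hm.2.2.1 _ (by simp)
      change m (b :: s) v ∘ _ ∈ _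
      rw [h1]
      exact zero_mem (NT n B R)
    | nil =>
      have hD := hm.2.1 [] v
      refine ⟨fun h r x y => ?_, fun h => ?_⟩
      · let W : FreeGroup (Fin n) → FA B := fun x => ⟨pj B x, pj_mem B x⟩
        have hW : W (x * y) = W x * W y := Subtype.ext (map_mul _ _ _)
        obtain ⟨f, hf⟩ : ∃ f : FA B → FA B → (R → FreeGroup (Fin n)) → ℤ,
          ∀ (y₁ y₂ : FA B) (h : R → FreeGroup (Fin n)), m [] v (y₁, y₂, h) = f y₁ y₂ h := ⟨fun y₁ y₂ h => m [] v (y₁, y₂, h), fun _ _ _ => rfl⟩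
        have hfX : ∀ y₁ y₂, f y₁ y₂ ∈ TX n r₀ := fun y₁ y₂ =>
          (congrArg (· ∈ TX n r₀) (funext fun h => hf y₁ y₂ h)).mp (hD.1 y₁ y₂)
        have hfD : ∀ y₁ y₂ y₃ h, f y₁ y₂ h + f y₂ y₃ h = f y₁ y₃ h := fun y₁ y₂ y₃ h =>
          ((congrArg₂ (· + ·) (hf _ _ _) (hf _ _ _)).symm.trans (hD.2 y₁ y₂ y₃ h)).trans (hf _ _ _)
        have hfF : ∀ w y₁ y₂ h, f (w * y₁) (w * y₂) h = f y₁ y₂ h := fun w y₁ y₂ h =>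
          (hf _ _ _).symm.trans ((hF w y₁ y₂ v h).trans (hf _ _ _))
        have hu : ∀ x : FreeGroup (Fin n), m [] v (un B a r₀ (Function.update h r x)) =
            f 1 (W (Function.update h r x r₀)) (Function.update (pA B h) r (pj B x)) := fun x => by
          rw [← pA_update]
          exact hf 1 _ _
        refine (hu _).trans (Eq.trans ?_ (congrArg₂ (· + ·) (hu _) (hu _)).symm)
        by_cases hr : r = r₀
        · subst hr
          rw [Function.update_self, Function.update_self, Function.update_self, (hfX _ _).1,
            (hfX _ _).1, (hfX _ _).1, hW, ← hfF (W x) 1 (W y), mul_one]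
          exact (hfD _ _ _ _).symm
        · rw [Function.update_of_ne (Ne.symm hr), Function.update_of_ne (Ne.symm hr),
            Function.update_of_ne (Ne.symm hr), map_mul]
          exact (hfX _ _).2 (pA B h) r hr _ _
      · exact congrArg (m [] v) (Prod.ext rfl (Prod.ext
          (Subtype.ext (congrFun (pA_idem h) r₀)) (pA_idem h)))
  · funext v h
    exact congrFun (congrFun (hm.2.2.1 s hs) v) _
  · funext h
    exact congrFun (hm.2.2.2 s v hv) _

lemma null_lam_zero (r₀ : R) {N : AddSubgroup ((R → Wn n) → ℤ)} {c : Cn n R}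
    (hc : Null (⊤ : Subgroup (KP B a)) (Diff (Yn B a) (TW n r₀)) 0 (fun s => lam B c s ∘ et r₀)) :
    Null (⊤ : Subgroup (KP B a)) N 0 (lam B c) := by
  obtain ⟨b, -, hb0, hbc⟩ := hc
  refine ⟨0, zero_mem _, fun _ => rfl, ?_⟩
  rw [hb0 rfl, map_zero] at hbc
  rw [map_zero]
  funext s (h : R → FreeGroup (Fin n))
  have h1 : 0 = lam B c s (et r₀ (un B a r₀ h)) := congrFun (congrFun hbc s) (un B a r₀ h)
  rw [et_un] at h1
  refine h1.trans ?_
  change c s (pA B (pA B h)) = c s (pA B h)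
  rw [pA_idem]

lemma null_lam_succ [Fintype R] [Nonempty R] (ha : a ∉ B) {i : ℕ} (hV : Van n (Option R) i)
    (hB : 2 * i + Fintype.card R + 3 ≤ B.card) {c : Cn n R}
    (hc : c ∈ Co (GA (insert a B)) (T n R) (i + 2)) (hc0 : del c = 0) :
    Null (⊤ : Subgroup (KP B a)) (NT n B R) (i + 1) (lam B c) := by
  obtain ⟨r₀⟩ := (inferInstance : Nonempty R)
  have hfree := isFreeGroup_Fk ha
  let ρ : Fs n := (1 : MulAut (FreeGroup (Fin n)))
  let y₀ : Yn B a := (1 : FA B)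
  let τ : Yn B a → Fs n := fun y => tw ha y
  have hFN : ∀ g ∈ Fk B a, ∀ z : R → Wn n, g • z = z := fun g hg z => by
    let z' : R → FreeGroup (Fin n) := z
    change g.1.2 • z' = z'
    rw [mem_Fk.1 hg, one_smul]
  have hl := lam_mem hc
  obtain ⟨ν, hν, hL⟩ := (hs (KP B a) (Fs n) (Sn n) (NT n B R)).exists_link (k := i + 2)
    (fun p q hpq => hs_descend ρ Fs_free Sn_fix
      (fun g hg f _ z => by rw [hFN g hg]) NT_stable fun hp => by
        obtain rfl : q = i := by omega
        exact vanHom_pair ha hV hB)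
    (l := edge (lam B c)) (edge_mem (Set.mem_univ _) hl) (by
      change del (edge (lam B c)) = 0
      rw [del_edge, del_lam c hc0, map_zero])
  refine hs_null Fs_free hL ?_
  have hL' := hs_link_comp (et r₀) (et_smul (B := B) (a := a) r₀) (fun f hf => et_Diff r₀ hf) hL
  obtain ⟨b, hb, -, hbc⟩ := null_et ha r₀ hc hc0
  obtain ⟨m, hm, hmν⟩ := DoubleCx.link_boundary _ (fun p q _ => hs_E2_of_acyclic
      ρ Sn_fix (Diff_stable (TW_stable r₀)) fun k _ y hy hy0 => by
        obtain ⟨κ, -, hκ⟩ := exists_kappa (⊤ : Subgroup (KP B a)) fun g _ (s : Fs n) => Fs_free g s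
        exact null_diff ρ (fun g _ s => Fs_free g s) hFN
          (fun s => κ s • y₀) (fun g _ s => by rw [hκ g trivial, mul_smul])
          τ (fun g hg (y : FA B) => by
            change tw ha (af g y) = g.1.1 * tw ha y
            rw [tw_smul, mem_Fk.1 hg, mul_one]) hy hy0)
    (fun x hx hx0 => hs_injS ρ x hx hx0) hL'
    ⟨edge b, edge_mem (Set.mem_univ _) hb, by
      change del (edge b) = _
      rw [del_edge, hbc]
      funext s v
      cases v with
      | nil => rfl
      | cons x v => rfl⟩
  refine ⟨_, hat_mem ha r₀ hm, ?_⟩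
  funext s v (h : R → FreeGroup (Fin n))
  have h1 := congrFun (congrFun (congrFun hmν s) v) (un B a r₀ h)
  rw [hs_dX] at h1 ⊢
  have h2 := (del_eval (un B a r₀) (m s) v h).trans h1
  refine h2.trans ?_
  change ν s v (et r₀ (un B a r₀ h)) = ν s v h
  rw [et_un]
  exact (hν.2.1 s v).2 h

end Pair

end WordCx

namespace WordCx

open scoped Pointwise

section Pair

variable {n : ℕ} {B : Finset (Fin n)} {a : Fin n} {R : Type} [DecidableEq R]

lemma null_restrict (ha : a ∉ B) {i : ℕ} {c : Cn n R}
    (hc : Null (⊤ : Subgroup (KP B a)) (NT n B R) i (lam B c)) :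
    Null (GA B) (T n R) i (fun s => c s ∘ pA B) := by
  obtain ⟨b, hb, hb0, hbc⟩ := hc
  exact ⟨b, ⟨fun g hg s z => hb.1 (dg ha hg) trivial s z, fun s => (hb.2.1 s).1, hb.2.2⟩, hb0, hbc⟩

lemma cstat_zero [Fintype R] [Nonempty R] : Cstat n R 0 := by
  intro A _ a ha c hc hc0
  rw [← Finset.insert_erase ha] at hc
  exact null_restrict (A.notMem_erase a)
    (null_lam_zero (Classical.arbitrary R) (null_et (A.notMem_erase a) _ hc hc0))

lemma cstat_succ [Fintype R] [Nonempty R] {i : ℕ} (hV : Van n (Option R) i) : Cstat n R (i + 1) := by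
  intro A hA a ha c hc hc0
  rw [← Finset.insert_erase ha] at hc
  refine null_restrict (A.notMem_erase a) (null_lam_succ (A.notMem_erase a) hV ?_ hc hc0)
  rw [Finset.card_erase_of_mem ha]
  omega

lemma van_of_isEmpty [Fintype R] [IsEmpty R] (i : ℕ) : Van n R i := by
  intro A _ c _ _
  have : c - (fun s => c s ∘ pr A) = 0 := by
    funext s h
    change c s h - c s (pr A h) = 0
    rw [Subsingleton.elim (pr A h) h, sub_self]
  rw [this]
  exact Null.zero

/-- Vanishing of twisted cohomology of automorphism groups of free groups in the stable range. -/
theorem van (n : ℕ) : ∀ (i : ℕ) (R : Type) [Fintype R] [DecidableEq R], Van n R i := by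
  intro i
  induction i using Nat.strong_induction_on with
  | _ i ih =>
    have hIS : ∀ j ≤ i, (∀ (R : Type) [Fintype R] [DecidableEq R], StInj n R j) ∧
        ∀ (R : Type) [Fintype R] [DecidableEq R], StSurj n R j := by
      intro j
      induction j using Nat.strong_induction_on with
      | _ j ihj =>
        intro hj
        exact ⟨fun R _ _ => stInj_of (fun k hk => (ihj k hk (by omega)).1 R) (fun k hk => (ihj k hk (by omega)).2 R) (fun k hk => ih k (by omega) R),
          fun R _ _ => stSurj_of (fun k hk => (ihj k hk (by omega)).1 R) (fun k hk => (ihj k hk (by omega)).2 R) (fun k hk => ih k (by omega) R)⟩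
    have hC : ∀ (R : Type) [Fintype R] [DecidableEq R] [Nonempty R], Cstat n R i := by
      intro R _ _ _
      cases i with
      | zero => exact cstat_zero
      | succ i => exact cstat_succ (ih i (by omega) _)
    suffices h : ∀ (k : ℕ) (R : Type) [Fintype R] [DecidableEq R], Fintype.card R = k → Van n R i from
      fun R _ _ => h _ R rfl
    intro k
    induction k using Nat.strong_induction_on with
    | _ k ihk =>
      intro R _ _ hR
      cases isEmpty_or_nonempty R
      · exact van_of_isEmpty i
      · exact van_of (hIS i le_rfl).1 (fun R' _ _ _ h => ihk _ (hR ▸ h) R' rfl) (hC R)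

end Pair

end WordCx

namespace WordCx

open scoped Pointwise

section Out

variable {n : ℕ}

lemma toWord_of_mul {x : FreeGroup (Fin n)} {l : Fin n × Bool} {w : List (Fin n × Bool)}
    (hx : x.toWord = l :: w) {j : Fin n} (hj : j ≠ l.1) :
    (FreeGroup.of j * x).toWord = (j, true) :: l :: w := by
  have h1 : FreeGroup.of j * x = FreeGroup.mk ((j, true) :: x.toWord) := by
    conv_lhs => rw [← FreeGroup.mk_toWord (x := x)]
    rfl
  rw [h1, FreeGroup.toWord_mk, FreeGroup.reduce.cons, FreeGroup.reduce_toWord, hx]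
  simp [hj]

lemma eq_one_of_commute (hn : 2 ≤ n) {x : FreeGroup (Fin n)}
    (hx : ∀ y : FreeGroup (Fin n), x * y = y * x) : x = 1 := by
  rw [← FreeGroup.toWord_eq_nil_iff]
  rcases hw : x.toWord with _ | ⟨l, w⟩
  · rfl
  have : Nontrivial (Fin n) := Fin.nontrivial_iff_two_le.2 hn
  obtain ⟨j, hj⟩ := exists_ne l.1
  have h1 := toWord_of_mul hw hj
  have h2 := FreeGroup.toWord_mul_sublist x (FreeGroup.of j)
  rw [hx, h1, hw, FreeGroup.toWord_of] at h2
  have h3 := List.head_eq_of_cons_eq (h2.eq_of_length (by simp))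
  exact absurd (congrArg Prod.fst h3) hj

lemma conj_injective (hn : 2 ≤ n) :
    Function.Injective (MulAut.conj : FreeGroup (Fin n) →* MulAut (FreeGroup (Fin n))) := by
  rw [injective_iff_map_eq_one]
  intro x hx
  refine eq_one_of_commute hn fun y => ?_
  have h1 : MulAut.conj x y = y := by rw [hx]; rfl
  rw [MulAut.conj_apply] at h1
  exact mul_inv_eq_iff_eq_mul.1 h1

lemma isFreeGroup_InnF (hn : 2 ≤ n) : IsFreeGroup (InnF n) :=
  IsFreeGroup.ofMulEquiv (MonoidHom.ofInjective (conj_injective hn))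

lemma outF_fix (g : MulAut (FreeGroup (Fin n))) (v : OutF n) : g • v = v ↔ g ∈ InnF n := by
  induction v using QuotientGroup.induction_on with
  | H x =>
    change ((g * x : AutF n) : OutF n) = x ↔ _
    rw [eq_comm, QuotientGroup.eq, ← mul_assoc]
    constructor
    · intro h
      simpa [mul_assoc] using (innF_normal n).conj_mem _ h x
    · intro h
      simpa using (innF_normal n).conj_mem _ h x⁻¹

lemma T_conj {R : Type} [Fintype R] [DecidableEq R] {g : MulAut (FreeGroup (Fin n))}
    (hg : g ∈ InnF n) {f : (R → FreeGroup (Fin n)) → ℤ} (hf : f ∈ T n R)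
    (z : R → FreeGroup (Fin n)) : f (g • z) = f z := by
  obtain ⟨x, rfl⟩ := hg
  have h1 : ∀ s : Finset R, f (s.piecewise (MulAut.conj x • z) z) = f z := by
    intro s
    induction s using Finset.induction_on with
    | empty => rw [Finset.piecewise_empty]
    | insert r s hr ih =>
      rw [Finset.piecewise_insert]
      change f (Function.update _ r (x * z r * x⁻¹)) = _
      rw [← Finset.piecewise_eq_of_notMem s (MulAut.conj x • z) z hr]
      set P := s.piecewise (MulAut.conj x • z) z
      have h2 := hf P r x⁻¹ (x * P r)
      rw [inv_mul_cancel_left, Function.update_eq_self, ih] at h2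
      rw [hf P r, h2, add_comm]
  simpa using h1 Finset.univ

end Out

end WordCx

namespace WordCx

open scoped Pointwise

section Out

variable {n : ℕ}

variable (n) in
/-- Vanishing of the twisted cohomology of the outer automorphism group in degree `i`. -/
def OutVan (R : Type) [Fintype R] [DecidableEq R] (i : ℕ) : Prop :=
  ∀ c : List (OutF n) → (R → FreeGroup (Fin n)) → ℤ,
    c ∈ Co (⊤ : Subgroup (MulAut (FreeGroup (Fin n)))) (T n R) (i + 1) → del c = 0 →
      Null (⊤ : Subgroup (MulAut (FreeGroup (Fin n)))) (T n R) i c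

variable (n) in
/-- An element inducing a given inner automorphism. -/
def unconj (f : MulAut (FreeGroup (Fin n))) : FreeGroup (Fin n) :=
  Function.invFun (MulAut.conj : FreeGroup (Fin n) →* MulAut (FreeGroup (Fin n))) f

lemma conj_unconj {f : MulAut (FreeGroup (Fin n))} (hf : f ∈ InnF n) :
    MulAut.conj (unconj n f) = f := Function.invFun_eq hf

lemma unconj_conj (hn : 2 ≤ n) (x : FreeGroup (Fin n)) : unconj n (MulAut.conj x) = x :=
  Function.leftInverse_invFun (conj_injective hn) x

lemma conj_apply_eq (g : MulAut (FreeGroup (Fin n))) (x : FreeGroup (Fin n)) :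
    MulAut.conj (g x) = g * MulAut.conj x * g⁻¹ := by
  ext y
  simp [MulAut.conj_apply, MulAut.mul_apply]

lemma vanHom_out {R : Type} [Fintype R] [DecidableEq R] (hn : 2 ≤ n) {p : ℕ}
    (hV : OutVan n (Option R) p) : VanHom (OutF n) (InnF n) (T n R) p := by
  intro Λ hΛ hΛ0
  obtain ⟨hΛg, hΛm, hΛN, hΛl⟩ := hΛ
  have hin : ∀ x : FreeGroup (Fin n), MulAut.conj x ∈ InnF n := fun x => ⟨x, rfl⟩
  let c : List (OutF n) → (Option R → FreeGroup (Fin n)) → ℤ :=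
    fun v h => Λ v (MulAut.conj (h none)) (h ∘ some)
  obtain ⟨b, hb, hb0, hbc⟩ := hV c ⟨fun g _ v h => by
      change Λ (sm g v) (MulAut.conj (g (h none))) (g • (h ∘ some)) = _
      rw [conj_apply_eq]
      exact hΛg g v _ (hin _) _,
    fun v => mem_T_oc (fun x y h => by
      change Λ v (MulAut.conj (x * y)) h = Λ v (MulAut.conj x) h + Λ v (MulAut.conj y) h
      rw [map_mul, hΛm v _ (hin _) _ (hin _)]
      rfl) fun x => hΛN v _ (hin x),
    fun v hv => by
      funext h
      exact congrFun (hΛl v hv _ (hin _)) _⟩ (by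
    funext v h
    rw [del_pt]
    exact (del_pt (fun v => Λ v (MulAut.conj (h none))) v (h ∘ some)).symm.trans
      (congrFun (congrFun (hΛ0 _ (hin _)) v) (h ∘ some)))
  refine ⟨fun v f z => b v (oc (unconj n f) z),
    ⟨fun g v f hf z => ?_, fun v f hf f' hf' => ?_, fun v f _ => T_oc (hb.2.1 v) _,
      fun v hv f _ => ?_⟩, fun hp v f _ => ?_, fun f hf => ?_⟩
  · have h1 : unconj n (g * f * g⁻¹) = g (unconj n f) := by
      rw [← conj_unconj hf, ← conj_apply_eq, unconj_conj hn, unconj_conj hn]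
    beta_reduce
    rw [h1, ← smul_oc]
    exact hb.1 g trivial v _
  · have h1 : unconj n (f * f') = unconj n f * unconj n f' := by
      rw [← conj_unconj hf, ← conj_unconj hf', ← map_mul, unconj_conj hn, unconj_conj hn,
        unconj_conj hn]
    funext z
    beta_reduce
    rw [h1]
    exact T_oc_mul (hb.2.1 v) _ _ _
  · funext z
    exact congrFun (hb.2.2 v hv) _
  · funext z
    exact congrFun (congrFun (hb0 hp) v) _
  · funext v z
    rw [del_pt]
    refine (del_pt b v (oc (unconj n f) z)).symm.trans ?_
    rw [hbc]
    change Λ v (MulAut.conj (unconj n f)) z = _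
    rw [conj_unconj hf]

lemma null_top_of_van {R : Type} [Fintype R] [DecidableEq R] [Nonempty R] {i : ℕ}
    (hn : 2 * i + Fintype.card R + 2 ≤ n) {c : Cn n R}
    (hc : c ∈ Co (⊤ : Subgroup (MulAut (FreeGroup (Fin n)))) (T n R) (i + 1)) (hc0 : del c = 0) :
    Null (⊤ : Subgroup (MulAut (FreeGroup (Fin n)))) (T n R) i c := by
  have htop : GA (Finset.univ : Finset (Fin n)) = ⊤ := eq_top_iff.2 fun g _ => GA_univ g
  have h1 := van n i R Finset.univ (by simpa using hn) c (htop ▸ hc) hc0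
  rw [htop] at h1
  convert h1 using 1
  funext s h
  have h2 : c s (pr Finset.univ h) = 0 :=
    T_apply_one (hc.2.1 s) (r := Classical.arbitrary R)
      ((pj_eq_of_mem subset_rfl (pj_mem _ _)).symm.trans (pj_eq_one (by simp) (pj_mem _ _)))
  change c s h = c s h - c s (pr Finset.univ h)
  rw [h2, sub_zero]

theorem outVan (n : ℕ) : ∀ (i : ℕ) (R : Type) [Fintype R] [DecidableEq R] [Nonempty R],
    2 * i + Fintype.card R + 2 ≤ n → 2 ≤ n → OutVan n R i := by
  intro i
  induction i using Nat.strong_induction_on with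
  | _ i ih =>
    intro R _ _ _ hn hn2 c hc hc0
    have hfree := isFreeGroup_InnF hn2
    let C := hs (MulAut (FreeGroup (Fin n))) (MulAut (FreeGroup (Fin n))) (OutF n) (T n R)
    let ρ : MulAut (FreeGroup (Fin n)) := 1
    have hfr : ∀ g s : MulAut (FreeGroup (Fin n)), g • s = s → g = 1 := fun g s => free_mul ⊤ g trivial s
    let ν : List (MulAut (FreeGroup (Fin n))) → List (OutF n) → (R → FreeGroup (Fin n)) → ℤ :=
      fun s v => edge (V := MulAut (FreeGroup (Fin n))) c v s
    have hνc : ∀ s, s ≠ [] → ν s = 0 := fun s hs => by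
      funext v
      exact if_neg hs
    have hν0 : ν [] = c := funext fun v => edge_nil c v
    have hν : ν ∈ C.D 0 (i + 1) := by
      have h1 := edge_mem (V := MulAut (FreeGroup (Fin n))) (X := Set.univ) (Set.mem_univ _) hc
      refine ⟨fun g hg s v z => h1.1 g hg v s z, fun s v => h1.2.1 v s,
        fun s hs => hνc s fun h => hs (by rw [h]; rfl), fun s v hv => ?_⟩
      exact congrFun (h1.2.2.1 v (by simpa using hv)) s
    have hdν : C.dX ν = 0 := by
      funext s
      rw [hs_dX]
      by_cases hs : s = []
      · rw [hs, hν0, hc0]; rfl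
      · rw [hνc s hs, map_zero]; rfl
    obtain ⟨l, hl, hL'⟩ := C.flip.exists_link (k := i + 1) (fun p q _ x hx _ hx0 => by
      obtain ⟨y, hy, e⟩ := hs_exX (V := OutF n) (N := T n R) hfr q p _ (C.dS_mem hx) hx0
      exact ⟨0, zero_mem _, map_zero _, fun _ => rfl, y, hy, by
        rw [map_zero, zero_add]; exact e.symm⟩) hν hdν
    have hL : C.Link (i + 1) ν l := C.flip.link_flip hL'
    have hl0 : C.dS l = 0 := by
      obtain ⟨e, -, h2, -, rfl⟩ := hL
      refine injX_dbl (hX := faceClosed_univ) (hK := fun _ _ _ _ => Set.mem_univ _)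
        (Classical.arbitrary (OutF n)) (Set.mem_univ _) (i + 2) _ (C.dS_mem hl) ?_
      change C.dX (C.dS (e (i + 1))) = 0
      rw [← C.comm, ← h2 i (by omega), C.dS_dS]
    have hle : l = edge fun s => l s [] := by
      funext s v
      cases v with
      | nil => exact (edge_nil _ _).symm
      | cons a v => exact hl.2.2.2 _ _ (Or.inr (by simp))
    obtain ⟨b, hb, hb0, hbl⟩ := null_top_of_van hn (at_nil_mem hl) (by
      rw [del_at]
      funext s
      exact congrFun (congrFun hl0 s) [])
    cases i with
    | zero =>
      have hlz : l = 0 := by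
        rw [hle, ← hbl, hb0 rfl, map_zero, map_zero]
      have hν1 : ν = 0 := by
        refine hs_injS ρ ν hν ?_
        obtain ⟨e, -, h2, h3, h4⟩ := hL
        rw [← h3, h2 0 (by omega), h4, hlz, map_zero]
      rw [← hν0, hν1]
      exact Null.zero
    | succ i =>
      obtain ⟨m, hm, hmν⟩ := C.link_boundary (k := i + 1) (fun p q hpq => hs_E2 ρ hfr outF_fix
          (fun g hg f hf z => T_conj hg hf z) T_stable fun hp =>
            vanHom_out hn2 (ih q (by omega) (Option R) (by rw [Fintype.card_option]; omega) hn2))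
        (fun x hx hx0 => hs_injS ρ x hx hx0) hL
        ⟨edge b, edge_mem (Set.mem_univ _) hb, by
          change del (edge b) = l
          rw [del_edge, hbl, ← hle]⟩
      refine ⟨m [], ⟨fun g hg v z => hm.1 g hg [] v z, hm.2.1 [], fun v hv =>
        hm.2.2.2 [] v (Or.inr hv)⟩, fun h => by omega, ?_⟩
      rw [← hν0, ← hmν, hs_dX]

end Out

end WordCx

namespace WordCx

section Bar

variable {O M : Type*} [Group O] [AddCommGroup M]

/-- Successive quotients of a word starting at `a`. -/
def steps : O → List O → List O
  | _, [] => []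
  | a, b :: t => (a⁻¹ * b) :: steps b t

/-- Partial products of a word starting at `a`. -/
def prods : O → List O → List O
  | _, [] => []
  | a, g :: t => (a * g) :: prods (a * g) t

@[simp] lemma steps_prods (a : O) (t : List O) : steps a (prods a t) = t := by
  induction t generalizing a with
  | nil => rfl
  | cons g t ih => simp [steps, prods, ih]

lemma prods_steps (c d : O) (t : List O) : prods c (steps d t) = t.map (c * d⁻¹ * ·) := by
  induction t generalizing c d with
  | nil => rfl
  | cons b t ih => simp [steps, prods, ih, mul_assoc]

@[simp] lemma length_steps (a : O) (t : List O) : (steps a t).length = t.length := by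
  induction t generalizing a with
  | nil => rfl
  | cons b t ih => simp [steps, ih]

lemma steps_mul (g a : O) (t : List O) : steps (g * a) (t.map (g * ·)) = steps a t := by
  induction t generalizing a with
  | nil => rfl
  | cons b t ih => simp [steps, ih, mul_assoc]

/-- Multiply the letters in positions `j` and `j + 1`, or delete the last letter. -/
def contr : ℕ → List O → List O
  | _, [] => []
  | 0, [_] => []
  | 0, g :: h :: t => (g * h) :: t
  | j + 1, g :: t => g :: contr j t

lemma steps_eraseIdx (a : O) (t : List O) (j : ℕ) :
    steps a (t.eraseIdx j) = contr j (steps a t) := by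
  induction j generalizing a t with
  | zero =>
    match t with
    | [] => rfl
    | [b] => rfl
    | b :: c :: t => simp [steps, contr, mul_assoc]
  | succ j ih =>
    cases t with
    | nil => rfl
    | cons b t => simp [steps, contr, ih]

lemma contr_ofFn {m : ℕ} (g : Fin (m + 1) → O) (j : Fin (m + 1)) :
    contr j (List.ofFn g) = List.ofFn (Fin.contractNth j (· * ·) g) := by
  induction m with
  | zero =>
    obtain rfl : j = 0 := Fin.fin_one_eq_zero j
    simp [contr]
  | succ m ih =>
    cases j using Fin.cases with
    | zero =>
      rw [List.ofFn_succ, List.ofFn_succ, List.ofFn_succ]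
      refine congrArg₂ List.cons ?_ (congrArg List.ofFn (funext fun k => ?_))
      · rw [Fin.contractNth_apply_of_eq _ _ _ _ rfl]; rfl
      · rw [Fin.contractNth_apply_of_gt _ _ _ _ (by simp)]
    | succ j =>
      rw [List.ofFn_succ, List.ofFn_succ (f := Fin.contractNth _ _ _)]
      rw [Fin.val_succ, contr]
      refine congrArg₂ List.cons ?_ ((ih (fun k => g k.succ) j).trans
        (congrArg List.ofFn (funext fun k => ?_)))
      · rw [Fin.contractNth_apply_of_lt _ _ _ _ (by simp)]; rfl
      · simp [Fin.contractNth]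

omit [Group O] in
lemma del_eq_sum (c : List O → M) (s : List O) :
    del c s = ∑ k ∈ Finset.range s.length, (-1 : ℤ) ^ k • c (s.eraseIdx k) := by
  induction s generalizing c with
  | nil => simp
  | cons a s ih =>
    rw [del_cons, ih, List.length_cons, Finset.sum_range_succ', add_comm, sub_eq_add_neg,
      ← Finset.sum_neg_distrib]
    simp [pow_succ]

variable (ρ : Representation ℤ O M)

/-- The homogeneous cochain of an inhomogeneous cochain. -/
def homog (X : List O → M) : List O → M
  | [] => 0
  | a :: t => ρ a (X (steps a t))

/-- Extend a function on tuples to words. -/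
def toL {j : ℕ} (x : (Fin j → O) → M) (l : List O) : M :=
  if h : l.length = j then x fun k => l.get (k.cast h.symm) else 0

omit [Group O] in
lemma toL_ofFn {j : ℕ} (x : (Fin j → O) → M) (g : Fin j → O) : toL x (List.ofFn g) = x g := by
  simp [toL]

omit [Group O] in
lemma toL_of_ne {j : ℕ} (x : (Fin j → O) → M) {l : List O} (h : l.length ≠ j) : toL x l = 0 :=
  dif_neg h

omit [Group O] in
lemma exists_ofFn {j : ℕ} {l : List O} (h : l.length = j) : ∃ g : Fin j → O, l = List.ofFn g := by
  subst h
  exact ⟨l.get, (List.ofFn_get l).symm⟩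

/-- The inhomogeneous differential. -/
def bard {j : ℕ} (x : (Fin j → O) → M) (g : Fin (j + 1) → O) : M :=
  ρ (g 0) (x fun i => g i.succ) +
    ∑ k : Fin (j + 1), (-1 : ℤ) ^ ((k : ℕ) + 1) • x (Fin.contractNth k (· * ·) g)

lemma del_homog {j : ℕ} (x : (Fin j → O) → M) {a : O} {t : List O} {g : Fin (j + 1) → O}
    (h : steps a t = List.ofFn g) : del (homog ρ (toL x)) (a :: t) = ρ a (bard ρ x g) := by
  have h1 : (fun u => homog ρ (toL x) (a :: u)) = fun u => ρ a (toL x (steps a u)) := rfl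
  have hl : t.length = j + 1 := by rw [← length_steps a t, h, List.length_ofFn]
  rw [del_cons, h1, del_eq_sum, bard, map_add, map_sum, sub_eq_add_neg, ← Finset.sum_neg_distrib,
    hl, Finset.sum_range]
  congr 1
  · cases t with
    | nil => simp at hl
    | cons b t =>
      rw [steps, List.ofFn_succ, List.cons.injEq] at h
      rw [homog, h.2, toL_ofFn, ← h.1, ← Module.End.mul_apply, ← map_mul, mul_inv_cancel_left]
  · refine Finset.sum_congr rfl fun k _ => ?_
    rw [steps_eraseIdx, h, contr_ofFn, toL_ofFn, pow_succ, mul_neg_one, neg_smul, map_neg, map_zsmul]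

lemma homog_prods {j : ℕ} (x : (Fin j → O) → M) (g : Fin j → O) :
    homog ρ (toL x) (1 :: prods 1 (List.ofFn g)) = x g := by
  rw [homog, steps_prods, toL_ofFn, map_one]; rfl

lemma homog_of_ne {j : ℕ} (x : (Fin j → O) → M) {s : List O} (hs : s.length ≠ j + 1) :
    homog ρ (toL x) s = 0 := by
  cases s with
  | nil => rfl
  | cons a t => rw [homog, toL_of_ne x (by simpa using hs), map_zero]

lemma del_homog_eq_zero {j : ℕ} {x : (Fin j → O) → M} (hx : bard ρ x = 0) :
    del (homog ρ (toL x)) = 0 := by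
  funext s
  by_cases hs : s.length = j + 2
  · obtain ⟨a, t, rfl⟩ := List.exists_cons_of_length_eq_add_one hs
    obtain ⟨g, hg⟩ := exists_ofFn (j := j + 1) (l := steps a t) (by simpa using hs)
    rw [del_homog ρ x hg, hx]
    exact map_zero _
  · exact del_eq_zero fun t _ ht => homog_of_ne ρ x (by omega)

end Bar

end WordCx

namespace WordCx

open scoped Pointwise

section Dual

variable {n : ℕ}

/-- Evaluate a functional on the abelianization at an element of the free group. -/
def evalAb (n : ℕ) : Module.Dual ℤ (AbH n) →+ ((Unit → FreeGroup (Fin n)) → ℤ) where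
  toFun φ h := φ (Additive.ofMul (Abelianization.of (h ())))
  map_zero' := rfl
  map_add' _ _ := rfl

lemma evalAb_injective : Function.Injective (evalAb n) := by
  intro φ φ' h
  refine LinearMap.ext fun z => ?_
  obtain ⟨x, hx⟩ := QuotientGroup.mk_surjective z.toMul
  have h1 := congrFun h fun _ => x
  change φ (Additive.ofMul (Abelianization.of x)) = φ' (Additive.ofMul (Abelianization.of x)) at h1
  change Abelianization.of x = z.toMul at hx
  rwa [hx] at h1

lemma evalAb_mem (φ : Module.Dual ℤ (AbH n)) : evalAb n φ ∈ T n Unit := by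
  intro h r x y
  change φ (Additive.ofMul (Abelianization.of (Function.update h () (x * y) ()))) =
    φ (Additive.ofMul (Abelianization.of (Function.update h () x ()))) +
    φ (Additive.ofMul (Abelianization.of (Function.update h () y ())))
  simp only [Function.update_self, map_mul, ofMul_mul, map_add]

lemma exists_evalAb {f : (Unit → FreeGroup (Fin n)) → ℤ} (hf : f ∈ T n Unit) :
    ∃ φ, evalAb n φ = f := by
  have hu : ∀ (h : Unit → FreeGroup (Fin n)) x, Function.update h () x = fun _ => x :=
    fun h x => funext fun _ => Function.update_self _ _ _
  have hm : ∀ x y, f (fun _ => x * y) = f (fun _ => x) + f (fun _ => y) := by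
    intro x y
    have h1 := hf (fun _ => 1) () x y
    rwa [hu, hu, hu] at h1
  let F : FreeGroup (Fin n) →* Multiplicative ℤ :=
    MonoidHom.mk' (fun x => Multiplicative.ofAdd (f fun _ => x)) fun x y => by
      rw [hm]; rfl
  refine ⟨(AddMonoidHom.toIntLinearMap (MonoidHom.toAdditiveLeft (Abelianization.lift F))), ?_⟩
  funext h
  rfl

lemma evalAb_smul (g : MulAut (FreeGroup (Fin n))) (φ : Module.Dual ℤ (AbH n))
    (h : Unit → FreeGroup (Fin n)) :
    evalAb n ((abRepOut n).dual ((g : AutF n) : OutF n) φ) (g • h) = evalAb n φ h := by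
  change φ (abRep n (g : AutF n)⁻¹ (Additive.ofMul (Abelianization.of (g (h ()))))) = _
  change φ (Additive.ofMul (Abelianization.of (g⁻¹ (g (h ()))))) = _
  rw [MulAut.inv_apply_self]
  rfl

lemma sm_out (g : MulAut (FreeGroup (Fin n))) (s : List (OutF n)) :
    sm g s = s.map (((g : AutF n) : OutF n) * ·) := by
  induction s with
  | nil => rfl
  | cons a s ih =>
    rw [sm_cons, ih, List.map_cons]
    rfl

lemma evalAb_homog_mem {j : ℕ} (x : (Fin j → OutF n) → Module.Dual ℤ (AbH n)) :
    (fun s => evalAb n (homog (abRepOut n).dual (toL x) s)) ∈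
      Co (⊤ : Subgroup (MulAut (FreeGroup (Fin n)))) (T n Unit) (j + 1) := by
  refine ⟨fun g _ s z => ?_, fun s => evalAb_mem _, fun s hs => ?_⟩
  · cases s with
    | nil => rfl
    | cons a t =>
      rw [sm_out, List.map_cons]
      simp only [homog, steps_mul, map_mul, Module.End.mul_apply]
      exact evalAb_smul g _ z
  · change evalAb n _ = 0
    rw [homog_of_ne _ x hs, map_zero]

lemma exists_homog {j : ℕ} {b : List (OutF n) → (Unit → FreeGroup (Fin n)) → ℤ}
    (hb : b ∈ Co (⊤ : Subgroup (MulAut (FreeGroup (Fin n)))) (T n Unit) (j + 1)) :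
    ∃ y : (Fin j → OutF n) → Module.Dual ℤ (AbH n),
      (fun s => evalAb n (homog (abRepOut n).dual (toL y) s)) = b := by
  choose y hy using fun g : Fin j → OutF n => exists_evalAb (hb.2.1 (1 :: prods 1 (List.ofFn g)))
  refine ⟨y, funext fun s => ?_⟩
  have hc := evalAb_homog_mem y
  by_cases hs : s.length = j + 1
  · obtain ⟨a, t, rfl⟩ := List.exists_cons_of_length_eq_add_one hs
    obtain ⟨g, hg⟩ := exists_ofFn (j := j) (l := steps a t) (by simpa using hs)
    obtain ⟨γ, hγ⟩ := QuotientGroup.mk_surjective a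
    have h1 : sm (γ : MulAut (FreeGroup (Fin n))) (1 :: prods 1 (List.ofFn g)) = a :: t := by
      rw [sm_out, hγ, ← hg, prods_steps, List.map_cons, List.map_map, mul_one]
      simp [Function.comp_def]
    funext z
    have h2 := hc.1 γ trivial (1 :: prods 1 (List.ofFn g)) (γ⁻¹ • z)
    have h3 := hb.1 γ trivial (1 :: prods 1 (List.ofFn g)) (γ⁻¹ • z)
    rw [h1, smul_inv_smul] at h2 h3
    rw [h3, ← hy, ← homog_prods (abRepOut n).dual y]
    exact h2
  · rw [hb.2.2 s hs]
    exact hc.2.2 s hs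

/-- Cocycles on the outer automorphism group with values in the dual of the abelianization are
coboundaries. -/
lemma exists_bard {j : ℕ} (h : 2 * (j + 1) + 3 ≤ n)
    {x : (Fin (j + 1) → OutF n) → Module.Dual ℤ (AbH n)}
    (hx : bard (abRepOut n).dual x = 0) : ∃ y, bard (abRepOut n).dual y = x := by
  obtain ⟨b, hb, -, hbc⟩ := outVan n (j + 1) Unit (by simpa using h) (by omega) _
    (evalAb_homog_mem x) (by
      rw [del_comp, del_homog_eq_zero _ hx]
      exact funext fun s => map_zero _)
  obtain ⟨y, rfl⟩ := exists_homog hb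
  refine ⟨y, funext fun g => evalAb_injective ?_⟩
  have h1 := congrFun hbc (1 :: prods 1 (List.ofFn g))
  rw [del_comp, homog_prods] at h1
  change evalAb n (del (homog _ (toL y)) _) = _ at h1
  rwa [del_homog _ y (steps_prods _ _), map_one] at h1

lemma eq_zero_of_bard (h : 3 ≤ n) {x : (Fin 0 → OutF n) → Module.Dual ℤ (AbH n)}
    (hx : bard (abRepOut n).dual x = 0) : x = 0 := by
  obtain ⟨b, -, hb0, hbc⟩ := outVan n 0 Unit (by simpa using h) (by omega) _
    (evalAb_homog_mem x) (by
      rw [del_comp, del_homog_eq_zero _ hx]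
      exact funext fun s => map_zero _)
  rw [hb0 rfl, map_zero] at hbc
  refine funext fun g => evalAb_injective ?_
  have h1 := congrFun hbc (1 :: prods 1 (List.ofFn g))
  rw [homog_prods] at h1
  exact h1.symm.trans (map_zero _).symm

end Dual

end WordCx

/-- For every `n` and every degree `i ≥ 0` with `2i ≤ n - 6`, the group
cohomology `H^i(Out(F_n); H^*)` vanishes. -/
theorem stmt0 (n : ℕ) (i : ℕ) (h : 2 * i + 6 ≤ n) :
    Limits.IsZero (groupCohomology (dualRepOut n) i) := by
  have hd : ∀ j (x : (Fin j → OutF n) → Module.Dual ℤ (AbH n)),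
      (groupCohomology.inhomogeneousCochains (dualRepOut n)).d j (j + 1) x =
        WordCx.bard (abRepOut n).dual x := by
    intro j x
    rw [groupCohomology.inhomogeneousCochains.d_def]
    rfl
  refine (HomologicalComplex.exactAt_iff_isZero_homology _ i).1 ?_
  cases i with
  | zero =>
    rw [HomologicalComplex.exactAt_iff' _ 0 0 1 (by simp) (by simp), ShortComplex.moduleCat_exact_iff]
    intro x hx
    refine ⟨0, ?_⟩
    rw [map_zero]
    exact (WordCx.eq_zero_of_bard (by omega) ((hd 0 x).symm.trans hx)).symm
  | succ j =>
    rw [HomologicalComplex.exactAt_iff' _ j (j + 1) (j + 2) (by simp) (by simp),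
      ShortComplex.moduleCat_exact_iff]
    intro x hx
    obtain ⟨y, hy⟩ := WordCx.exists_bard (by omega) ((hd (j + 1) x).symm.trans hx)
    exact ⟨y, (hd j y).trans hy⟩
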